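/- Let γ ∈ (0,1/2). Assume the density of ν_γ with respect to Lebesgue measure is bounded by V(γ) x^{−γ} for some constant V(γ) > 0. Let f be positive and nondecreasing on (0,1) with f(x) ≤ C (1−x)^{−a} for some constant C > 0 and some a with 0 ≤ a < 1/2 − γ/(2(1−γ)). Then ν_γ(f > t) ≤ (V(γ)/(1−γ)) (1 − (1 − (C/t)^{1/a})^{1−γ}) for all t > C (when a > 0), and n^{−1/2} S_n(f − ν_γ(f)) converges in distribution, on ([0,1], ν_γ), to a centered Gaussian law. -/

import Mathlib

open MeasureTheory ProbabilityTheory Filter Set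
open scoped ENNReal NNReal Topology

noncomputable section

/-- The intermittent (Liverani–Saussol–Vaienti) map `T_γ` on `[0,1]`. -/
def Tmap (γ : ℝ) (x : ℝ) : ℝ :=
  if x < 1/2 then x * (1 + 2 ^ γ * x ^ γ) else 2 * x - 1

/-- `K` is the Perron–Frobenius operator of `T_γ` with respect to `ν`:
`ν(f · g∘T_γ) = ν(K f · g)` for all bounded measurable `f, g`. -/
def IsPFOp (γ : ℝ) (ν : Measure ℝ) (K : (ℝ → ℝ) → ℝ → ℝ) : Prop :=
  ∀ f g : ℝ → ℝ, Measurable f → Measurable g → (∃ C, ∀ x, |f x| ≤ C) →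
    (∃ C, ∀ x, |g x| ≤ C) →
    ∫ x, f x * g (Tmap γ x) ∂ν = ∫ x, (K f) x * g x ∂ν

/-- Birkhoff sums `S_n(f) = ∑_{i=1}^n f ∘ T_γ^i`. -/
def Sn (γ : ℝ) (f : ℝ → ℝ) (n : ℕ) (x : ℝ) : ℝ :=
  ∑ i ∈ Finset.range n, f ((Tmap γ)^[i + 1] x)

/-- The class `H_{α,1}` of `α`-Hölder functions (with constant 1) on `[0,1]`. -/
def Hclass (α : ℝ) : Set (ℝ → ℝ) :=
  {f | ∀ x ∈ Set.Icc (0:ℝ) 1, ∀ y ∈ Set.Icc (0:ℝ) 1, |f x - f y| ≤ |x - y| ^ α}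

/-- `f_t = 1_{(-∞, t]}`. -/
def indic (t : ℝ) : ℝ → ℝ := Set.indicator (Set.Iic t) (fun _ => 1)

/-- Nested operator `K^{(n_1,…,n_k)}(f_1,…,f_k)
= K^{n_1}(f_1 · K^{n_2}(f_2 ⋯ K^{n_k}(f_k)⋯))`, encoded by a list of pairs. -/
def nestedK (K : (ℝ → ℝ) → ℝ → ℝ) : List (ℕ × (ℝ → ℝ)) → ℝ → ℝ
  | [] => fun _ => 1
  | (n, f) :: r => K^[n] (fun x => f x * nestedK K r x)

/-- The list `[(n, f_{t_1}), (n_2, f_{t_2}), …, (n_l, f_{t_l})]`. -/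
def tList (n : ℕ) {l : ℕ} (ns : Fin l → ℕ) (ts : Fin (l + 1) → ℝ) :
    List (ℕ × (ℝ → ℝ)) :=
  (n, indic (ts 0)) :: List.ofFn (fun i : Fin l => (ns i, indic (ts i.succ)))

/-- The coefficient `α_1(n)` for an operator `K` with invariant measure `ν`. -/
def alpha1 (K : (ℝ → ℝ) → ℝ → ℝ) (ν : Measure ℝ) (n : ℕ) : ℝ :=
  ⨆ t : ℝ, ∫ x, |K^[n] (indic t) x - ∫ y, indic t y ∂ν| ∂ν

/-- The dependence coefficient `α_k(n)`. -/
def alphaCoef (K : (ℝ → ℝ) → ℝ → ℝ) (ν : Measure ℝ) (k n : ℕ) : ℝ :=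
  max (alpha1 K ν n)
    (⨆ j : Fin (k - 1), ⨆ ns : {m : Fin (j.1 + 1) → ℕ // ∀ i, 1 ≤ m i},
      ⨆ ts : Fin (j.1 + 2) → ℝ,
        ∫ x, |nestedK K (tList n ns.1 ts) x - ∫ y, nestedK K (tList n ns.1 ts) y ∂ν| ∂ν)

/-- The dependence coefficient `β_1(n)`. -/
def beta1 (K : (ℝ → ℝ) → ℝ → ℝ) (ν : Measure ℝ) (n : ℕ) : ℝ :=
  ∫ x, (⨆ t : ℝ, |K^[n] (indic t) x - ∫ y, indic t y ∂ν|) ∂ν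

/-- The dependence coefficient `β_k(n)`. -/
def betaCoef (K : (ℝ → ℝ) → ℝ → ℝ) (ν : Measure ℝ) (k n : ℕ) : ℝ :=
  max (beta1 K ν n)
    (⨆ j : Fin (k - 1), ⨆ ns : {m : Fin (j.1 + 1) → ℕ // ∀ i, 1 ≤ m i},
      ∫ x, (⨆ ts : Fin (j.1 + 2) → ℝ,
        |nestedK K (tList n ns.1 ts) x - ∫ y, nestedK K (tList n ns.1 ts) y ∂ν|) ∂ν)

/-- The operator associated with a Markov transition kernel: `(Kg)(x) = ∫ g(y) K(x,dy)`. -/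
def Kop (K : Kernel ℝ ℝ) (g : ℝ → ℝ) : ℝ → ℝ := fun x => ∫ y, g y ∂(K x)

/-- The class `Mon(M,p,μ)` of monotonic functions on an open interval, vanishing
elsewhere, with tail condition `μ(|g|>t) ≤ M^p t^{-p}` (for `p < ∞`),
resp. `μ(|g|>M) = 0` (for `p = ∞`). -/
def Mon (M : ℝ) (p : ℝ≥0∞) (μ : Measure ℝ) (g : ℝ → ℝ) : Prop :=
  (∃ I : Set ℝ, IsOpen I ∧ I.OrdConnected ∧ (MonotoneOn g I ∨ AntitoneOn g I) ∧
      ∀ x ∉ I, g x = 0) ∧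
  (if p = ∞ then μ {x | M < |g x|} = 0
   else ∀ t : ℝ, 0 < t →
      μ {x | t < |g x|} ≤ ENNReal.ofReal (M ^ p.toReal * t ^ (-p.toReal)))

/-- The class `C(M,p,μ)`: the closure in `L¹(μ)` of convex-type combinations
`∑ a_i g_i`, `∑ |a_i| ≤ 1`, `g_i ∈ Mon(M,p,μ)`. -/
def ClassC (M : ℝ) (p : ℝ≥0∞) (μ : Measure ℝ) (f : ℝ → ℝ) : Prop :=
  Integrable f μ ∧ ∀ ε : ℝ, 0 < ε → ∃ (n : ℕ) (a : Fin n → ℝ) (g : Fin n → ℝ → ℝ),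
    (∑ i, |a i|) ≤ 1 ∧ (∀ i, Mon M p μ (g i)) ∧
    ∫ x, |f x - ∑ i, a i * g i x| ∂μ < ε

/-- The class `Lip_c` of functions `g` with `|g(x) − g(y)| ≤ c(|x−y|)`. -/
def LipC (c : ℝ → ℝ) : Set (ℝ → ℝ) := {g | ∀ x y : ℝ, |g x - g y| ≤ c |x - y|}

/-- The distance `d_c(P,Q) = sup_{g ∈ Lip_c} |P(g) − Q(g)|`. -/
def dC (c : ℝ → ℝ) (P Q : Measure ℝ) : ℝ :=
  ⨆ g : LipC c, |(∫ x, (g : ℝ → ℝ) x ∂P) - ∫ x, (g : ℝ → ℝ) x ∂Q|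


lemma norm_exp_sub_one_add_mul_exp_le {y : ℝ} (hy : |y| ≤ 1) :
    ‖Complex.exp (Complex.I * y) - (1 + Complex.I * y) * (Real.exp (-(y ^ 2 / 2)) : ℝ)‖
      ≤ 2 * |y| ^ 3 := by
  have h1 : ‖Complex.exp (Complex.I * y) - (1 + Complex.I * y - (y ^ 2 / 2 : ℝ))‖
      ≤ |y| ^ 3 * (2 / 9) := by
    have h := Complex.exp_bound (x := Complex.I * y) (by simpa using hy) (n := 3) (by norm_num)
    have h2 : ∑ m ∈ Finset.range 3, (Complex.I * y) ^ m / (m.factorial : ℂ)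
        = 1 + Complex.I * y - (y ^ 2 / 2 : ℝ) := by
      simp [Finset.sum_range_succ, mul_pow, Nat.factorial]
      ring
    rw [h2] at h
    refine h.trans (le_of_eq ?_)
    simp [Nat.factorial]
    norm_num
  have h2 : ‖((Real.exp (-(y ^ 2 / 2)) - 1 + y ^ 2 / 2 : ℝ) : ℂ)‖ ≤ |y| ^ 3 * (1 / 4) := by
    have hy2 : |y| ^ 2 ≤ 1 := pow_le_one₀ (abs_nonneg _) hy
    have h := Real.norm_exp_sub_one_sub_id_le (x := -(y ^ 2 / 2))
      (by rw [norm_neg, Real.norm_of_nonneg (by positivity)]; rw [sq_abs] at hy2; linarith)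
    rw [Complex.norm_real]
    have h3 : ‖-(y ^ 2 / 2)‖ ^ 2 = |y| ^ 3 * (|y| / 4) := by
      rw [norm_neg, Real.norm_of_nonneg (by positivity),
        show |y| ^ 3 * (|y| / 4) = (|y| ^ 2 / 2) ^ 2 by ring, sq_abs]
    rw [h3] at h
    refine le_trans (le_of_eq ?_) (h.trans ?_)
    · congr 1; ring
    · gcongr
  have h3 : ‖(1 + Complex.I * y : ℂ)‖ ≤ 2 := by
    refine (norm_add_le _ _).trans ?_
    simp only [norm_one, norm_mul, Complex.norm_I, Complex.norm_real, Real.norm_eq_abs]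
    linarith
  have h4 : ‖(Complex.I * (y ^ 3 / 2 : ℝ) : ℂ)‖ ≤ |y| ^ 3 * (1 / 2) := by
    simp; linarith
  have key : Complex.exp (Complex.I * y) - (1 + Complex.I * y) * (Real.exp (-(y ^ 2 / 2)) : ℝ)
      = (Complex.exp (Complex.I * y) - (1 + Complex.I * y - (y ^ 2 / 2 : ℝ)))
        - (1 + Complex.I * y) * ((Real.exp (-(y ^ 2 / 2)) - 1 + y ^ 2 / 2 : ℝ) : ℂ)
        + Complex.I * (y ^ 3 / 2 : ℝ) := by
    push_cast; ring
  rw [key]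
  refine (norm_add_le _ _).trans ?_
  have h5 := norm_sub_le (Complex.exp (Complex.I * y) - (1 + Complex.I * y - (y ^ 2 / 2 : ℝ)))
    ((1 + Complex.I * y) * ((Real.exp (-(y ^ 2 / 2)) - 1 + y ^ 2 / 2 : ℝ) : ℂ))
  rw [norm_mul] at h5
  have h6 := mul_le_mul h3 h2 (norm_nonneg _) (by norm_num)
  have h7 : 0 ≤ |y| ^ 3 := by positivity
  linarith

lemma norm_one_add_I_mul_le (y : ℝ) : ‖(1 + Complex.I * y : ℂ)‖ ≤ Real.exp (y ^ 2 / 2) := by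
  have h : ‖(1 + Complex.I * y : ℂ)‖ ^ 2 = 1 + y ^ 2 := by
    rw [Complex.sq_norm, Complex.normSq_apply]; simp; ring
  refine le_of_sq_le_sq ?_ (Real.exp_pos _).le
  rw [h, ← Real.exp_nat_mul]
  have := Real.add_one_le_exp (y ^ 2)
  refine le_trans (by linarith) (this.trans (le_of_eq ?_))
  congr 1; push_cast; ring

lemma norm_prod_sub_prod_le_sum {ι : Type*} (s : Finset ι) (a b : ι → ℂ)
    (ha : ∀ i ∈ s, ‖a i‖ ≤ 1) (hb : ∀ i ∈ s, ‖b i‖ ≤ 1) :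
    ‖∏ i ∈ s, a i - ∏ i ∈ s, b i‖ ≤ ∑ i ∈ s, ‖a i - b i‖ := by
  classical
  induction s using Finset.induction_on with
  | empty => simp
  | insert i s hi ih =>
    rw [Finset.prod_insert hi, Finset.prod_insert hi, Finset.sum_insert hi]
    have ih' := ih (fun j hj => ha j (Finset.mem_insert_of_mem hj))
      (fun j hj => hb j (Finset.mem_insert_of_mem hj))
    have e : a i * ∏ j ∈ s, a j - b i * ∏ j ∈ s, b j
        = a i * (∏ j ∈ s, a j - ∏ j ∈ s, b j) + (a i - b i) * ∏ j ∈ s, b j := by ring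
    rw [e]
    refine (norm_add_le _ _).trans ?_
    rw [norm_mul, norm_mul]
    have h1 : ‖∏ j ∈ s, b j‖ ≤ 1 := by
      rw [norm_prod]
      exact Finset.prod_le_one (fun _ _ => norm_nonneg _)
        (fun j hj => hb j (Finset.mem_insert_of_mem hj))
    have h2 := ha i (Finset.mem_insert_self _ _)
    have h3 := mul_le_mul h2 ih' (norm_nonneg _) zero_le_one
    have h4 := mul_le_mul_of_nonneg_left h1 (norm_nonneg (a i - b i))
    linarith

lemma norm_exp_I_mul_sub_exp_I_mul_le (a b : ℝ) :
    ‖Complex.exp (Complex.I * a) - Complex.exp (Complex.I * b)‖ ≤ |a - b| := by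
  have h : Complex.exp (Complex.I * a) - Complex.exp (Complex.I * b)
      = Complex.exp (Complex.I * b) * (Complex.exp (Complex.I * (a - b : ℝ)) - 1) := by
    rw [mul_sub, ← Complex.exp_add]; push_cast; ring_nf
  rw [h, norm_mul, mul_comm Complex.I, Complex.norm_exp_ofReal_mul_I, one_mul]
  exact Real.norm_exp_I_mul_ofReal_sub_one_le

/-- Pointwise comparison behind McLeish's proof of the martingale central limit theorem. -/
lemma norm_exp_sum_sub_prod_le {n : ℕ} (y : ℕ → ℝ) {δ s : ℝ} (hδ : δ ≤ 1)
    (hy : ∀ i, |y i| ≤ δ) :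
    ‖Complex.exp (Complex.I * (∑ i ∈ Finset.range n, y i : ℝ))
      - (∏ i ∈ Finset.range n, (1 + Complex.I * y i)) * (Real.exp (-s) : ℝ)‖
      ≤ n * (2 * δ ^ 3) + Real.exp (n * δ ^ 2 / 2) *
        |Real.exp (-(∑ i ∈ Finset.range n, y i ^ 2) / 2) - Real.exp (-s)| := by
  have hδ0 : 0 ≤ δ := (abs_nonneg _).trans (hy 0)
  have e1 : Complex.exp (Complex.I * (∑ i ∈ Finset.range n, y i : ℝ))
      = ∏ i ∈ Finset.range n, Complex.exp (Complex.I * y i) := by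
    rw [← Complex.exp_sum]; push_cast; rw [Finset.mul_sum]
  have e2 : (∏ i ∈ Finset.range n, (1 + Complex.I * y i)) *
      (Real.exp (-(∑ i ∈ Finset.range n, y i ^ 2) / 2) : ℝ)
      = ∏ i ∈ Finset.range n, ((1 + Complex.I * y i) * (Real.exp (-(y i ^ 2 / 2)) : ℝ)) := by
    rw [Finset.prod_mul_distrib]
    congr 1
    rw [← Complex.ofReal_prod, ← Real.exp_sum]
    congr 2
    rw [Finset.sum_neg_distrib, ← Finset.sum_div, neg_div]
  have h1 : ‖Complex.exp (Complex.I * (∑ i ∈ Finset.range n, y i : ℝ))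
      - (∏ i ∈ Finset.range n, (1 + Complex.I * y i)) *
      (Real.exp (-(∑ i ∈ Finset.range n, y i ^ 2) / 2) : ℝ)‖ ≤ n * (2 * δ ^ 3) := by
    rw [e1, e2]
    refine (norm_prod_sub_prod_le_sum _ _ _ ?_ ?_).trans ?_
    · intro i _
      rw [mul_comm, Complex.norm_exp_ofReal_mul_I]
    · intro i _
      rw [norm_mul, Complex.norm_real, Real.norm_of_nonneg (Real.exp_pos _).le]
      calc _ ≤ Real.exp (y i ^ 2 / 2) * Real.exp (-(y i ^ 2 / 2)) := by
            gcongr; exact norm_one_add_I_mul_le _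
        _ = 1 := by rw [← Real.exp_add]; simp
    · calc _ ≤ ∑ i ∈ Finset.range n, 2 * δ ^ 3 := by
            refine Finset.sum_le_sum fun i _ => ?_
            refine (norm_exp_sub_one_add_mul_exp_le ((hy i).trans hδ)).trans ?_
            have := pow_le_pow_left₀ (abs_nonneg _) (hy i) 3
            linarith
        _ = _ := by simp
  have h2 : ‖∏ i ∈ Finset.range n, (1 + Complex.I * y i)‖ ≤ Real.exp (n * δ ^ 2 / 2) := by
    rw [norm_prod]
    calc _ ≤ ∏ i ∈ Finset.range n, Real.exp (δ ^ 2 / 2) := by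
          refine Finset.prod_le_prod (fun _ _ => norm_nonneg _) fun i _ => ?_
          refine (norm_one_add_I_mul_le _).trans (Real.exp_le_exp.2 ?_)
          have := pow_le_pow_left₀ (abs_nonneg _) (hy i) 2
          rw [sq_abs] at this
          linarith
      _ = _ := by
          rw [Finset.prod_const, Finset.card_range, ← Real.exp_nat_mul]
          congr 1; ring
  have e3 : Complex.exp (Complex.I * (∑ i ∈ Finset.range n, y i : ℝ))
      - (∏ i ∈ Finset.range n, (1 + Complex.I * y i)) * (Real.exp (-s) : ℝ)
      = (Complex.exp (Complex.I * (∑ i ∈ Finset.range n, y i : ℝ))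
      - (∏ i ∈ Finset.range n, (1 + Complex.I * y i)) *
      (Real.exp (-(∑ i ∈ Finset.range n, y i ^ 2) / 2) : ℝ))
      + (∏ i ∈ Finset.range n, (1 + Complex.I * y i)) *
      ((Real.exp (-(∑ i ∈ Finset.range n, y i ^ 2) / 2) - Real.exp (-s) : ℝ) : ℂ) := by
    push_cast; ring
  rw [e3]
  refine (norm_add_le _ _).trans (add_le_add h1 ?_)
  rw [norm_mul, Complex.norm_real, Real.norm_eq_abs]
  gcongr

lemma abs_exp_neg_sub_exp_neg_le {a b : ℝ} (ha : 0 ≤ a) (hb : 0 ≤ b) :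
    |Real.exp (-a) - Real.exp (-b)| ≤ |a - b| := by
  wlog h : a ≤ b generalizing a b
  · rw [abs_sub_comm, abs_sub_comm a b]; exact this hb ha (le_of_not_ge h)
  have h1 : Real.exp (-b) ≤ Real.exp (-a) := Real.exp_le_exp.2 (by linarith)
  rw [abs_of_nonneg (by linarith), abs_of_nonpos (by linarith)]
  have h2 : Real.exp (-b) = Real.exp (-a) * Real.exp (a - b) := by
    rw [← Real.exp_add]; ring_nf
  have h3 := Real.add_one_le_exp (a - b)
  have h4 : Real.exp (-a) ≤ 1 := Real.exp_le_one_iff.2 (by linarith)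
  have h5 : Real.exp (a - b) ≤ 1 := Real.exp_le_one_iff.2 (by linarith)
  rw [h2]
  nlinarith [Real.exp_pos (-a)]

section
variable {Ω : Type*} [MeasurableSpace Ω] {ν : Measure Ω} [IsProbabilityMeasure ν] {T : Ω → Ω}

lemma MeasureTheory.MeasurePreserving.integral_comp_of_aestronglyMeasurable
    {Ω : Type*} [MeasurableSpace Ω] {ν : Measure Ω} {T : Ω → Ω}
    {E : Type*} [NormedAddCommGroup E] [NormedSpace ℝ E]
    (hT : MeasurePreserving T ν ν) {g : Ω → E} (hg : AEStronglyMeasurable g ν) :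
    ∫ x, g (T x) ∂ν = ∫ x, g x ∂ν := by
  conv_rhs => rw [← hT.map_eq]
  rw [integral_map hT.measurable.aemeasurable (by rwa [hT.map_eq])]

lemma integrable_of_abs_le {b : Ω → ℝ} (hb : Measurable b) {M : ℝ} (h : ∀ x, |b x| ≤ M) :
    Integrable b ν :=
  Integrable.of_bound hb.aestronglyMeasurable M (ae_of_all _ h)

lemma sq_integral_abs_le {X : Ω → ℝ} (hX : MemLp X 2 ν) :
    (∫ x, |X x| ∂ν) ^ 2 ≤ ∫ x, X x ^ 2 ∂ν := by
  have h := variance_nonneg (fun x => |X x|) ν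
  have hX' : MemLp (fun x => |X x|) 2 ν := hX.abs
  rw [variance_eq_sub hX'] at h
  simpa using h

/-- Weak law of large numbers along an orbit whose autocorrelations tend to zero. -/
lemma tendsto_integral_abs_average_of_correlation (hT : MeasurePreserving T ν ν)
    {g : Ω → ℝ} (hg : Measurable g) {M : ℝ} (hM : ∀ x, |g x| ≤ M)
    (hmix : Tendsto (fun n => ∫ x, g x * g (T^[n] x) ∂ν) atTop (𝓝 0)) :
    Tendsto (fun n : ℕ => ∫ x, |(n : ℝ)⁻¹ * ∑ i ∈ Finset.range n, g (T^[i] x)| ∂ν)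
      atTop (𝓝 0) := by
  have hTi : ∀ i, Measurable (T^[i]) := fun i => hT.measurable.iterate i
  have hgi : ∀ i, Measurable (fun x => g (T^[i] x)) := fun i => hg.comp (hTi i)
  have hint : ∀ i j, Integrable (fun x => g (T^[i] x) * g (T^[j] x)) ν := fun i j =>
    integrable_of_abs_le ((hgi i).mul (hgi j)) (M := M * M) fun x => by
      rw [abs_mul]; exact mul_le_mul (hM _) (hM _) (abs_nonneg _) ((abs_nonneg _).trans (hM x))
  set c : ℕ → ℝ := fun n => |∫ x, g x * g (T^[n] x) ∂ν| with hc
  have hc0 : Tendsto c atTop (𝓝 0) := by simpa using hmix.abs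
  have hcor : ∀ i k, ∫ x, g (T^[i] x) * g (T^[k + i] x) ∂ν = ∫ x, g x * g (T^[k] x) ∂ν := by
    intro i k
    have := (hT.iterate i).integral_comp_of_aestronglyMeasurable
      (g := fun x => g x * g (T^[k] x)) (hg.mul (hgi k)).aestronglyMeasurable
    rw [← this]
    simp_rw [Function.iterate_add_apply]
  set Q : ℕ → ℝ := fun n => ∫ x, (∑ i ∈ Finset.range n, g (T^[i] x)) ^ 2 ∂ν with hQ
  have hmeasS : ∀ n, Measurable (fun x => ∑ i ∈ Finset.range n, g (T^[i] x)) := fun n =>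
    Finset.measurable_fun_sum _ fun i _ => hgi i
  have hbS : ∀ n x, |∑ i ∈ Finset.range n, g (T^[i] x)| ≤ n * M := fun n x => by
    refine (Finset.abs_sum_le_sum_abs _ _).trans ?_
    refine (Finset.sum_le_sum fun i _ => hM _).trans ?_
    simp
  have hmem : ∀ n, MemLp (fun x => ∑ i ∈ Finset.range n, g (T^[i] x)) 2 ν := fun n =>
    MemLp.of_bound (hmeasS n).aestronglyMeasurable (n * M) (ae_of_all _ (hbS n))
  have hQle : ∀ n : ℕ, Q n ≤ 2 * n * ∑ k ∈ Finset.range n, c k := by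
    intro n
    induction n with
    | zero => simp [hQ]
    | succ n ih =>
      have e : Q (n + 1) = Q n + 2 * (∑ i ∈ Finset.range n, ∫ x, g (T^[i] x) * g (T^[n] x) ∂ν)
          + ∫ x, g (T^[n] x) * g (T^[n] x) ∂ν := by
        rw [← integral_finsetSum _ (fun i _ => hint i n), ← integral_const_mul, ← integral_add,
          ← integral_add]
        · refine integral_congr_ae (ae_of_all _ fun x => ?_)
          simp only [Finset.sum_range_succ]
          rw [← Finset.sum_mul]
          ring
        · exact ((hmem n).integrable_sq).add
            ((integrable_finsetSum _ fun i _ => hint i n).const_mul 2)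
        · exact hint n n
        · exact (hmem n).integrable_sq
        · exact (integrable_finsetSum _ fun i _ => hint i n).const_mul 2
      have h1 : ∑ i ∈ Finset.range n, ∫ x, g (T^[i] x) * g (T^[n] x) ∂ν
          ≤ ∑ k ∈ Finset.range n, c (k + 1) := by
        rw [← Finset.sum_range_reflect]
        refine Finset.sum_le_sum fun i hi => ?_
        have hi' := Finset.mem_range.1 hi
        have : n = (i + 1) + (n - 1 - i) := by omega
        conv_lhs => rw [show T^[n] = T^[(i + 1) + (n - 1 - i)] by rw [← this]]
        rw [hcor]
        exact le_abs_self _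
      have h2 : ∫ x, g (T^[n] x) * g (T^[n] x) ∂ν ≤ c 0 := by
        have := hcor n 0
        rw [zero_add] at this
        rw [this]; exact le_abs_self _
      have h3 : ∑ k ∈ Finset.range (n + 1), c k = ∑ k ∈ Finset.range n, c (k + 1) + c 0 :=
        Finset.sum_range_succ' _ _
      have h4 : ∑ k ∈ Finset.range (n + 1), c k = ∑ k ∈ Finset.range n, c k + c n :=
        Finset.sum_range_succ _ _
      have hc0 : 0 ≤ c 0 := abs_nonneg _
      have hcn : 0 ≤ (n : ℝ) * c n := mul_nonneg (Nat.cast_nonneg _) (abs_nonneg _)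
      have h5 : 2 * (n : ℝ) * ∑ k ∈ Finset.range n, c k
          ≤ 2 * n * ∑ k ∈ Finset.range (n + 1), c k := by rw [h4]; linarith
      push_cast
      linarith
  have hces := hc0.cesaro
  have hsqrt : Tendsto (fun n : ℕ => √(2 * ((n : ℝ)⁻¹ * ∑ k ∈ Finset.range n, c k)))
      atTop (𝓝 0) := by
    simpa using (hces.const_mul 2).sqrt
  refine squeeze_zero (fun n => integral_nonneg fun x => abs_nonneg _) (fun n => ?_) hsqrt
  refine Real.le_sqrt_of_sq_le ((sq_integral_abs_le ((hmem n).const_mul _)).trans ?_)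
  rcases Nat.eq_zero_or_pos n with rfl | hn
  · simp
  have hn' : (0 : ℝ) < n := by exact_mod_cast hn
  simp_rw [mul_pow]
  rw [integral_const_mul]
  calc _ ≤ ((n : ℝ)⁻¹) ^ 2 * (2 * n * ∑ k ∈ Finset.range n, c k) := by
        gcongr; exact hQle n
    _ = _ := by field_simp

/-- Products of complex martingale-type factors integrate to one. -/
lemma integral_prod_one_add_mul_eq_one (hT : MeasurePreserving T ν ν)
    {h : Ω → ℝ} (hm : Measurable h) {M : ℝ} (hM : ∀ x, |h x| ≤ M)
    (hK : ∀ b : Ω → ℝ, Measurable b → (∃ C, ∀ x, |b x| ≤ C) → ∫ x, h x * b (T x) ∂ν = 0)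
    (c : ℂ) (n : ℕ) :
    ∫ x, ∏ i ∈ Finset.range n, (1 + c * h (T^[i] x)) ∂ν = 1 := by
  have hmeas : ∀ n, Measurable (fun x => ∏ i ∈ Finset.range n, (1 + c * h (T^[i] x))) := by
    intro n
    refine Finset.measurable_fun_prod _ fun i _ => ?_
    have := hm.comp (hT.measurable.iterate i)
    exact (measurable_const.mul (Complex.measurable_ofReal.comp this)).const_add 1
  have hbd : ∀ n x, ‖∏ i ∈ Finset.range n, (1 + c * h (T^[i] x))‖ ≤ (1 + ‖c‖ * M) ^ n := by
    intro n x
    rw [norm_prod]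
    refine (Finset.prod_le_prod (fun _ _ => norm_nonneg _) (fun i _ => ?_)).trans
      (le_of_eq (by rw [Finset.prod_const, Finset.card_range]))
    refine (norm_add_le _ _).trans ?_
    rw [norm_one, norm_mul, Complex.norm_real]
    gcongr
    exact hM _
  induction n with
  | zero => simp
  | succ n ih =>
    set R : Ω → ℂ := fun x => ∏ i ∈ Finset.range n, (1 + c * h (T^[i] x)) with hR
    have hRT : Measurable (fun x => R (T x)) := (hmeas n).comp hT.measurable
    have e : ∀ x, ∏ i ∈ Finset.range (n + 1), (1 + c * h (T^[i] x))
        = R (T x) + c * ((h x : ℂ) * R (T x)) := by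
      intro x
      rw [Finset.prod_range_succ']
      simp only [Function.iterate_succ_apply, Function.iterate_zero, id, hR]
      ring
    have i1 : Integrable (fun x => R (T x)) ν :=
      Integrable.of_bound hRT.aestronglyMeasurable _ (ae_of_all _ fun x => hbd n (T x))
    have i2 : Integrable (fun x => (h x : ℂ) * R (T x)) ν := by
      refine Integrable.of_bound (C := M * (1 + ‖c‖ * M) ^ n)
        ((Complex.measurable_ofReal.comp hm).mul hRT).aestronglyMeasurable
        (ae_of_all _ fun x => ?_)
      rw [norm_mul, Complex.norm_real]
      exact mul_le_mul (hM x) (hbd n (T x)) (norm_nonneg _) ((abs_nonneg _).trans (hM x))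
    have hz : ∫ x, (h x : ℂ) * R (T x) ∂ν = 0 := by
      apply Complex.ext
      · have := integral_re i2
        simp only [RCLike.re_eq_complex_re] at this
        rw [← this]
        simp only [Complex.re_ofReal_mul, Complex.zero_re]
        exact hK (fun x => (R x).re) (Complex.measurable_re.comp (hmeas n))
          ⟨_, fun x => (Complex.abs_re_le_norm _).trans (hbd n x)⟩
      · have := integral_im i2
        simp only [RCLike.im_eq_complex_im] at this
        rw [← this]
        simp only [Complex.im_ofReal_mul, Complex.zero_im]
        exact hK (fun x => (R x).im) (Complex.measurable_im.comp (hmeas n))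
          ⟨_, fun x => (Complex.abs_im_le_norm _).trans (hbd n x)⟩
    simp_rw [e]
    rw [integral_add i1 (i2.const_mul c), integral_const_mul, hz, mul_zero, add_zero,
      hT.integral_comp_of_aestronglyMeasurable (hmeas n).aestronglyMeasurable, ih]

/-- Central limit theorem for bounded reverse martingale differences `h ∘ T^i`, in terms of
characteristic functions. -/
lemma tendsto_integral_exp_of_bounded (hT : MeasurePreserving T ν ν)
    (hmix : ∀ b : Ω → ℝ, Measurable b → (∃ C, ∀ x, |b x| ≤ C) →
      Tendsto (fun n => ∫ x, b x * b (T^[n] x) ∂ν) atTop (𝓝 ((∫ x, b x ∂ν) ^ 2)))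
    {h : Ω → ℝ} (hm : Measurable h) {M : ℝ} (hM : ∀ x, |h x| ≤ M)
    (hK : ∀ b : Ω → ℝ, Measurable b → (∃ C, ∀ x, |b x| ≤ C) → ∫ x, h x * b (T x) ∂ν = 0)
    (t : ℝ) :
    Tendsto (fun n : ℕ => ∫ x, Complex.exp (Complex.I *
        (t * ((√n)⁻¹ * ∑ i ∈ Finset.range n, h (T^[i] x)) : ℝ)) ∂ν) atTop
      (𝓝 (Real.exp (-(t ^ 2 * (∫ x, h x ^ 2 ∂ν) / 2)) : ℝ)) := by
  have hM0 : 0 ≤ M := by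
    obtain ⟨x⟩ : Nonempty Ω := ν.nonempty_of_neZero
    exact (abs_nonneg _).trans (hM x)
  set s2 := ∫ x, h x ^ 2 ∂ν with hs2
  have hs20 : 0 ≤ s2 := integral_nonneg fun x => sq_nonneg _
  set s := t ^ 2 * s2 / 2 with hs
  have hhi : ∀ i, Measurable (fun x => h (T^[i] x)) := fun i => hm.comp (hT.measurable.iterate i)
  have hsqb : ∀ x, |h x ^ 2| ≤ M ^ 2 := fun x => by
    rw [abs_pow]; exact pow_le_pow_left₀ (abs_nonneg _) (hM x) 2
  have hsqi : ∀ i, Integrable (fun x => h (T^[i] x) ^ 2) ν := fun i =>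
    integrable_of_abs_le ((hhi i).pow_const 2) (fun x => hsqb _)
  have hlln := tendsto_integral_abs_average_of_correlation hT
    (g := fun x => h x ^ 2 - s2) ((hm.pow_const 2).sub_const _) (M := M ^ 2 + s2)
    (fun x => (abs_sub _ _).trans (add_le_add (hsqb x) (le_of_eq (abs_of_nonneg hs20)))) (by
      have h1 := hmix (fun x => h x ^ 2) (hm.pow_const 2) ⟨_, hsqb⟩
      have h2 := h1.sub_const (s2 ^ 2)
      rw [← hs2, sub_self] at h2
      refine h2.congr fun n => ?_
      have i1 : Integrable (fun x => h x ^ 2 * h (T^[n] x) ^ 2) ν :=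
        integrable_of_abs_le ((hm.pow_const 2).mul ((hhi n).pow_const 2)) (M := M ^ 2 * M ^ 2)
          fun x => by
            rw [abs_mul]; exact mul_le_mul (hsqb _) (hsqb _) (abs_nonneg _) (by positivity)
      have e : ∀ x, (h x ^ 2 - s2) * (h (T^[n] x) ^ 2 - s2)
          = h x ^ 2 * h (T^[n] x) ^ 2 - s2 * h x ^ 2 - s2 * h (T^[n] x) ^ 2 + s2 ^ 2 :=
        fun x => by ring
      simp_rw [e]
      have i2 := (hsqi 0).const_mul s2
      have i3 := (hsqi n).const_mul s2
      simp only [Function.iterate_zero, id] at i2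
      have i12 : Integrable (fun x => h x ^ 2 * h (T^[n] x) ^ 2 - s2 * h x ^ 2) ν := i1.sub i2
      have i123 : Integrable (fun x => h x ^ 2 * h (T^[n] x) ^ 2 - s2 * h x ^ 2
          - s2 * h (T^[n] x) ^ 2) ν := i12.sub i3
      rw [integral_add i123 (integrable_const _), integral_sub i12 i3, integral_sub i1 i2,
        integral_const_mul, integral_const_mul,
        (hT.iterate n).integral_comp_of_aestronglyMeasurable (g := fun x => h x ^ 2)
          (hm.pow_const 2).aestronglyMeasurable, ← hs2]
      simp
      ring)
  have hlim : Tendsto (fun n : ℕ => 2 * (|t| * M) ^ 3 * (√n)⁻¹ + Real.exp ((|t| * M) ^ 2 / 2) *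
      (t ^ 2 / 2 * ∫ x, |(n : ℝ)⁻¹ * ∑ i ∈ Finset.range n, (h (T^[i] x) ^ 2 - s2)| ∂ν))
      atTop (𝓝 0) := by
    have h1 : Tendsto (fun n : ℕ => (√(n : ℝ))⁻¹) atTop (𝓝 0) :=
      tendsto_inv_atTop_zero.comp (Real.tendsto_sqrt_atTop.comp tendsto_natCast_atTop_atTop)
    simpa using (h1.const_mul (2 * (|t| * M) ^ 3)).add
      ((hlln.const_mul (t ^ 2 / 2)).const_mul (Real.exp ((|t| * M) ^ 2 / 2)))
  rw [tendsto_iff_norm_sub_tendsto_zero]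
  refine squeeze_zero' (Eventually.of_forall fun n => norm_nonneg _) ?_ hlim
  have hlarge : ∀ᶠ n : ℕ in atTop, |t| * M ≤ √n :=
    (Real.tendsto_sqrt_atTop.comp tendsto_natCast_atTop_atTop).eventually_ge_atTop (|t| * M)
  filter_upwards [hlarge, eventually_gt_atTop 0] with n hn hn0
  have hn0' : (0 : ℝ) < n := by exact_mod_cast hn0
  have hsn : 0 < √(n : ℝ) := Real.sqrt_pos.2 hn0'
  have hsn2 : √(n : ℝ) ^ 2 = n := Real.sq_sqrt hn0'.le
  set r := t * (√(n : ℝ))⁻¹ with hr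
  have hP := integral_prod_one_add_mul_eq_one hT hm hM hK (Complex.I * r) n
  set δ := |t| * M * (√(n : ℝ))⁻¹ with hδ
  have hδ1 : δ ≤ 1 := by
    rw [hδ, ← div_eq_mul_inv]; exact (div_le_one hsn).2 hn
  have hδ2 : (n : ℝ) * δ ^ 2 = (|t| * M) ^ 2 := by
    rw [hδ, mul_pow, inv_pow, hsn2]; field_simp
  have hδ3 : (n : ℝ) * (2 * δ ^ 3) = 2 * (|t| * M) ^ 3 * (√n)⁻¹ := by
    have : (n : ℝ) * (2 * δ ^ 3) = 2 * (n * δ ^ 2) * δ := by ring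
    rw [this, hδ2, hδ]; ring
  have hyb : ∀ x i, |r * h (T^[i] x)| ≤ δ := fun x i => by
    rw [abs_mul, hr, abs_mul, abs_inv, abs_of_pos hsn, hδ]
    have := hM (T^[i] x)
    calc |t| * (√(n : ℝ))⁻¹ * |h (T^[i] x)| ≤ |t| * (√(n : ℝ))⁻¹ * M := by gcongr
      _ = _ := by ring
  have hpt : ∀ x, ‖Complex.exp (Complex.I *
        (t * ((√n)⁻¹ * ∑ i ∈ Finset.range n, h (T^[i] x)) : ℝ)) -
        (∏ i ∈ Finset.range n, (1 + Complex.I * r * h (T^[i] x))) * (Real.exp (-s) : ℝ)‖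
      ≤ 2 * (|t| * M) ^ 3 * (√n)⁻¹ + Real.exp ((|t| * M) ^ 2 / 2) *
      (t ^ 2 / 2 * |(n : ℝ)⁻¹ * ∑ i ∈ Finset.range n, (h (T^[i] x) ^ 2 - s2)|) := by
    intro x
    have h1 := norm_exp_sum_sub_prod_le (n := n) (fun i => r * h (T^[i] x)) (s := s) hδ1 (hyb x)
    rw [hδ3, hδ2] at h1
    have e1 : (∑ i ∈ Finset.range n, r * h (T^[i] x))
        = t * ((√n)⁻¹ * ∑ i ∈ Finset.range n, h (T^[i] x)) := by
      rw [← Finset.mul_sum, hr]; ring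
    have e2 : ∀ i, (1 + Complex.I * ((r * h (T^[i] x) : ℝ) : ℂ))
        = (1 + Complex.I * r * h (T^[i] x)) := fun i => by push_cast; ring
    rw [e1] at h1
    simp_rw [e2] at h1
    refine h1.trans ?_
    gcongr
    rw [neg_div]
    refine (abs_exp_neg_sub_exp_neg_le (by positivity) (by positivity)).trans (le_of_eq ?_)
    have e3 : (∑ i ∈ Finset.range n, (r * h (T^[i] x)) ^ 2) / 2 - s
        = t ^ 2 / 2 * ((n : ℝ)⁻¹ * ∑ i ∈ Finset.range n, (h (T^[i] x) ^ 2 - s2)) := by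
      rw [Finset.sum_sub_distrib]
      simp_rw [mul_pow]
      rw [← Finset.mul_sum, hs, hr, mul_pow, inv_pow, hsn2]
      simp
      field_simp
    rw [e3, abs_mul, abs_of_nonneg (by positivity : 0 ≤ t ^ 2 / 2)]
  have hmS : Measurable (fun x => t * ((√(n : ℝ))⁻¹ * ∑ i ∈ Finset.range n, h (T^[i] x))) :=
    ((Finset.measurable_fun_sum _ fun i _ => hhi i).const_mul _).const_mul _
  have iE : Integrable (fun x => Complex.exp (Complex.I *
        (t * ((√n)⁻¹ * ∑ i ∈ Finset.range n, h (T^[i] x)) : ℝ))) ν := by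
    refine Integrable.of_bound (C := 1) ?_ (ae_of_all _ fun x => ?_)
    · exact (Complex.measurable_exp.comp
        ((Complex.measurable_ofReal.comp hmS).const_mul _)).aestronglyMeasurable
    · rw [mul_comm, Complex.norm_exp_ofReal_mul_I]
  have iP : Integrable (fun x => ∏ i ∈ Finset.range n, (1 + Complex.I * r * h (T^[i] x))) ν := by
    by_contra hcon
    rw [integral_undef hcon] at hP
    exact zero_ne_one hP
  have e4 : ∫ x, Complex.exp (Complex.I *
        (t * ((√n)⁻¹ * ∑ i ∈ Finset.range n, h (T^[i] x)) : ℝ)) ∂ν - (Real.exp (-s) : ℝ)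
      = ∫ x, (Complex.exp (Complex.I *
        (t * ((√n)⁻¹ * ∑ i ∈ Finset.range n, h (T^[i] x)) : ℝ)) -
        (∏ i ∈ Finset.range n, (1 + Complex.I * r * h (T^[i] x))) * (Real.exp (-s) : ℝ)) ∂ν := by
    rw [integral_sub iE (iP.mul_const _), integral_mul_const, hP, one_mul]
  rw [e4]
  have iA : Integrable (fun x => |(n : ℝ)⁻¹ * ∑ i ∈ Finset.range n, (h (T^[i] x) ^ 2 - s2)|) ν :=
    ((integrable_finsetSum _ fun i _ => (hsqi i).sub (integrable_const _)).const_mul _).abs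
  refine (norm_integral_le_integral_norm _).trans ?_
  have iB : Integrable (fun x => 2 * (|t| * M) ^ 3 * (√n)⁻¹ + Real.exp ((|t| * M) ^ 2 / 2) *
      (t ^ 2 / 2 * |(n : ℝ)⁻¹ * ∑ i ∈ Finset.range n, (h (T^[i] x) ^ 2 - s2)|)) ν :=
    (integrable_const _).add ((iA.const_mul _).const_mul _)
  refine (integral_mono (iE.sub (iP.mul_const _)).norm iB hpt).trans (le_of_eq ?_)
  rw [integral_add (integrable_const _) ((iA.const_mul _).const_mul _), integral_const_mul,
    integral_const_mul]
  rw [integral_const_mul, integral_const, probReal_univ, one_smul]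
end

section
variable {Ω : Type*} [mΩ : MeasurableSpace Ω] {ν : Measure Ω} {T : Ω → Ω}

lemma sq_integral_mul_le {X Y : Ω → ℝ} (hX : MemLp X 2 ν) (hY : MemLp Y 2 ν) :
    (∫ x, X x * Y x ∂ν) ^ 2 ≤ (∫ x, X x ^ 2 ∂ν) * ∫ x, Y x ^ 2 ∂ν := by
  have iXY : Integrable (fun x => X x * Y x) ν := hX.integrable_mul hY
  have h : ∀ s : ℝ, 0 ≤ (∫ x, Y x ^ 2 ∂ν) * (s * s) + (2 * ∫ x, X x * Y x ∂ν) * s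
      + ∫ x, X x ^ 2 ∂ν := by
    intro s
    have h0 : 0 ≤ ∫ x, (Y x ^ 2 * (s * s) + (2 * (X x * Y x)) * s + X x ^ 2) ∂ν :=
      integral_nonneg fun x => by
        have : Y x ^ 2 * (s * s) + (2 * (X x * Y x)) * s + X x ^ 2 = (X x + s * Y x) ^ 2 := by
          ring
        simp only [Pi.zero_apply]
        rw [this]; positivity
    have i1 : Integrable (fun x => Y x ^ 2 * (s * s)) ν := hY.integrable_sq.mul_const _
    have i2 : Integrable (fun x => (2 * (X x * Y x)) * s) ν := (iXY.const_mul 2).mul_const _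
    have i12 : Integrable (fun x => Y x ^ 2 * (s * s) + (2 * (X x * Y x)) * s) ν := i1.add i2
    rwa [integral_add i12 hX.integrable_sq, integral_add i1 i2, integral_mul_const,
      integral_mul_const, integral_const_mul] at h0
  have := discrim_le_zero h
  rw [discrim] at this
  linarith

/-- Truncation at level `N`. -/
def clampAt (N : ℕ) (y : ℝ) : ℝ := max (-N) (min N y)

lemma measurable_clampAt (N : ℕ) : Measurable (clampAt N) :=
  measurable_const.max (measurable_const.min measurable_id)

lemma abs_clampAt_le (N : ℕ) (y : ℝ) : |clampAt N y| ≤ N := by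
  have : (0 : ℝ) ≤ N := Nat.cast_nonneg _
  rw [abs_le]
  exact ⟨le_max_left _ _, max_le (by linarith) (min_le_left _ _)⟩

lemma abs_clampAt_le_abs (N : ℕ) (y : ℝ) : |clampAt N y| ≤ |y| := by
  have : (0 : ℝ) ≤ N := Nat.cast_nonneg _
  unfold clampAt
  rcases le_total 0 y with h | h
  · rw [max_eq_right ((neg_nonpos.2 this).trans (le_min this h)), abs_of_nonneg (le_min this h),
      abs_of_nonneg h]
    exact min_le_right _ _
  · rw [min_eq_right (h.trans this), abs_of_nonpos (max_le (neg_nonpos.2 this) h),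
      abs_of_nonpos h]
    exact neg_le_neg (le_max_right _ _)

lemma tendsto_clampAt (y : ℝ) : Tendsto (fun N => clampAt N y) atTop (𝓝 y) := by
  refine tendsto_const_nhds.congr' ?_
  filter_upwards [tendsto_natCast_atTop_atTop.eventually_ge_atTop |y|] with N hN
  have := abs_le.1 hN
  rw [clampAt, min_eq_right this.2, max_eq_right this.1]

lemma integral_mul_comp_eq_zero_of_memLp (hT : MeasurePreserving T ν ν)
    {h : Ω → ℝ} (h2 : MemLp h 2 ν)
    (hK : ∀ b : Ω → ℝ, Measurable b → (∃ C, ∀ x, |b x| ≤ C) → ∫ x, h x * b (T x) ∂ν = 0)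
    {g : Ω → ℝ} (hg : Measurable g) (hg2 : MemLp g 2 ν) : ∫ x, h x * g (T x) ∂ν = 0 := by
  have hgT : MemLp (fun x => g (T x)) 2 ν := hg2.comp_measurePreserving hT
  have hi : Integrable (fun x => h x * g (T x)) ν := h2.integrable_mul hgT
  have hl := tendsto_integral_of_dominated_convergence (μ := ν)
    (F := fun (N : ℕ) x => h x * clampAt N (g (T x))) (f := fun x => h x * g (T x))
    (fun x => |h x * g (T x)|)
    (fun N => h2.aestronglyMeasurable.mul
      ((measurable_clampAt N).comp (hg.comp hT.measurable)).aestronglyMeasurable)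
    hi.abs (fun N => ae_of_all _ fun x => by
      rw [Real.norm_eq_abs, abs_mul, abs_mul]
      exact mul_le_mul_of_nonneg_left (abs_clampAt_le_abs _ _) (abs_nonneg _))
    (ae_of_all _ fun x => (tendsto_clampAt _).const_mul _)
  refine tendsto_nhds_unique hl ?_
  simp_rw [fun N : ℕ => hK (fun x => clampAt N (g x)) ((measurable_clampAt N).comp hg)
    ⟨N, fun x => abs_clampAt_le _ _⟩]
  exact tendsto_const_nhds

/-- Orthogonality of reverse martingale differences. -/
lemma integral_sq_birkhoff_eq (hT : MeasurePreserving T ν ν)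
    {h : Ω → ℝ} (hm : Measurable h) (h2 : MemLp h 2 ν)
    (hK : ∀ b : Ω → ℝ, Measurable b → (∃ C, ∀ x, |b x| ≤ C) → ∫ x, h x * b (T x) ∂ν = 0)
    (n : ℕ) :
    ∫ x, (∑ i ∈ Finset.range n, h (T^[i] x)) ^ 2 ∂ν = n * ∫ x, h x ^ 2 ∂ν := by
  have hhi : ∀ i, Measurable (fun x => h (T^[i] x)) := fun i => hm.comp (hT.measurable.iterate i)
  have hmi : ∀ i, MemLp (fun x => h (T^[i] x)) 2 ν := fun i =>
    h2.comp_measurePreserving (hT.iterate i)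
  have hmS : ∀ n, Measurable (fun x => ∑ i ∈ Finset.range n, h (T^[i] x)) := fun n =>
    Finset.measurable_fun_sum _ fun i _ => hhi i
  have hLS : ∀ n, MemLp (fun x => ∑ i ∈ Finset.range n, h (T^[i] x)) 2 ν := fun n =>
    memLp_finsetSum _ fun i _ => hmi i
  induction n with
  | zero => simp
  | succ n ih =>
    set R : Ω → ℝ := fun x => ∑ i ∈ Finset.range n, h (T^[i] x) with hR
    have hRT : MemLp (fun x => R (T x)) 2 ν := (hLS n).comp_measurePreserving hT
    have e : ∀ x, (∑ i ∈ Finset.range (n + 1), h (T^[i] x)) ^ 2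
        = R (T x) ^ 2 + 2 * (h x * R (T x)) + h x ^ 2 := by
      intro x
      rw [Finset.sum_range_succ']
      simp only [Function.iterate_succ_apply, Function.iterate_zero, id, hR]
      ring
    simp_rw [e]
    have i1 : Integrable (fun x => R (T x) ^ 2) ν := hRT.integrable_sq
    have i2 : Integrable (fun x => 2 * (h x * R (T x))) ν := (h2.integrable_mul hRT).const_mul 2
    have i12 : Integrable (fun x => R (T x) ^ 2 + 2 * (h x * R (T x))) ν := i1.add i2
    rw [integral_add i12 h2.integrable_sq, integral_add i1 i2, integral_const_mul,
      integral_mul_comp_eq_zero_of_memLp hT h2 hK (hmS n) (hLS n),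
      hT.integral_comp_of_aestronglyMeasurable (g := fun x => R x ^ 2)
        ((hmS n).pow_const 2).aestronglyMeasurable, ih]
    push_cast
    ring

variable [IsProbabilityMeasure ν]

lemma memLp_two_of_abs_le {b : Ω → ℝ} (hb : Measurable b) {M : ℝ} (h : ∀ x, |b x| ≤ M) :
    MemLp b 2 ν :=
  MemLp.of_bound hb.aestronglyMeasurable M (ae_of_all _ h)

lemma integral_abs_le_sqrt {X : Ω → ℝ} (hX : MemLp X 2 ν) :
    ∫ x, |X x| ∂ν ≤ √(∫ x, X x ^ 2 ∂ν) :=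
  Real.le_sqrt_of_sq_le (sq_integral_abs_le hX)

/-- The transfer operator of `T` on bounded functions. -/
lemma exists_integral_mul_comp_eq (hT : MeasurePreserving T ν ν)
    {b : Ω → ℝ} (hb : Measurable b) {M : ℝ} (hM : ∀ x, |b x| ≤ M) :
    ∃ β : Ω → ℝ, Measurable β ∧ (∀ x, |β x| ≤ M) ∧
      ∀ g : Ω → ℝ, Measurable g → (∃ C, ∀ x, |g x| ≤ C) →
        ∫ x, b x * g (T x) ∂ν = ∫ x, β x * g x ∂ν := by
  have hM0 : 0 ≤ M := by
    obtain ⟨x⟩ : Nonempty Ω := ν.nonempty_of_neZero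
    exact (abs_nonneg _).trans (hM x)
  have hle : mΩ.comap T ≤ mΩ := hT.measurable.comap_le
  obtain ⟨β₀, hβ₀, he⟩ := (stronglyMeasurable_condExp (f := b) (m := mΩ.comap T)
    (μ := ν)).exists_eq_measurable_comp
  have hβ : Measurable (fun x => max (-M) (min M (β₀ x))) :=
    measurable_const.max (measurable_const.min hβ₀.measurable)
  refine ⟨fun x => max (-M) (min M (β₀ x)), hβ, fun x => ?_, fun g hg hgC => ?_⟩
  · rw [abs_le]
    exact ⟨le_max_left _ _, max_le (by linarith) (min_le_left _ _)⟩
  · have hbd := ae_bdd_abs_condExp_of_ae_bdd_abs (m := mΩ.comap T) (μ := ν) (R := M) (f := b)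
      (ae_of_all _ hM)
    obtain ⟨C, hC⟩ := hgC
    have hgm : StronglyMeasurable[mΩ.comap T] (fun x => g (T x)) :=
      (hg.comp (comap_measurable T)).stronglyMeasurable
    have hbi := integrable_of_abs_le (ν := ν) hb hM
    have hbg : Integrable (b * fun x => g (T x)) ν :=
      hbi.mul_bdd (c := C) (hg.comp hT.measurable).aestronglyMeasurable (ae_of_all _ fun x => hC _)
    have h1 := condExp_mul_of_stronglyMeasurable_right hgm hbg hbi
    have h2 := hT.integral_comp_of_aestronglyMeasurable
      (g := fun x => max (-M) (min M (β₀ x)) * g x) (hβ.mul hg).aestronglyMeasurable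
    rw [← h2]
    have h3 : ∫ x, b x * g (T x) ∂ν = ∫ x, (ν[b * fun x => g (T x) | mΩ.comap T]) x ∂ν :=
      (integral_condExp hle).symm
    rw [h3]
    refine integral_congr_ae ?_
    filter_upwards [h1, hbd] with x hx hxb
    rw [hx]
    have hx2 : (ν[b | mΩ.comap T]) x = β₀ (T x) := congrFun he x
    rw [hx2] at hxb
    have := abs_le.1 hxb
    simp only [Pi.mul_apply, hx2]
    rw [min_eq_right this.2, max_eq_right this.1]

lemma norm_integral_exp_sub_integral_exp_le {X Y : Ω → ℝ} (hX : AEMeasurable X ν)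
    (hY : AEMeasurable Y ν) (hi : Integrable (fun x => X x - Y x) ν) :
    ‖∫ x, Complex.exp (Complex.I * X x) ∂ν - ∫ x, Complex.exp (Complex.I * Y x) ∂ν‖
      ≤ ∫ x, |X x - Y x| ∂ν := by
  have iE : ∀ Z : Ω → ℝ, AEMeasurable Z ν →
      Integrable (fun x => Complex.exp (Complex.I * Z x)) ν := by
    intro Z hZ
    refine Integrable.of_bound (C := 1) ?_ (ae_of_all _ fun x => ?_)
    · exact (Complex.measurable_exp.comp_aemeasurable
        ((Complex.measurable_ofReal.comp_aemeasurable hZ).const_mul _)).aestronglyMeasurable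
    · rw [mul_comm, Complex.norm_exp_ofReal_mul_I]
  rw [← integral_sub (iE X hX) (iE Y hY)]
  refine (norm_integral_le_integral_norm _).trans ?_
  exact integral_mono ((iE X hX).sub (iE Y hY)).norm hi.abs
    fun x => norm_exp_I_mul_sub_exp_I_mul_le _ _

/-- Bounded reverse martingale differences approximate square integrable ones. -/
lemma exists_bounded_approx (hT : MeasurePreserving T ν ν)
    {h : Ω → ℝ} (hm : Measurable h) (h2 : MemLp h 2 ν)
    (hK : ∀ b : Ω → ℝ, Measurable b → (∃ C, ∀ x, |b x| ≤ C) → ∫ x, h x * b (T x) ∂ν = 0)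
    {ε : ℝ} (hε : 0 < ε) :
    ∃ k : Ω → ℝ, Measurable k ∧ (∃ M, ∀ x, |k x| ≤ M) ∧
      (∀ b : Ω → ℝ, Measurable b → (∃ C, ∀ x, |b x| ≤ C) → ∫ x, k x * b (T x) ∂ν = 0) ∧
      ∫ x, (h x - k x) ^ 2 ∂ν ≤ ε := by
  have hl := tendsto_integral_of_dominated_convergence (μ := ν)
    (F := fun (N : ℕ) x => (h x - clampAt N (h x)) ^ 2) (f := fun _ => 0)
    (fun x => (2 * h x) ^ 2)
    (fun N => ((hm.sub ((measurable_clampAt N).comp hm)).pow_const 2).aestronglyMeasurable)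
    (h2.const_mul 2).integrable_sq (fun N => ae_of_all _ fun x => by
      rw [Real.norm_eq_abs, abs_pow, ← sq_abs (2 * h x), abs_mul, abs_two, two_mul]
      gcongr
      exact (abs_sub _ _).trans (add_le_add_right (abs_clampAt_le_abs _ _) _))
    (ae_of_all _ fun x => by
      have := ((tendsto_clampAt (h x)).const_sub (h x)).pow 2
      simpa using this)
  rw [integral_zero] at hl
  obtain ⟨N, hN⟩ := (hl.eventually (gt_mem_nhds (by positivity : 0 < ε / 4))).exists
  set b : Ω → ℝ := fun x => clampAt N (h x) with hb
  have hbm : Measurable b := (measurable_clampAt N).comp hm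
  have hbN : ∀ x, |b x| ≤ N := fun x => abs_clampAt_le _ _
  obtain ⟨β, hβm, hβN, hβ⟩ := exists_integral_mul_comp_eq hT hbm hbN
  have hb2 : MemLp b 2 ν := memLp_two_of_abs_le hbm hbN
  have hβ2 : MemLp β 2 ν := memLp_two_of_abs_le hβm hβN
  have hβT2 : MemLp (fun x => β (T x)) 2 ν := hβ2.comp_measurePreserving hT
  have key : ∀ g : Ω → ℝ, Measurable g → (∃ C, ∀ x, |g x| ≤ C) →
      ∫ x, (b x - β (T x)) * g (T x) ∂ν = 0 := by
    intro g hg hgC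
    obtain ⟨C, hC⟩ := hgC
    have hg2 : MemLp g 2 ν := memLp_two_of_abs_le hg hC
    have hgT2 : MemLp (fun x => g (T x)) 2 ν := hg2.comp_measurePreserving hT
    simp_rw [sub_mul]
    have i1 : Integrable (fun x => b x * g (T x)) ν := hb2.integrable_mul hgT2
    have i2 : Integrable (fun x => β (T x) * g (T x)) ν := hβT2.integrable_mul hgT2
    rw [integral_sub i1 i2, hβ g hg ⟨C, hC⟩,
      hT.integral_comp_of_aestronglyMeasurable (g := fun x => β x * g x)
        (hβm.mul hg).aestronglyMeasurable, sub_self]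
  refine ⟨fun x => b x - β (T x), hbm.sub (hβm.comp hT.measurable), ⟨N + N, fun x =>
    (abs_sub _ _).trans (add_le_add (hbN x) (hβN _))⟩, key, ?_⟩
  have hd2 : MemLp (fun x => h x - b x) 2 ν := h2.sub hb2
  have k1 := key β hβm ⟨N, hβN⟩
  have k2 := hK β hβm ⟨N, hβN⟩
  have j1 : Integrable (fun x => (b x - β (T x)) * β (T x)) ν :=
    (hb2.sub hβT2).integrable_mul hβT2
  have j2 : Integrable (fun x => h x * β (T x)) ν := h2.integrable_mul hβT2
  have j3 : Integrable (fun x => (h x - b x) ^ 2) ν := hd2.integrable_sq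
  have j4 : Integrable (fun x => (h x - (b x - β (T x))) ^ 2) ν :=
    (h2.sub (hb2.sub hβT2)).integrable_sq
  have h4 : ∫ x, (h x - (b x - β (T x))) ^ 2 ∂ν ≤ ∫ x, (h x - b x) ^ 2 ∂ν := by
    have e : ∀ x, (h x - (b x - β (T x))) ^ 2 + 2 * ((b x - β (T x)) * β (T x))
        - 2 * (h x * β (T x)) + β (T x) ^ 2 = (h x - b x) ^ 2 := fun x => by ring
    have j5 : Integrable (fun x => (h x - (b x - β (T x))) ^ 2
        + 2 * ((b x - β (T x)) * β (T x))) ν := j4.add (j1.const_mul 2)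
    have j6 : Integrable (fun x => (h x - (b x - β (T x))) ^ 2
        + 2 * ((b x - β (T x)) * β (T x)) - 2 * (h x * β (T x))) ν := j5.sub (j2.const_mul 2)
    have h5 := integral_congr_ae (μ := ν) (ae_of_all _ e)
    rw [integral_add j6 hβT2.integrable_sq, integral_sub j5 (j2.const_mul 2),
      integral_add j4 (j1.const_mul 2), integral_const_mul, integral_const_mul, k1, k2] at h5
    have : 0 ≤ ∫ x, β (T x) ^ 2 ∂ν := integral_nonneg fun x => sq_nonneg _
    linarith
  exact h4.trans (hN.le.trans (by linarith))

/-- Central limit theorem for square integrable reverse martingale differences. -/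
lemma tendsto_integral_exp_of_memLp (hT : MeasurePreserving T ν ν)
    (hmix : ∀ b : Ω → ℝ, Measurable b → (∃ C, ∀ x, |b x| ≤ C) →
      Tendsto (fun n => ∫ x, b x * b (T^[n] x) ∂ν) atTop (𝓝 ((∫ x, b x ∂ν) ^ 2)))
    {h : Ω → ℝ} (hm : Measurable h) (h2 : MemLp h 2 ν)
    (hK : ∀ b : Ω → ℝ, Measurable b → (∃ C, ∀ x, |b x| ≤ C) → ∫ x, h x * b (T x) ∂ν = 0)
    (t : ℝ) :
    Tendsto (fun n : ℕ => ∫ x, Complex.exp (Complex.I *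
        (t * ((√n)⁻¹ * ∑ i ∈ Finset.range n, h (T^[i] x)) : ℝ)) ∂ν) atTop
      (𝓝 (Real.exp (-(t ^ 2 * (∫ x, h x ^ 2 ∂ν) / 2)) : ℝ)) := by
  set s2 := ∫ x, h x ^ 2 ∂ν with hs2
  have hs20 : 0 ≤ s2 := integral_nonneg fun x => sq_nonneg _
  have hlim0 : Tendsto (fun ε : ℝ => |t| * √ε + t ^ 2 / 2 * (2 * √(s2 * ε) + ε)) (𝓝[>] 0)
      (𝓝 0) := by
    have : ContinuousAt (fun ε : ℝ => |t| * √ε + t ^ 2 / 2 * (2 * √(s2 * ε) + ε)) 0 := by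
      fun_prop
    have := this.tendsto.mono_left (nhdsWithin_le_nhds (s := Ioi (0 : ℝ)))
    simpa using this
  rw [Metric.tendsto_atTop]
  intro η hη
  obtain ⟨ε, hεlt, hε⟩ := ((hlim0.eventually (gt_mem_nhds (half_pos hη))).and
    self_mem_nhdsWithin).exists
  replace hε : 0 < ε := hε
  obtain ⟨k, hkm, ⟨M, hkM⟩, hkK, hkε⟩ := exists_bounded_approx hT hm h2 hK hε
  have hbdd := tendsto_integral_exp_of_bounded hT hmix hkm hkM hkK t
  rw [Metric.tendsto_atTop] at hbdd
  obtain ⟨N, hN⟩ := hbdd (η / 2) (half_pos hη)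
  refine ⟨max N 1, fun n hn => ?_⟩
  have hnN := hN n (le_of_max_le_left hn)
  have hn1 : (0 : ℝ) < n := by exact_mod_cast (le_of_max_le_right hn)
  have hk2 : MemLp k 2 ν := memLp_two_of_abs_le hkm hkM
  have hd2 : MemLp (fun x => h x - k x) 2 ν := h2.sub hk2
  have hdm : Measurable (fun x => h x - k x) := hm.sub hkm
  have hdK : ∀ b : Ω → ℝ, Measurable b → (∃ C, ∀ x, |b x| ≤ C) →
      ∫ x, (h x - k x) * b (T x) ∂ν = 0 := by
    intro b hb hbC
    obtain ⟨C, hC⟩ := hbC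
    have hb2 : MemLp (fun x => b (T x)) 2 ν :=
      (memLp_two_of_abs_le hb hC).comp_measurePreserving hT
    simp_rw [sub_mul]
    have i1 : Integrable (fun x => h x * b (T x)) ν := h2.integrable_mul hb2
    have i2 : Integrable (fun x => k x * b (T x)) ν := hk2.integrable_mul hb2
    rw [integral_sub i1 i2, hK b hb ⟨C, hC⟩, hkK b hb ⟨C, hC⟩, sub_zero]
  have hS : ∀ g : Ω → ℝ, Measurable g → Measurable (fun x =>
      t * ((√(n : ℝ))⁻¹ * ∑ i ∈ Finset.range n, g (T^[i] x))) := fun g hg =>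
    ((Finset.measurable_fun_sum _ fun i _ =>
      hg.comp (hT.measurable.iterate i)).const_mul _).const_mul _
  have hLd : MemLp (fun x => t * (√(n : ℝ))⁻¹ *
      ∑ i ∈ Finset.range n, (h (T^[i] x) - k (T^[i] x))) 2 ν :=
    (memLp_finsetSum _ fun i _ => hd2.comp_measurePreserving (hT.iterate i)).const_mul _
  have e1 : ∀ x, t * ((√(n : ℝ))⁻¹ * ∑ i ∈ Finset.range n, h (T^[i] x))
      - t * ((√(n : ℝ))⁻¹ * ∑ i ∈ Finset.range n, k (T^[i] x))
      = t * (√(n : ℝ))⁻¹ * ∑ i ∈ Finset.range n, (h (T^[i] x) - k (T^[i] x)) := fun x => by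
    rw [Finset.sum_sub_distrib]; ring
  have b1 := norm_integral_exp_sub_integral_exp_le (ν := ν) (hS h hm).aemeasurable
    (hS k hkm).aemeasurable (by simp_rw [e1]; exact hLd.integrable (by norm_num))
  have b2 : ∫ x, |t * ((√(n : ℝ))⁻¹ * ∑ i ∈ Finset.range n, h (T^[i] x))
      - t * ((√(n : ℝ))⁻¹ * ∑ i ∈ Finset.range n, k (T^[i] x))| ∂ν ≤ |t| * √ε := by
    simp_rw [e1]
    refine (integral_abs_le_sqrt hLd).trans ?_
    simp_rw [mul_pow]
    rw [integral_const_mul, integral_sq_birkhoff_eq hT hdm hd2 hdK, inv_pow, Real.sq_sqrt hn1.le,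
      ← mul_assoc, mul_assoc (t ^ 2), inv_mul_cancel₀ hn1.ne', mul_one,
      Real.sqrt_mul (sq_nonneg _), Real.sqrt_sq_eq_abs]
    gcongr
  have b3 : |(∫ x, k x ^ 2 ∂ν) - s2| ≤ 2 * √(s2 * ε) + ε := by
    have e2 : ∀ x, k x ^ 2 = h x ^ 2 - 2 * (h x * (h x - k x)) + (h x - k x) ^ 2 := fun x => by
      ring
    have i1 : Integrable (fun x => h x * (h x - k x)) ν := h2.integrable_mul hd2
    have i2 : Integrable (fun x => h x ^ 2 - 2 * (h x * (h x - k x))) ν :=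
      h2.integrable_sq.sub (i1.const_mul 2)
    simp_rw [e2]
    rw [integral_add i2 hd2.integrable_sq, integral_sub h2.integrable_sq (i1.const_mul 2),
      integral_const_mul, ← hs2]
    have c1 : |∫ x, h x * (h x - k x) ∂ν| ≤ √(s2 * ε) :=
      Real.abs_le_sqrt ((sq_integral_mul_le h2 hd2).trans (by rw [← hs2]; gcongr))
    have c2 : 0 ≤ ∫ x, (h x - k x) ^ 2 ∂ν := integral_nonneg fun x => sq_nonneg _
    have := abs_le.1 c1
    rw [abs_le]
    constructor <;> linarith
  have hk0 : 0 ≤ ∫ x, k x ^ 2 ∂ν := integral_nonneg fun x => sq_nonneg _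
  have b4 : ‖((Real.exp (-(t ^ 2 * (∫ x, k x ^ 2 ∂ν) / 2)) : ℝ) : ℂ)
      - (Real.exp (-(t ^ 2 * s2 / 2)) : ℝ)‖ ≤ t ^ 2 / 2 * (2 * √(s2 * ε) + ε) := by
    rw [← Complex.ofReal_sub, Complex.norm_real]
    refine (abs_exp_neg_sub_exp_neg_le (by positivity) (by positivity)).trans ?_
    have : t ^ 2 * (∫ x, k x ^ 2 ∂ν) / 2 - t ^ 2 * s2 / 2
        = t ^ 2 / 2 * ((∫ x, k x ^ 2 ∂ν) - s2) := by ring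
    rw [this, abs_mul, abs_of_nonneg (by positivity : 0 ≤ t ^ 2 / 2)]
    gcongr
  rw [dist_eq_norm] at hnN ⊢
  have tri : ∀ A B A' B' : ℂ, ‖A - B‖ ≤ ‖A - A'‖ + ‖A' - B'‖ + ‖B' - B‖ := fun A B A' B' => by
    have : A - B = (A - A') + (A' - B') + (B' - B) := by ring
    rw [this]; exact norm_add₃_le
  refine (tri _ _ (∫ x, Complex.exp (Complex.I *
        (t * ((√n)⁻¹ * ∑ i ∈ Finset.range n, k (T^[i] x)) : ℝ)) ∂ν)
    ((Real.exp (-(t ^ 2 * (∫ x, k x ^ 2 ∂ν) / 2)) : ℝ) : ℂ)).trans_lt ?_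
  linarith [b1.trans b2]
end

section
variable {Ω : Type*} [mΩ : MeasurableSpace Ω] {ν : Measure Ω} {T : Ω → Ω}

lemma MeasureTheory.MemLp.integrable_fun_mul {X Y : Ω → ℝ} (hX : MemLp X 2 ν)
    (hY : MemLp Y 2 ν) : Integrable (fun x => X x * Y x) ν :=
  hX.integrable_mul hY

/-- The transfer operator of `T` on square integrable functions. -/
lemma exists_transfer (hT : MeasurePreserving T ν ν) {X : Ω → ℝ} (hX : MemLp X 2 ν) :
    ∃ Y : Ω → ℝ, Measurable Y ∧ MemLp Y 2 ν ∧
      ∀ g : Ω → ℝ, MemLp g 2 ν → ∫ x, X x * g (T x) ∂ν = ∫ x, Y x * g x ∂ν := by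
  let U : Lp ℝ 2 ν →L[ℝ] Lp ℝ 2 ν :=
    (Lp.compMeasurePreservingₗᵢ ℝ T hT).toContinuousLinearMap
  let Y : Lp ℝ 2 ν := ContinuousLinearMap.adjoint U (hX.toLp X)
  refine ⟨Y, (Lp.stronglyMeasurable Y).measurable, Lp.memLp Y, fun g hg => ?_⟩
  have h1 : inner ℝ (hg.toLp g) Y = inner ℝ (U (hg.toLp g)) (hX.toLp X) :=
    ContinuousLinearMap.adjoint_inner_right U _ _
  have hU : U (hg.toLp g) = (hg.comp_measurePreserving hT).toLp _ := rfl
  rw [hU, L2.inner_def, L2.inner_def] at h1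
  have h2 : ∫ x, inner ℝ ((hg.toLp g : Lp ℝ 2 ν) x) (Y x) ∂ν = ∫ x, Y x * g x ∂ν := by
    refine integral_congr_ae ?_
    filter_upwards [hg.coeFn_toLp] with x hx
    rw [hx]; simp
  have h3 : ∫ x, inner ℝ (((hg.comp_measurePreserving hT).toLp (g ∘ T) : Lp ℝ 2 ν) x)
      ((hX.toLp X : Lp ℝ 2 ν) x) ∂ν = ∫ x, X x * g (T x) ∂ν := by
    refine integral_congr_ae ?_
    filter_upwards [(hg.comp_measurePreserving hT).coeFn_toLp, hX.coeFn_toLp] with x hx hx'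
    rw [hx, hx']; simp
  rw [← h3, ← h2, h1]

lemma frequently_le_of_sum_le {a : ℕ → ℝ} {R : ℝ}
    (h : ∀ N : ℕ, ∑ n ∈ Finset.range N, a n ≤ N * R) (h0 : ∀ n, 0 ≤ a n) :
    ∃ᶠ n in atTop, a n ≤ R + 1 := by
  intro hcon
  obtain ⟨n₀, hn₀⟩ := eventually_atTop.1 hcon
  have hR : 0 ≤ R := by
    have := h 1
    simp only [Finset.range_one, Finset.sum_singleton, Nat.cast_one, one_mul] at this
    exact (h0 0).trans this
  have hlow : ∀ m : ℕ, (m : ℝ) * (R + 1) ≤ ∑ n ∈ Finset.range (n₀ + m), a n := by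
    intro m
    rw [Finset.sum_range_add]
    have h1 : 0 ≤ ∑ n ∈ Finset.range n₀, a n := Finset.sum_nonneg fun n _ => h0 n
    have h2 : ∑ _n ∈ Finset.range m, (R + 1) ≤ ∑ n ∈ Finset.range m, a (n₀ + n) :=
      Finset.sum_le_sum fun n _ => (not_le.1 (hn₀ (n₀ + n) (by omega))).le
    simp only [Finset.sum_const, Finset.card_range, nsmul_eq_mul] at h2
    linarith
  obtain ⟨m, hm⟩ := exists_nat_gt (n₀ * R)
  have h1 := hlow m
  have h2 := h (n₀ + m)
  push_cast at h2
  nlinarith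

/-- Gordin's decomposition: under summable correlations, a square integrable observable is a
square integrable reverse martingale difference plus an integrable coboundary. -/
lemma exists_martingale_coboundary [IsProbabilityMeasure ν] (hT : MeasurePreserving T ν ν)
    {φ : Ω → ℝ} (hφ : Measurable φ) (hφ2 : MemLp φ 2 ν) {c : ℕ → ℝ} (hc : Summable c)
    (hb : ∀ k, ∀ b : Ω → ℝ, Measurable b → (∀ x, |b x| ≤ 1) →
      |∫ x, φ x * b (T^[k] x) ∂ν| ≤ c k)
    (hcov : ∀ k, |∫ x, φ x * φ (T^[k] x) ∂ν| ≤ c k) :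
    ∃ u : Ω → ℝ, Measurable u ∧ Integrable u ν ∧
      MemLp (fun x => φ x + u x - u (T x)) 2 ν ∧
      ∀ b : Ω → ℝ, Measurable b → (∃ C, ∀ x, |b x| ≤ C) →
        ∫ x, (φ x + u x - u (T x)) * b (T x) ∂ν = 0 := by
  have hc0 : ∀ k, 0 ≤ c k := fun k => (abs_nonneg _).trans (hcov k)
  choose! K hKm hK2 hK using fun (X : Ω → ℝ) (hX : MemLp X 2 ν) => exists_transfer hT hX
  set P : ℕ → Ω → ℝ := fun k => K^[k] φ with hP
  have hPs : ∀ k, P (k + 1) = K (P k) := fun k => Function.iterate_succ_apply' K k φ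
  have hP2 : ∀ k, MemLp (P k) 2 ν := by
    intro k
    induction k with
    | zero => exact hφ2
    | succ k ih => rw [hPs]; exact hK2 _ ih
  have hPm : ∀ k, Measurable (P k) := by
    intro k
    cases k with
    | zero => exact hφ
    | succ k => rw [hPs]; exact hKm _ (hP2 k)
  have hPint : ∀ k, ∀ g : Ω → ℝ, MemLp g 2 ν →
      ∫ x, P k x * g x ∂ν = ∫ x, φ x * g (T^[k] x) ∂ν := by
    intro k
    induction k with
    | zero => intro g _; rfl
    | succ k ih =>
      intro g hg
      rw [hPs, ← hK _ (hP2 k) g hg, ih (fun x => g (T x)) (hg.comp_measurePreserving hT)]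
      simp_rw [Function.iterate_succ_apply']
  have hP1 : ∀ k, ∫ x, |P k x| ∂ν ≤ c k := by
    intro k
    set b : Ω → ℝ := fun x => if 0 ≤ P k x then 1 else -1 with hbdef
    have hbm : Measurable b :=
      Measurable.ite (measurableSet_le measurable_const (hPm k)) measurable_const measurable_const
    have hb1 : ∀ x, |b x| ≤ 1 := fun x => by
      simp only [hbdef]; split_ifs <;> simp
    have e : ∀ x, |P k x| = P k x * b x := fun x => by
      simp only [hbdef]
      split_ifs with h
      · rw [abs_of_nonneg h, mul_one]
      · rw [abs_of_neg (not_le.1 h)]; ring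
    simp_rw [e]
    rw [hPint k b (memLp_two_of_abs_le hbm hb1)]
    exact (le_abs_self _).trans (hb k b hbm hb1)
  set D : Ω → ℝ≥0∞ := fun x => ∑' k, ‖P (k + 1) x‖ₑ with hD
  have hDm : Measurable D := Measurable.tsum fun k => (hPm (k + 1)).enorm
  have hDint : ∫⁻ x, D x ∂ν ≠ ∞ := by
    rw [hD, lintegral_tsum fun k => (hPm (k + 1)).enorm.aemeasurable]
    have hs : Summable fun k => c (k + 1) := (summable_nat_add_iff 1).2 hc
    refine ne_top_of_le_ne_top (b := ENNReal.ofReal (∑' k, c (k + 1))) ENNReal.ofReal_ne_top ?_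
    rw [ENNReal.ofReal_tsum_of_nonneg (fun k => hc0 _) hs]
    refine ENNReal.tsum_le_tsum fun k => ?_
    rw [← ofReal_integral_norm_eq_lintegral_enorm ((hP2 (k + 1)).integrable (by norm_num))]
    exact ENNReal.ofReal_le_ofReal (hP1 (k + 1))
  have hDae : ∀ᵐ x ∂ν, D x < ∞ := ae_lt_top hDm hDint
  have hDri : Integrable (fun x => (D x).toReal) ν :=
    integrable_toReal_of_lintegral_ne_top hDm.aemeasurable hDint
  have hsum : ∀ x, D x < ∞ → Summable fun k => P (k + 1) x := fun x hx =>
    Summable.of_nnnorm (ENNReal.tsum_coe_ne_top_iff_summable.1 hx.ne)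
  have hpartial : ∀ x, D x < ∞ → ∀ n, |∑ k ∈ Finset.range n, P (k + 1) x| ≤ (D x).toReal := by
    intro x hx n
    have h1 : ‖∑ k ∈ Finset.range n, P (k + 1) x‖ₑ ≤ D x :=
      (enorm_sum_le _ _).trans (ENNReal.sum_le_tsum _)
    rw [← Real.norm_eq_abs, ← toReal_enorm]
    exact ENNReal.toReal_mono hx.ne h1
  set S : Set Ω := {x | D x < ∞} with hS
  have hSm : MeasurableSet S := measurableSet_lt hDm measurable_const
  set q : ℕ → Ω → ℝ := fun n x => ∑ k ∈ Finset.range n, P (k + 1) x with hq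
  have hqm : ∀ n, Measurable (q n) := fun n => Finset.measurable_fun_sum _ fun k _ => hPm _
  set u : Ω → ℝ := S.indicator (fun x => ∑' k, P (k + 1) x) with hu
  have hqu : ∀ x ∈ S, Tendsto (fun n => q n x) atTop (𝓝 (u x)) := by
    intro x hx
    rw [hu, indicator_of_mem hx]
    exact (hsum x hx).hasSum.tendsto_sum_nat
  have hum : Measurable u := by
    refine measurable_of_tendsto_metrizable (f := fun n => S.indicator (q n))
      (fun n => (hqm n).indicator hSm) (tendsto_pi_nhds.2 fun x => ?_)
    by_cases hx : x ∈ S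
    · simpa only [indicator_of_mem hx] using hqu x hx
    · simp only [indicator_of_notMem hx, hu]
      exact tendsto_const_nhds
  have hubd : ∀ x, |u x| ≤ (D x).toReal := by
    intro x
    by_cases hx : x ∈ S
    · exact le_of_tendsto (hqu x hx).abs (Eventually.of_forall fun n => hpartial x hx n)
    · rw [hu, indicator_of_notMem hx, abs_zero]; exact ENNReal.toReal_nonneg
  have hui : Integrable u ν := hDri.mono' hum.aestronglyMeasurable (ae_of_all _ hubd)
  set G : ℕ → Ω → ℝ := fun n x => ∑ k ∈ Finset.range n, P k x with hG
  have hG2 : ∀ n, MemLp (G n) 2 ν := fun n => memLp_finsetSum _ fun k _ => hP2 k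
  have hq2 : ∀ n, MemLp (q n) 2 ν := fun n => memLp_finsetSum _ fun k _ => hP2 (k + 1)
  have hqT2 : ∀ n, MemLp (fun x => q n (T x)) 2 ν := fun n => (hq2 n).comp_measurePreserving hT
  have hGq : ∀ n x, G (n + 1) x = q n x + φ x := fun n x => Finset.sum_range_succ' _ _
  have hGK : ∀ n, ∀ g : Ω → ℝ, MemLp g 2 ν →
      ∫ x, G n x * g (T x) ∂ν = ∫ x, q n x * g x ∂ν := by
    intro n g hg
    have hgT : MemLp (fun x => g (T x)) 2 ν := hg.comp_measurePreserving hT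
    simp only [hG, hq, Finset.sum_mul]
    rw [integral_finsetSum _ fun k _ => (hP2 k).integrable_fun_mul hgT,
      integral_finsetSum _ fun k _ => (hP2 (k + 1)).integrable_fun_mul hg]
    refine Finset.sum_congr rfl fun k _ => ?_
    rw [hPs]
    exact hK _ (hP2 k) g hg
  have hd2 : ∀ n, MemLp (fun x => G n x - q n (T x)) 2 ν := fun n => (hG2 n).sub (hqT2 n)
  have hdK : ∀ n, ∀ g : Ω → ℝ, Measurable g → MemLp g 2 ν →
      ∫ x, (G n x - q n (T x)) * g (T x) ∂ν = 0 := by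
    intro n g hgm hg
    have hgT : MemLp (fun x => g (T x)) 2 ν := hg.comp_measurePreserving hT
    simp_rw [sub_mul]
    have i1 : Integrable (fun x => G n x * g (T x)) ν := (hG2 n).integrable_mul hgT
    have i2 : Integrable (fun x => q n (T x) * g (T x)) ν := (hqT2 n).integrable_mul hgT
    rw [integral_sub i1 i2, hGK n g hg, hT.integral_comp_of_aestronglyMeasurable
      (g := fun x => q n x * g x) ((hqm n).mul hgm).aestronglyMeasurable, sub_self]
  have hsq : ∀ n, ∫ x, (G n x - q n (T x)) ^ 2 ∂ν
      = ∫ x, G n x ^ 2 ∂ν - ∫ x, q n x ^ 2 ∂ν := by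
    intro n
    have e : ∀ x, (G n x - q n (T x)) ^ 2
        = G n x ^ 2 - 2 * (G n x * q n (T x)) + q n (T x) ^ 2 := fun x => by ring
    have i1 : Integrable (fun x => G n x * q n (T x)) ν := (hG2 n).integrable_mul (hqT2 n)
    have i2 : Integrable (fun x => G n x ^ 2 - 2 * (G n x * q n (T x))) ν :=
      (hG2 n).integrable_sq.sub (i1.const_mul 2)
    simp_rw [e]
    rw [integral_add i2 (hqT2 n).integrable_sq, integral_sub (hG2 n).integrable_sq
      (i1.const_mul 2), integral_const_mul, hGK n (q n) (hq2 n),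
      hT.integral_comp_of_aestronglyMeasurable (g := fun x => q n x ^ 2)
        ((hqm n).pow_const 2).aestronglyMeasurable]
    simp_rw [← sq]
    ring
  have hGφ : ∀ n, ∫ x, G n x * φ x ∂ν ≤ ∑' k, c k := by
    intro n
    simp only [hG, Finset.sum_mul]
    rw [integral_finsetSum _ fun k _ => (hP2 k).integrable_fun_mul hφ2]
    refine (Finset.sum_le_sum fun k _ => ?_).trans (hc.sum_le_tsum _ fun k _ => hc0 k)
    rw [hPint k φ hφ2]
    exact (le_abs_self _).trans (hcov k)
  have hrec : ∀ n, ∫ x, (G n x - q n (T x)) ^ 2 ∂ν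
      ≤ ∫ x, G n x ^ 2 ∂ν - ∫ x, G (n + 1) x ^ 2 ∂ν + 2 * ∑' k, c k := by
    intro n
    have e : ∀ x, q n x ^ 2 = G (n + 1) x ^ 2 - 2 * (G (n + 1) x * φ x) + φ x ^ 2 := fun x => by
      rw [hGq]; ring
    have i1 : Integrable (fun x => G (n + 1) x * φ x) ν := (hG2 _).integrable_mul hφ2
    have i2 : Integrable (fun x => G (n + 1) x ^ 2 - 2 * (G (n + 1) x * φ x)) ν :=
      (hG2 _).integrable_sq.sub (i1.const_mul 2)
    rw [hsq]
    have h1 : ∫ x, q n x ^ 2 ∂ν = ∫ x, G (n + 1) x ^ 2 ∂ν - 2 * ∫ x, G (n + 1) x * φ x ∂ν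
        + ∫ x, φ x ^ 2 ∂ν := by
      simp_rw [e]
      rw [integral_add i2 hφ2.integrable_sq, integral_sub (hG2 _).integrable_sq
        (i1.const_mul 2), integral_const_mul]
    have h2 := hGφ (n + 1)
    have h3 : 0 ≤ ∫ x, φ x ^ 2 ∂ν := integral_nonneg fun x => sq_nonneg _
    linarith
  have hfreq : ∃ᶠ n in atTop, ∫ x, (G n x - q n (T x)) ^ 2 ∂ν ≤ 2 * ∑' k, c k + 1 := by
    refine frequently_le_of_sum_le (fun N => ?_) fun n => integral_nonneg fun x => sq_nonneg _
    have h1 : ∑ n ∈ Finset.range N, ∫ x, (G n x - q n (T x)) ^ 2 ∂ν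
        ≤ ∑ n ∈ Finset.range N, ((∫ x, G n x ^ 2 ∂ν - ∫ x, G (n + 1) x ^ 2 ∂ν)
          + 2 * ∑' k, c k) := Finset.sum_le_sum fun n _ => hrec n
    rw [Finset.sum_add_distrib, Finset.sum_range_sub' (fun n => ∫ x, G n x ^ 2 ∂ν)] at h1
    have h2 : ∫ x, G 0 x ^ 2 ∂ν = 0 := by simp [hG]
    have h3 : 0 ≤ ∫ x, G N x ^ 2 ∂ν := integral_nonneg fun x => sq_nonneg _
    simp only [Finset.sum_const, Finset.card_range, nsmul_eq_mul] at h1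
    linarith
  have hSae : ∀ᵐ x ∂ν, x ∈ S ∧ T x ∈ S :=
    hDae.and (hT.quasiMeasurePreserving.ae hDae)
  have hlim : ∀ᵐ x ∂ν, Tendsto (fun n => G (n + 1) x - q (n + 1) (T x)) atTop
      (𝓝 (φ x + u x - u (T x))) := by
    filter_upwards [hSae] with x hx
    simp_rw [hGq]
    have := ((hqu x hx.1).add_const (φ x)).sub ((hqu _ hx.2).comp (tendsto_add_atTop_nat 1))
    rwa [add_comm (u x)] at this
  have huT : Measurable (fun x => u (T x)) := hum.comp hT.measurable
  refine ⟨u, hum, hui, ⟨((hφ.add hum).sub huT).aestronglyMeasurable, ?_⟩, fun b hbm hbC => ?_⟩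
  · have h1 := Lp.eLpNorm_lim_le_liminf_eLpNorm (p := 2)
      (fun n => (hd2 (n + 1)).aestronglyMeasurable) _ hlim
    refine h1.trans_lt (lt_of_le_of_lt (liminf_le_of_frequently_le'
      (x := ENNReal.ofReal (√(2 * ∑' k, c k + 1))) ?_) ENNReal.ofReal_lt_top)
    have hfreq' : ∃ᶠ n in atTop,
        ∫ x, (G (n + 1) x - q (n + 1) (T x)) ^ 2 ∂ν ≤ 2 * ∑' k, c k + 1 := by
      rw [frequently_atTop] at hfreq ⊢
      intro N
      obtain ⟨n, hn, hn'⟩ := hfreq (N + 1)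
      refine ⟨n - 1, by omega, ?_⟩
      rwa [Nat.sub_add_cancel (by omega)]
    refine hfreq'.mono fun n hn => ?_
    rw [(hd2 (n + 1)).eLpNorm_eq_integral_rpow_norm (by norm_num) (by norm_num)]
    refine ENNReal.ofReal_le_ofReal ?_
    rw [Real.sqrt_eq_rpow]
    simp only [ENNReal.toReal_ofNat, Real.rpow_ofNat, Real.norm_eq_abs, sq_abs, one_div]
    gcongr
  · obtain ⟨C, hC⟩ := hbC
    have hb2 : MemLp b 2 ν := memLp_two_of_abs_le hbm hC
    have hbT : Measurable (fun x => b (T x)) := hbm.comp hT.measurable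
    have hDT : Integrable (fun x => (D (T x)).toReal) ν :=
      hT.integrable_comp_of_integrable hDri
    have hl := tendsto_integral_of_dominated_convergence (μ := ν)
      (F := fun n x => (G (n + 1) x - q (n + 1) (T x)) * b (T x))
      (f := fun x => (φ x + u x - u (T x)) * b (T x))
      (fun x => ((D x).toReal + |φ x| + (D (T x)).toReal) * C)
      (fun n => (hd2 (n + 1)).aestronglyMeasurable.mul hbT.aestronglyMeasurable)
      (((hDri.add (hφ2.integrable (by norm_num)).abs).add hDT).mul_const C)
      (fun n => by
        filter_upwards [hSae] with x hx
        rw [Real.norm_eq_abs, abs_mul, hGq]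
        refine mul_le_mul ?_ (hC _) (abs_nonneg _) (by positivity)
        refine (abs_sub _ _).trans (add_le_add ((abs_add_le _ _).trans ?_) (hpartial _ hx.2 _))
        exact add_le_add (hpartial _ hx.1 _) le_rfl)
      (by filter_upwards [hlim] with x hx using hx.mul_const _)
    refine tendsto_nhds_unique hl ?_
    simp_rw [fun n => hdK (n + 1) b hbm hb2]
    exact tendsto_const_nhds

end

section
variable {Ω : Type*} [mΩ : MeasurableSpace Ω] {ν : Measure Ω} {T : Ω → Ω}

/-- Lévy's continuity theorem for a Gaussian limit, in terms of integrals of exponentials. -/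
lemma tendsto_integral_of_tendsto_integral_exp [IsProbabilityMeasure ν] {Y : ℕ → Ω → ℝ}
    (hY : ∀ n, Measurable (Y n)) {v : ℝ≥0}
    (h : ∀ t : ℝ, Tendsto (fun n => ∫ x, Complex.exp (Complex.I * (t * Y n x : ℝ)) ∂ν) atTop
      (𝓝 (Real.exp (-(t ^ 2 * v / 2)) : ℝ))) (g : BoundedContinuousFunction ℝ ℝ) :
    Tendsto (fun n => ∫ x, g (Y n x) ∂ν) atTop (𝓝 (∫ y, g y ∂(gaussianReal 0 v))) := by
  have hp : ∀ n, IsProbabilityMeasure (ν.map (Y n)) := fun n =>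
    Measure.isProbabilityMeasure_map (hY n).aemeasurable
  let P : ℕ → ProbabilityMeasure ℝ := fun n => ⟨ν.map (Y n), hp n⟩
  have hP : Tendsto P atTop (𝓝 ⟨gaussianReal 0 v, inferInstance⟩) := by
    refine ProbabilityMeasure.tendsto_of_tendsto_charFun fun t => ?_
    simp only [P, ProbabilityMeasure.coe_mk]
    rw [charFun_gaussianReal]
    convert h t using 1
    · funext n
      rw [charFun_apply_real, integral_map (hY n).aemeasurable (by fun_prop)]
      refine integral_congr_ae (ae_of_all _ fun x => ?_)
      simp only
      congr 1
      push_cast; ring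
    · congr 1
      push_cast
      congr 1
      ring
  have := (ProbabilityMeasure.tendsto_iff_forall_integral_tendsto.1 hP) g
  simp only [P, ProbabilityMeasure.coe_mk] at this
  refine this.congr fun n => ?_
  rw [integral_map (hY n).aemeasurable g.continuous.aestronglyMeasurable]

/-- Central limit theorem for square integrable observables with summable correlations. -/
lemma tendsto_integral_gaussian_of_summable [IsProbabilityMeasure ν]
    (hT : MeasurePreserving T ν ν)
    (hmix : ∀ b : Ω → ℝ, Measurable b → (∃ C, ∀ x, |b x| ≤ C) →
      Tendsto (fun n => ∫ x, b x * b (T^[n] x) ∂ν) atTop (𝓝 ((∫ x, b x ∂ν) ^ 2)))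
    {φ : Ω → ℝ} (hφ : Measurable φ) (hφ2 : MemLp φ 2 ν) {c : ℕ → ℝ} (hc : Summable c)
    (hb : ∀ k, ∀ b : Ω → ℝ, Measurable b → (∀ x, |b x| ≤ 1) →
      |∫ x, φ x * b (T^[k] x) ∂ν| ≤ c k)
    (hcov : ∀ k, |∫ x, φ x * φ (T^[k] x) ∂ν| ≤ c k) :
    ∃ v : ℝ≥0, ∀ g : BoundedContinuousFunction ℝ ℝ,
      Tendsto (fun n : ℕ => ∫ x, g ((n : ℝ) ^ (-(1:ℝ)/2) *
          ∑ i ∈ Finset.range n, φ (T^[i + 1] x)) ∂ν)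
        atTop (𝓝 (∫ y, g y ∂(gaussianReal 0 v))) := by
  obtain ⟨u, hum, hui, hh2, hhK⟩ := exists_martingale_coboundary hT hφ hφ2 hc hb hcov
  set h : Ω → ℝ := fun x => φ x + u x - u (T x) with hh
  have hhm : Measurable h := (hφ.add hum).sub (hum.comp hT.measurable)
  have hclt := tendsto_integral_exp_of_memLp hT hmix hhm hh2 hhK
  have hv0 : 0 ≤ ∫ x, h x ^ 2 ∂ν := integral_nonneg fun x => sq_nonneg _
  refine ⟨⟨∫ x, h x ^ 2 ∂ν, hv0⟩, fun g => ?_⟩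
  set Y : ℕ → Ω → ℝ := fun n x => (√n)⁻¹ * ∑ i ∈ Finset.range n, φ (T^[i] x) with hYdef
  have hS : ∀ f : Ω → ℝ, Measurable f → ∀ n : ℕ, Measurable (fun x =>
      (√(n : ℝ))⁻¹ * ∑ i ∈ Finset.range n, f (T^[i] x)) := fun f hf n =>
    (Finset.measurable_fun_sum _ fun i _ => hf.comp (hT.measurable.iterate i)).const_mul _
  have hYm : ∀ n, Measurable (Y n) := fun n => hS φ hφ n
  have hmain : Tendsto (fun n => ∫ x, g (Y n x) ∂ν) atTop
      (𝓝 (∫ y, g y ∂(gaussianReal 0 ⟨∫ x, h x ^ 2 ∂ν, hv0⟩))) := by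
    refine tendsto_integral_of_tendsto_integral_exp hYm (fun t => ?_) g
    refine tendsto_of_tendsto_of_dist (hclt t) ?_
    have hinv : Tendsto (fun n : ℕ => (√(n : ℝ))⁻¹) atTop (𝓝 0) :=
      tendsto_inv_atTop_zero.comp (Real.tendsto_sqrt_atTop.comp tendsto_natCast_atTop_atTop)
    have hz : Tendsto (fun n : ℕ => |t| * (√(n : ℝ))⁻¹ * (2 * ∫ x, |u x| ∂ν)) atTop (𝓝 0) := by
      simpa using (hinv.const_mul |t|).mul_const (2 * ∫ x, |u x| ∂ν)
    refine squeeze_zero (fun n => dist_nonneg) (fun n => ?_) hz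
    have e : ∀ x, t * ((√(n : ℝ))⁻¹ * ∑ i ∈ Finset.range n, h (T^[i] x)) - t * Y n x
        = t * (√(n : ℝ))⁻¹ * (u x - u (T^[n] x)) := by
      intro x
      have h1 : ∑ i ∈ Finset.range n, (u (T^[i] x) - u (T^[i + 1] x)) = u x - u (T^[n] x) :=
        Finset.sum_range_sub' (fun i => u (T^[i] x)) n
      have h2 : ∑ i ∈ Finset.range n, h (T^[i] x) = ∑ i ∈ Finset.range n, φ (T^[i] x)
          + (u x - u (T^[n] x)) := by
        rw [← h1, ← Finset.sum_add_distrib]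
        refine Finset.sum_congr rfl fun i _ => ?_
        simp only [hh, Function.iterate_succ_apply']
        ring
      rw [h2, hYdef]
      ring
    have huT : Integrable (fun x => u (T^[n] x)) ν :=
      (hT.iterate n).integrable_comp_of_integrable hui
    have hi : Integrable (fun x => t * (√(n : ℝ))⁻¹ * (u x - u (T^[n] x))) ν :=
      (hui.sub huT).const_mul _
    rw [dist_eq_norm]
    refine (norm_integral_exp_sub_integral_exp_le ((hS h hhm n).const_mul t).aemeasurable
      ((hYm n).const_mul t).aemeasurable (by simp_rw [e]; exact hi)).trans ?_
    simp_rw [e, abs_mul, abs_inv, abs_of_nonneg (Real.sqrt_nonneg _)]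
    rw [integral_const_mul]
    gcongr
    have h3 : ∫ x, |u (T^[n] x)| ∂ν = ∫ x, |u x| ∂ν :=
      (hT.iterate n).integral_comp_of_aestronglyMeasurable (g := fun x => |u x|)
        hui.abs.aestronglyMeasurable
    calc ∫ x, |u x - u (T^[n] x)| ∂ν ≤ ∫ x, (|u x| + |u (T^[n] x)|) ∂ν :=
          integral_mono (hui.sub huT).abs (hui.abs.add huT.abs) fun x => abs_sub _ _
      _ = 2 * ∫ x, |u x| ∂ν := by rw [integral_add hui.abs huT.abs, h3]; ring
  refine hmain.congr fun n => ?_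
  have h4 := hT.integral_comp_of_aestronglyMeasurable (g := fun x => g (Y n x))
    (g.continuous.measurable.comp (hYm n)).aestronglyMeasurable
  rw [← h4]
  refine integral_congr_ae (ae_of_all _ fun x => ?_)
  simp only [hYdef, Function.iterate_succ_apply]
  congr 2
  rw [neg_div, Real.rpow_neg (Nat.cast_nonneg _), Real.sqrt_eq_rpow]

end

section Branches

variable {γ : ℝ}

/-- The left branch of the intermittent map. -/
def leftBranch (γ y : ℝ) : ℝ := y * (1 + 2 ^ γ * y ^ γ)

/-- The derivative of the left branch. -/
def leftJac (γ y : ℝ) : ℝ := 1 + (1 + γ) * (2 ^ γ * y ^ γ)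

/-- The inverse of the left branch. -/
def leftInv (γ x : ℝ) : ℝ := Function.invFunOn (leftBranch γ) (Icc 0 (1 / 2)) x

theorem two_rpow_mul_rpow {y : ℝ} (hy : 0 ≤ y) : (2 : ℝ) ^ γ * y ^ γ = (2 * y) ^ γ :=
  (Real.mul_rpow (by norm_num) hy).symm

theorem two_rpow_mul_rpow_nonneg {y : ℝ} (hy : 0 ≤ y) : 0 ≤ (2 : ℝ) ^ γ * y ^ γ := by
  positivity

theorem two_rpow_mul_rpow_le_one (hγ : 0 < γ) {y : ℝ} (hy : y ∈ Icc (0 : ℝ) (1 / 2)) :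
    (2 : ℝ) ^ γ * y ^ γ ≤ 1 := by
  rw [two_rpow_mul_rpow hy.1]
  exact Real.rpow_le_one (by linarith [hy.1]) (by linarith [hy.2]) hγ.le

theorem two_rpow_mul_rpow_mono (hγ : 0 < γ) {x y : ℝ} (hx : 0 ≤ x) (hxy : x ≤ y) :
    (2 : ℝ) ^ γ * x ^ γ ≤ 2 ^ γ * y ^ γ := by
  gcongr

theorem leftBranch_zero : leftBranch γ 0 = 0 := by simp [leftBranch]

theorem leftBranch_half : leftBranch γ (1 / 2) = 1 := by
  rw [leftBranch, two_rpow_mul_rpow (by norm_num)]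
  norm_num

theorem leftJac_half : leftJac γ (1 / 2) = 2 + γ := by
  rw [leftJac, two_rpow_mul_rpow (by norm_num)]
  norm_num
  ring

theorem one_le_leftJac (hγ : 0 < γ) {y : ℝ} (hy : 0 ≤ y) : 1 ≤ leftJac γ y := by
  have := two_rpow_mul_rpow_nonneg (γ := γ) hy
  unfold leftJac
  nlinarith

theorem leftJac_mono (hγ : 0 < γ) {x y : ℝ} (hx : 0 ≤ x) (hxy : x ≤ y) :
    leftJac γ x ≤ leftJac γ y := by
  have := two_rpow_mul_rpow_mono hγ hx hxy
  unfold leftJac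
  nlinarith

theorem leftJac_le_three (hγ : 0 < γ) (hγ1 : γ < 1 / 2) {y : ℝ} (hy : y ∈ Icc (0 : ℝ) (1 / 2)) :
    leftJac γ y ≤ 3 := by
  have := two_rpow_mul_rpow_le_one hγ hy
  unfold leftJac
  nlinarith

theorem strictMonoOn_leftBranch (hγ : 0 < γ) : StrictMonoOn (leftBranch γ) (Icc 0 (1 / 2)) := by
  intro x hx y hy hxy
  have h1 := two_rpow_mul_rpow_mono hγ hx.1 hxy.le
  have h2 := two_rpow_mul_rpow_nonneg (γ := γ) hx.1
  have := hx.1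
  unfold leftBranch
  nlinarith

theorem continuous_leftBranch (hγ : 0 < γ) : Continuous (leftBranch γ) := by
  unfold leftBranch
  have : Continuous fun y : ℝ => y ^ γ := Real.continuous_rpow_const hγ.le
  fun_prop

theorem hasDerivWithinAt_leftBranch (hγ : 0 < γ) {s : Set ℝ} (hs : s ⊆ Ici 0) {y : ℝ}
    (hy : y ∈ s) : HasDerivWithinAt (leftBranch γ) (leftJac γ y) s y := by
  have h := (((Real.hasDerivAt_rpow_const (x := y) (p := 1 + γ)
    (Or.inr (by linarith))).const_mul ((2 : ℝ) ^ γ)).add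
    (hasDerivAt_id y)).hasDerivWithinAt (s := s)
  have key : ∀ x ∈ s, leftBranch γ x = (((2 : ℝ) ^ γ) * x ^ (1 + γ)) + x := by
    intro x hx
    rw [leftBranch, Real.rpow_one_add' (hs hx) (by linarith)]
    ring
  refine (h.congr (f₁ := leftBranch γ) (fun x hx => key x hx) (key y hy)).congr_deriv ?_
  rw [leftJac, add_sub_cancel_left]
  ring

theorem leftBranch_image_Icc (hγ : 0 < γ) {a : ℝ} (ha : a ∈ Icc (0 : ℝ) (1 / 2)) :
    leftBranch γ '' Icc a (1 / 2) = Icc (leftBranch γ a) 1 := by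
  apply Subset.antisymm
  · rintro _ ⟨x, hx, rfl⟩
    have hx' : x ∈ Icc (0 : ℝ) (1 / 2) := ⟨ha.1.trans hx.1, hx.2⟩
    refine ⟨(strictMonoOn_leftBranch hγ).monotoneOn ha hx' hx.1, ?_⟩
    rw [← leftBranch_half (γ := γ)]
    exact (strictMonoOn_leftBranch hγ).monotoneOn hx' ⟨by norm_num, le_rfl⟩ hx.2
  · have := intermediate_value_Icc ha.2 (continuous_leftBranch hγ).continuousOn
    rwa [leftBranch_half] at this

theorem mem_leftBranch_image (hγ : 0 < γ) {x : ℝ} (hx : x ∈ Icc (0 : ℝ) 1) :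
    ∃ y ∈ Icc (0 : ℝ) (1 / 2), leftBranch γ y = x := by
  have h : x ∈ leftBranch γ '' Icc 0 (1 / 2) := by
    rwa [leftBranch_image_Icc hγ ⟨le_rfl, by norm_num⟩, leftBranch_zero]
  exact h

theorem leftInv_mem (hγ : 0 < γ) {x : ℝ} (hx : x ∈ Icc (0 : ℝ) 1) :
    leftInv γ x ∈ Icc (0 : ℝ) (1 / 2) :=
  Function.invFunOn_mem (mem_leftBranch_image hγ hx)

theorem leftInv_mem_unit (hγ : 0 < γ) {x : ℝ} (hx : x ∈ Icc (0 : ℝ) 1) :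
    leftInv γ x ∈ Icc (0 : ℝ) 1 :=
  ⟨(leftInv_mem hγ hx).1, (leftInv_mem hγ hx).2.trans (by norm_num)⟩

theorem leftBranch_leftInv (hγ : 0 < γ) {x : ℝ} (hx : x ∈ Icc (0 : ℝ) 1) :
    leftBranch γ (leftInv γ x) = x :=
  Function.invFunOn_eq (mem_leftBranch_image hγ hx)

theorem leftInv_leftBranch (hγ : 0 < γ) {y : ℝ} (hy : y ∈ Icc (0 : ℝ) (1 / 2)) :
    leftInv γ (leftBranch γ y) = y :=
  (strictMonoOn_leftBranch hγ).injOn.leftInvOn_invFunOn hy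

theorem monotoneOn_leftInv (hγ : 0 < γ) : MonotoneOn (leftInv γ) (Icc 0 1) := by
  intro x hx y hy hxy
  rw [← leftBranch_leftInv hγ hx, ← leftBranch_leftInv hγ hy] at hxy
  exact ((strictMonoOn_leftBranch hγ).le_iff_le (leftInv_mem hγ hx) (leftInv_mem hγ hy)).1 hxy

theorem leftInv_one (hγ : 0 < γ) : leftInv γ 1 = 1 / 2 := by
  conv_lhs => rw [← leftBranch_half (γ := γ)]
  exact leftInv_leftBranch hγ ⟨by norm_num, le_rfl⟩

theorem leftInv_pos (hγ : 0 < γ) {x : ℝ} (hx : x ∈ Ioc (0 : ℝ) 1) : 0 < leftInv γ x := by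
  have hx' : x ∈ Icc (0 : ℝ) 1 := ⟨hx.1.le, hx.2⟩
  refine lt_of_le_of_ne (leftInv_mem hγ hx').1 fun h => hx.1.ne ?_
  rw [← leftBranch_leftInv hγ hx', ← h, leftBranch_zero]

theorem measurable_Tmap (γ : ℝ) : Measurable (Tmap γ) := by
  unfold Tmap
  refine Measurable.ite measurableSet_Iio ?_ ?_ <;> fun_prop

end Branches

section Transfer

variable {γ : ℝ}

/-- The contribution of the left branch to the transfer operator. -/
def pfLeft (γ : ℝ) (g : ℝ → ℝ) (x : ℝ) : ℝ := g (leftInv γ x) / leftJac γ (leftInv γ x)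

/-- The contribution of the right branch to the transfer operator. -/
def pfRight (g : ℝ → ℝ) (x : ℝ) : ℝ := g ((x + 1) / 2) / 2

/-- The transfer operator of the intermittent map with respect to Lebesgue measure. -/
def pf (γ : ℝ) (g : ℝ → ℝ) (x : ℝ) : ℝ := pfLeft γ g x + pfRight g x

theorem setIntegral_image_branch {s : Set ℝ} {F F' G : ℝ → ℝ} (hs : MeasurableSet s)
    (hd : ∀ x ∈ s, HasDerivWithinAt F (F' x) s x) (hm : MonotoneOn F s)
    (hG : ∀ x ∈ s, G (F x) = x) (hpos : ∀ x ∈ s, 0 < F' x) (g φ : ℝ → ℝ) :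
    ∫ x in F '' s, g (G x) / F' (G x) * φ x = ∫ y in s, g y * φ (F y) := by
  rw [integral_image_eq_integral_deriv_smul_of_monotoneOn hs hd hm]
  refine setIntegral_congr_fun hs fun y hy => ?_
  have := hpos y hy
  simp only [hG y hy, smul_eq_mul]
  field_simp

theorem integrableOn_image_branch {s : Set ℝ} {F F' G : ℝ → ℝ} (hs : MeasurableSet s)
    (hd : ∀ x ∈ s, HasDerivWithinAt F (F' x) s x)
    (hG : ∀ x ∈ s, G (F x) = x) (hpos : ∀ x ∈ s, 0 < F' x) {g : ℝ → ℝ} (hg : IntegrableOn g s) :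
    IntegrableOn (fun x => g (G x) / F' (G x)) (F '' s) := by
  have hinj : InjOn F s := fun x hx y hy h => by rw [← hG x hx, ← hG y hy, h]
  rw [integrableOn_image_iff_integrableOn_abs_deriv_smul hs hd hinj]
  refine hg.congr_fun (fun y hy => ?_) hs
  have := hpos y hy
  simp only [hG y hy, smul_eq_mul, abs_of_pos this]
  field_simp

theorem setIntegral_pfLeft (hγ : 0 < γ) {a : ℝ} (ha : a ∈ Icc (0 : ℝ) (1 / 2)) (g φ : ℝ → ℝ) :
    ∫ x in Icc (leftBranch γ a) 1, pfLeft γ g x * φ x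
      = ∫ y in Icc a (1 / 2), g y * φ (leftBranch γ y) := by
  have hsub : Icc a (1 / 2) ⊆ Icc (0 : ℝ) (1 / 2) := Icc_subset_Icc_left ha.1
  rw [← leftBranch_image_Icc hγ ha]
  exact setIntegral_image_branch measurableSet_Icc
    (fun x hx => hasDerivWithinAt_leftBranch hγ (fun y hy => (hsub hy).1) hx)
    ((strictMonoOn_leftBranch hγ).monotoneOn.mono hsub)
    (fun x hx => leftInv_leftBranch hγ (hsub hx))
    (fun x hx => zero_lt_one.trans_le (one_le_leftJac hγ (hsub hx).1)) g φ

theorem integrableOn_pfLeft (hγ : 0 < γ) {g : ℝ → ℝ} (hg : IntegrableOn g (Icc 0 1)) :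
    IntegrableOn (pfLeft γ g) (Icc 0 1) := by
  have := integrableOn_image_branch (G := leftInv γ) measurableSet_Icc
    (fun x hx => hasDerivWithinAt_leftBranch hγ (fun y hy => (mem_Icc.1 hy).1) hx)
    (fun x hx => leftInv_leftBranch hγ hx)
    (fun x hx => zero_lt_one.trans_le (one_le_leftJac hγ (mem_Icc.1 hx).1))
    (hg.mono_set (Icc_subset_Icc_right (by norm_num : (1 / 2 : ℝ) ≤ 1)))
  rwa [leftBranch_image_Icc hγ ⟨le_rfl, by norm_num⟩, leftBranch_zero] at this

theorem rightBranch_image : (fun y : ℝ => 2 * y - 1) '' Icc (1 / 2) 1 = Icc 0 1 := by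
  ext x
  constructor
  · rintro ⟨y, hy, rfl⟩
    exact ⟨by linarith [hy.1], by linarith [hy.2]⟩
  · intro hx
    exact ⟨(x + 1) / 2, ⟨by linarith [hx.1], by linarith [hx.2]⟩, by ring⟩

theorem hasDerivAt_rightBranch (y : ℝ) : HasDerivAt (fun y : ℝ => 2 * y - 1) 2 y := by
  simpa using ((hasDerivAt_id y).const_mul (2 : ℝ)).sub_const 1

theorem setIntegral_pfRight (g φ : ℝ → ℝ) :
    ∫ x in Icc 0 1, pfRight g x * φ x = ∫ y in Icc (1 / 2) 1, g y * φ (2 * y - 1) := by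
  rw [← rightBranch_image]
  exact setIntegral_image_branch (F := fun y : ℝ => 2 * y - 1) (F' := fun _ => 2)
    (G := fun x => (x + 1) / 2) measurableSet_Icc
    (fun x _ => (hasDerivAt_rightBranch x).hasDerivWithinAt)
    (fun x _ y _ h => by simp only; linarith) (fun x _ => by ring) (fun _ _ => two_pos) g φ

theorem integrableOn_pfRight {g : ℝ → ℝ} (hg : IntegrableOn g (Icc 0 1)) :
    IntegrableOn (pfRight g) (Icc 0 1) := by
  rw [← rightBranch_image]
  exact integrableOn_image_branch (F := fun y : ℝ => 2 * y - 1) (F' := fun _ => 2)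
    (G := fun x => (x + 1) / 2) measurableSet_Icc
    (fun x _ => (hasDerivAt_rightBranch x).hasDerivWithinAt)
    (fun x _ => by ring) (fun _ _ => two_pos)
    (hg.mono_set (Icc_subset_Icc_left (by norm_num : (0 : ℝ) ≤ 1 / 2)))

theorem integrableOn_pf (hγ : 0 < γ) {g : ℝ → ℝ} (hg : IntegrableOn g (Icc 0 1)) :
    IntegrableOn (pf γ g) (Icc 0 1) :=
  (integrableOn_pfLeft hγ hg).add (integrableOn_pfRight hg)

theorem integrableOn_pf_iterate (hγ : 0 < γ) {g : ℝ → ℝ} (hg : IntegrableOn g (Icc 0 1)) (n : ℕ) :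
    IntegrableOn ((pf γ)^[n] g) (Icc 0 1) := by
  induction n with
  | zero => exact hg
  | succ n ih => rw [Function.iterate_succ_apply']; exact integrableOn_pf hγ ih

theorem IntegrableOn.mul_bounded {g φ : ℝ → ℝ} {s : Set ℝ} (hg : IntegrableOn g s)
    (hφ : Measurable φ) {M : ℝ} (hM : ∀ x, |φ x| ≤ M) : IntegrableOn (fun x => g x * φ x) s :=
  Integrable.mul_bdd (c := M) hg hφ.aestronglyMeasurable (ae_of_all _ hM)

theorem setIntegral_pf_mul (hγ : 0 < γ) {g φ : ℝ → ℝ} (hg : IntegrableOn g (Icc 0 1))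
    (hφ : Measurable φ) {M : ℝ} (hM : ∀ x, |φ x| ≤ M) :
    ∫ x in Icc 0 1, pf γ g x * φ x = ∫ x in Icc 0 1, g x * φ (Tmap γ x) := by
  have hl := setIntegral_pfLeft hγ (a := 0) ⟨le_rfl, by norm_num⟩ g φ
  rw [leftBranch_zero] at hl
  have hint : IntegrableOn (fun x => g x * φ (Tmap γ x)) (Icc 0 1) :=
    IntegrableOn.mul_bounded hg (hφ.comp (measurable_Tmap γ)) (fun x => hM _)
  have hsplit : Icc (0 : ℝ) 1 = Ico 0 (1 / 2) ∪ Icc (1 / 2) 1 :=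
    (Ico_union_Icc_eq_Icc (by norm_num) (by norm_num)).symm
  calc ∫ x in Icc 0 1, pf γ g x * φ x
      = ∫ x in Icc 0 1, (pfLeft γ g x * φ x + pfRight g x * φ x) := by
        simp only [pf, add_mul]
    _ = (∫ y in Icc 0 (1 / 2), g y * φ (leftBranch γ y))
          + ∫ y in Icc (1 / 2) 1, g y * φ (2 * y - 1) := by
        rw [integral_add (IntegrableOn.mul_bounded (integrableOn_pfLeft hγ hg) hφ hM)
          (IntegrableOn.mul_bounded (integrableOn_pfRight hg) hφ hM), hl, setIntegral_pfRight]
    _ = (∫ y in Ico 0 (1 / 2), g y * φ (Tmap γ y))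
          + ∫ y in Icc (1 / 2) 1, g y * φ (Tmap γ y) := by
        rw [integral_Icc_eq_integral_Ico]
        congr 1
        · refine setIntegral_congr_fun measurableSet_Ico fun y hy => ?_
          simp only [Tmap, if_pos hy.2, leftBranch]
        · refine setIntegral_congr_fun measurableSet_Icc fun y hy => ?_
          simp only [Tmap, if_neg (not_lt.2 hy.1)]
    _ = ∫ x in Icc 0 1, g x * φ (Tmap γ x) := by
        rw [hsplit] at hint ⊢
        refine (setIntegral_union ?_ measurableSet_Icc (hint.mono_set subset_union_left)
          (hint.mono_set subset_union_right)).symm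
        exact disjoint_left.2 fun x hx hx' => not_lt.2 hx'.1 hx.2

theorem setIntegral_pf_iterate_mul (hγ : 0 < γ) {g φ : ℝ → ℝ} (hg : IntegrableOn g (Icc 0 1))
    (hφ : Measurable φ) {M : ℝ} (hM : ∀ x, |φ x| ≤ M) (n : ℕ) :
    ∫ x in Icc 0 1, (pf γ)^[n] g x * φ x = ∫ x in Icc 0 1, g x * φ ((Tmap γ)^[n] x) := by
  induction n generalizing g with
  | zero => rfl
  | succ n ih =>
    rw [Function.iterate_succ_apply, ih (integrableOn_pf hγ hg),
      setIntegral_pf_mul (φ := fun x => φ ((Tmap γ)^[n] x)) hγ hg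
        (hφ.comp ((measurable_Tmap γ).iterate n)) (fun x => hM _)]
    simp only [Function.iterate_succ_apply]

theorem setIntegral_pf_iterate (hγ : 0 < γ) {g : ℝ → ℝ} (hg : IntegrableOn g (Icc 0 1)) (n : ℕ) :
    ∫ x in Icc 0 1, (pf γ)^[n] g x = ∫ x in Icc 0 1, g x := by
  simpa using setIntegral_pf_iterate_mul hγ hg (φ := fun _ => 1) measurable_const
    (M := 1) (by simp) n

end Transfer

section Decreasing

variable {γ : ℝ}

/-- The cone of nonnegative nonincreasing functions on `[0,1]`. -/
def DecUnit (g : ℝ → ℝ) : Prop := AntitoneOn g (Icc 0 1) ∧ ∀ x ∈ Icc (0 : ℝ) 1, 0 ≤ g x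

theorem DecUnit.integrableOn {g : ℝ → ℝ} (hg : DecUnit g) : IntegrableOn g (Icc 0 1) :=
  hg.1.integrableOn_isCompact isCompact_Icc

theorem decUnit_one : DecUnit (fun _ => 1) := ⟨antitoneOn_const, fun _ _ => zero_le_one⟩

theorem right_mem {x : ℝ} (hx : x ∈ Icc (0 : ℝ) 1) : (x + 1) / 2 ∈ Icc (0 : ℝ) 1 :=
  ⟨by linarith [hx.1], by linarith [hx.2]⟩

theorem DecUnit.pfLeft (hγ : 0 < γ) {g : ℝ → ℝ} (hg : DecUnit g) : DecUnit (pfLeft γ g) := by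
  refine ⟨fun x hx y hy hxy => ?_, fun x hx => ?_⟩
  · have h1 := monotoneOn_leftInv hγ hx hy hxy
    have h2 := one_le_leftJac hγ (leftInv_mem hγ hx).1
    exact div_le_div₀ (hg.2 _ (leftInv_mem_unit hγ hx))
      (hg.1 (leftInv_mem_unit hγ hx) (leftInv_mem_unit hγ hy) h1) (by linarith)
      (leftJac_mono hγ (leftInv_mem hγ hx).1 h1)
  · have h2 := one_le_leftJac hγ (leftInv_mem hγ hx).1
    exact div_nonneg (hg.2 _ (leftInv_mem_unit hγ hx)) (by linarith)

theorem DecUnit.pfRight {g : ℝ → ℝ} (hg : DecUnit g) : DecUnit (pfRight g) := by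
  refine ⟨fun x hx y hy hxy => ?_, fun x hx => ?_⟩
  · exact div_le_div_of_nonneg_right (hg.1 (right_mem hx) (right_mem hy) (by linarith)) two_pos.le
  · exact div_nonneg (hg.2 _ (right_mem hx)) two_pos.le

theorem DecUnit.add {g h : ℝ → ℝ} (hg : DecUnit g) (hh : DecUnit h) :
    DecUnit (fun x => g x + h x) :=
  ⟨fun _ hx _ hy hxy => add_le_add (hg.1 hx hy hxy) (hh.1 hx hy hxy),
    fun x hx => add_nonneg (hg.2 x hx) (hh.2 x hx)⟩

theorem DecUnit.mul {g h : ℝ → ℝ} (hg : DecUnit g) (hh : DecUnit h) :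
    DecUnit (fun x => g x * h x) :=
  ⟨fun x hx y hy hxy => mul_le_mul (hg.1 hx hy hxy) (hh.1 hx hy hxy) (hh.2 y hy) (hg.2 x hx),
    fun x hx => mul_nonneg (hg.2 x hx) (hh.2 x hx)⟩

theorem DecUnit.const_mul {g : ℝ → ℝ} (hg : DecUnit g) {c : ℝ} (hc : 0 ≤ c) :
    DecUnit (fun x => c * g x) :=
  DecUnit.mul ⟨antitoneOn_const, fun _ _ => hc⟩ hg

theorem DecUnit.pf (hγ : 0 < γ) {g : ℝ → ℝ} (hg : DecUnit g) : DecUnit (pf γ g) :=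
  (hg.pfLeft hγ).add hg.pfRight

theorem DecUnit.pf_iterate (hγ : 0 < γ) {g : ℝ → ℝ} (hg : DecUnit g) (n : ℕ) :
    DecUnit ((_root_.pf γ)^[n] g) := by
  induction n with
  | zero => exact hg
  | succ n ih => rw [Function.iterate_succ_apply']; exact ih.pf hγ

theorem pf_mono (hγ : 0 < γ) {g h : ℝ → ℝ} (hgh : ∀ x ∈ Icc (0 : ℝ) 1, g x ≤ h x) :
    ∀ x ∈ Icc (0 : ℝ) 1, pf γ g x ≤ pf γ h x := by
  intro x hx
  have h2 := one_le_leftJac hγ (leftInv_mem hγ hx).1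
  exact add_le_add (div_le_div_of_nonneg_right (hgh _ (leftInv_mem_unit hγ hx)) (by linarith))
    (div_le_div_of_nonneg_right (hgh _ (right_mem hx)) two_pos.le)

theorem pf_iterate_mono (hγ : 0 < γ) {g h : ℝ → ℝ} (hgh : ∀ x ∈ Icc (0 : ℝ) 1, g x ≤ h x)
    (n : ℕ) : ∀ x ∈ Icc (0 : ℝ) 1, (pf γ)^[n] g x ≤ (pf γ)^[n] h x := by
  induction n with
  | zero => exact hgh
  | succ n ih => simp only [Function.iterate_succ_apply']; exact pf_mono hγ ih

theorem pf_add_const_mul (c : ℝ) (g h : ℝ → ℝ) :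
    pf γ (fun x => g x + c * h x) = fun x => pf γ g x + c * pf γ h x := by
  funext x
  simp only [pf, pfLeft, pfRight]
  ring

theorem pf_iterate_add_const_mul (c : ℝ) (g h : ℝ → ℝ) (n : ℕ) :
    (pf γ)^[n] (fun x => g x + c * h x) = fun x => (pf γ)^[n] g x + c * (pf γ)^[n] h x := by
  induction n with
  | zero => rfl
  | succ n ih => simp only [Function.iterate_succ_apply', ih, pf_add_const_mul]

theorem DecUnit.mul_le_setIntegral {g : ℝ → ℝ} (hg : DecUnit g) {a b : ℝ} (ha : 0 ≤ a)
    (hab : a ≤ b) (hb : b ≤ 1) : (b - a) * g b ≤ ∫ x in Icc a b, g x := by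
  have hsub : Icc a b ⊆ Icc 0 1 := Icc_subset_Icc ha hb
  have h := setIntegral_mono_on (f := fun _ => g b) (g := g) (μ := volume) (s := Icc a b)
    (by simp) (hg.integrableOn.mono_set hsub) measurableSet_Icc
    (fun x hx => hg.1 (hsub hx) ⟨ha.trans hab, hb⟩ hx.2)
  simpa [hab] using h

theorem DecUnit.setIntegral_le_mul {g : ℝ → ℝ} (hg : DecUnit g) {a b : ℝ} (ha : 0 ≤ a)
    (hab : a ≤ b) (hb : b ≤ 1) : ∫ x in Icc a b, g x ≤ (b - a) * g a := by
  have hsub : Icc a b ⊆ Icc 0 1 := Icc_subset_Icc ha hb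
  have h := setIntegral_mono_on (f := g) (g := fun _ => g a) (μ := volume) (s := Icc a b)
    (hg.integrableOn.mono_set hsub) (by simp) measurableSet_Icc
    (fun x hx => hg.1 ⟨ha, hab.trans hb⟩ (hsub hx) hx.1)
  simpa [hab] using h

theorem DecUnit.setIntegral_mono_set {g : ℝ → ℝ} (hg : DecUnit g) {s t : Set ℝ} (hst : s ⊆ t)
    (ht : t ⊆ Icc 0 1) (htm : MeasurableSet t) : ∫ x in s, g x ≤ ∫ x in t, g x :=
  MeasureTheory.setIntegral_mono_set (hg.integrableOn.mono_set ht)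
    ((ae_restrict_iff' htm).2 (ae_of_all _ fun x hx => hg.2 x (ht hx)))
    (LE.le.eventuallyLE hst)

theorem DecUnit.setIntegral_split {g : ℝ → ℝ} (hg : DecUnit g) {a b c : ℝ} (ha : 0 ≤ a)
    (hab : a ≤ b) (hbc : b ≤ c) (hc : c ≤ 1) :
    ∫ x in Icc a c, g x = (∫ x in Icc a b, g x) + ∫ x in Icc b c, g x := by
  have hi := hg.integrableOn
  rw [← Ico_union_Icc_eq_Icc hab hbc, integral_Icc_eq_integral_Ico (y := b)]
  refine setIntegral_union (disjoint_left.2 fun x hx hx' => not_lt.2 hx'.1 hx.2)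
    measurableSet_Icc (hi.mono_set ?_) (hi.mono_set ?_)
  · exact fun x hx => ⟨ha.trans hx.1, hx.2.le.trans (hbc.trans hc)⟩
  · exact fun x hx => ⟨(ha.trans hab).trans hx.1, hx.2.trans hc⟩

end Decreasing

section Bounds

variable {γ : ℝ}

theorem rpow_neg_leftInv (hγ : 0 < γ) {x : ℝ} (hx : x ∈ Ioc (0 : ℝ) 1) :
    ∃ y ξ : ℝ, y = leftInv γ x ∧ 0 < y ∧ 0 < ξ ∧ ξ ≤ 1 ∧ leftJac γ y = 1 + (1 + γ) * ξ ∧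
      y ^ (-γ) = 2 ^ γ / ξ ∧ x ^ (-γ) = 2 ^ γ / ξ * (1 + ξ) ^ (-γ) := by
  have hx' : x ∈ Icc (0 : ℝ) 1 := ⟨hx.1.le, hx.2⟩
  have hy := leftInv_pos hγ hx
  have hξ : 0 < (2 : ℝ) ^ γ * leftInv γ x ^ γ := by positivity
  have hyp : leftInv γ x ^ (-γ) = 2 ^ γ / (2 ^ γ * leftInv γ x ^ γ) := by
    rw [Real.rpow_neg hy.le]
    have : 0 < leftInv γ x ^ γ := by positivity
    field_simp
  refine ⟨leftInv γ x, 2 ^ γ * leftInv γ x ^ γ, rfl, hy, hξ,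
    two_rpow_mul_rpow_le_one hγ (leftInv_mem hγ hx'), rfl, hyp, ?_⟩
  conv_lhs => rw [← leftBranch_leftInv hγ hx', leftBranch]
  rw [Real.mul_rpow hy.le (by linarith), hyp]

theorem one_add_rpow_neg_ge (hγ : 0 < γ) (hγ1 : γ ≤ 1) {ξ : ℝ} (hξ : 0 ≤ ξ) :
    1 / (1 + γ * ξ) ≤ (1 + ξ) ^ (-γ) := by
  rw [Real.rpow_neg (by linarith), ← one_div]
  exact one_div_le_one_div_of_le (by positivity)
    (rpow_one_add_le_one_add_mul_self (by linarith) hγ.le hγ1)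

theorem one_add_rpow_neg_le (hγ : 0 < γ) (hγ1 : γ ≤ 1) {ξ : ℝ} (hξ : 0 ≤ ξ) :
    (1 + ξ) ^ (-γ) ≤ 1 - γ * (ξ / (1 + ξ)) := by
  have h0 : 0 < 1 + ξ := by linarith
  have h1 : (1 + ξ)⁻¹ = 1 + -(ξ / (1 + ξ)) := by field_simp; ring
  rw [Real.rpow_neg h0.le, ← Real.inv_rpow h0.le, h1]
  have h2 : ξ / (1 + ξ) ≤ 1 := (div_le_one h0).2 (by linarith)
  have := rpow_one_add_le_one_add_mul_self (s := -(ξ / (1 + ξ))) (by linarith) hγ.le hγ1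
  linarith

theorem one_le_two_rpow (hγ : 0 < γ) : (1 : ℝ) ≤ 2 ^ γ :=
  Real.one_le_rpow (by norm_num) hγ.le

theorem pf_le_four_mul_rpow (hγ : 0 < γ) (hγ1 : γ < 1 / 2) {g : ℝ → ℝ} (hg : DecUnit g)
    (hint : ∫ x in Icc 0 1, g x ≤ 1) (hle : ∀ x ∈ Ioc (0 : ℝ) 1, g x ≤ 4 * x ^ (-γ)) :
    ∀ x ∈ Ioc (0 : ℝ) 1, pf γ g x ≤ 4 * x ^ (-γ) := by
  intro x hx
  obtain ⟨y, ξ, hy, hy0, hξ0, hξ1, hJ, hyp, hxp⟩ := rpow_neg_leftInv hγ hx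
  have hx' : x ∈ Icc (0 : ℝ) 1 := ⟨hx.1.le, hx.2⟩
  have hymem : y ∈ Ioc (0 : ℝ) 1 := ⟨hy0, hy ▸ (leftInv_mem_unit hγ hx').2⟩
  have hr : pfRight g x ≤ 1 := by
    have h1 := hg.mul_le_setIntegral le_rfl (right_mem hx').1 (right_mem hx').2
    have h2 := hg.setIntegral_mono_set (Icc_subset_Icc_right (right_mem hx').2 :
      Icc (0 : ℝ) ((x + 1) / 2) ⊆ Icc 0 1) Subset.rfl measurableSet_Icc
    have h3 := hg.2 _ (right_mem hx')
    have h4 := hx'.1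
    unfold pfRight
    nlinarith
  have hl : pfLeft γ g x ≤ 4 * (2 ^ γ / ξ) / (1 + (1 + γ) * ξ) := by
    unfold pfLeft
    rw [← hy, hJ, ← hyp]
    gcongr
    exact hle y hymem
  have hb := one_add_rpow_neg_ge hγ (by linarith) hξ0.le
  have h2 := one_le_two_rpow hγ
  have h3 : 1 ≤ 4 * (2 ^ γ / ξ) * (1 / (1 + γ * ξ) - 1 / (1 + (1 + γ) * ξ)) := by
    have : 4 * (2 ^ γ / ξ) * (1 / (1 + γ * ξ) - 1 / (1 + (1 + γ) * ξ))
        = 4 * 2 ^ γ / ((1 + γ * ξ) * (1 + (1 + γ) * ξ)) := by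
      field_simp
      ring
    rw [this, one_le_div (by positivity)]
    have e1 : γ * ξ ≤ 1 / 2 := by nlinarith
    have e2 : (1 + γ) * ξ ≤ 3 / 2 := by nlinarith
    have e3 : 0 ≤ γ * ξ := by positivity
    have e4 : 0 ≤ (1 + γ) * ξ := by positivity
    nlinarith
  have h4 : 4 * (2 ^ γ / ξ) * (1 / (1 + γ * ξ)) ≤ 4 * x ^ (-γ) := by
    rw [hxp, ← mul_assoc]
    gcongr
  unfold pf
  have h5 : 4 * (2 ^ γ / ξ) / (1 + (1 + γ) * ξ) = 4 * (2 ^ γ / ξ) * (1 / (1 + (1 + γ) * ξ)) := by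
    rw [mul_one_div]
  rw [h5] at hl
  linarith

theorem setIntegral_pf_iterate_one (hγ : 0 < γ) (n : ℕ) :
    ∫ x in Icc 0 1, (pf γ)^[n] (fun _ => 1) x = 1 := by
  rw [setIntegral_pf_iterate hγ decUnit_one.integrableOn]
  simp

theorem pf_iterate_one_le (hγ : 0 < γ) (hγ1 : γ < 1 / 2) (n : ℕ) :
    ∀ x ∈ Ioc (0 : ℝ) 1, (pf γ)^[n] (fun _ => 1) x ≤ 4 * x ^ (-γ) := by
  induction n with
  | zero =>
    intro x hx
    have := Real.one_le_rpow_of_pos_of_le_one_of_nonpos hx.1 hx.2 (neg_nonpos.2 hγ.le)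
    simp only [Function.iterate_zero, id]
    linarith
  | succ n ih =>
    rw [Function.iterate_succ_apply']
    exact pf_le_four_mul_rpow hγ hγ1 (decUnit_one.pf_iterate hγ n)
      (setIntegral_pf_iterate_one hγ n).le ih

theorem integrableOn_rpow_neg (hγ1 : γ < 1) : IntegrableOn (fun x : ℝ => x ^ (-γ)) (Icc 0 1) := by
  rw [integrableOn_Icc_iff_integrableOn_Ioc, ← intervalIntegrable_iff_integrableOn_Ioc_of_le
    zero_le_one]
  exact intervalIntegral.intervalIntegrable_rpow' (by linarith)

theorem setIntegral_rpow_neg (hγ1 : γ < 1) {e : ℝ} (he : 0 ≤ e) :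
    ∫ x in Icc 0 e, x ^ (-γ) = e ^ (1 - γ) / (1 - γ) := by
  rw [integral_Icc_eq_integral_Ioc, ← intervalIntegral.integral_of_le he,
    integral_rpow (Or.inl (by linarith)), Real.zero_rpow (by linarith)]
  rw [sub_zero, neg_add_eq_sub]

theorem DecUnit.setIntegral_le_rpow (hγ1 : γ < 1) {g : ℝ → ℝ} (hg : DecUnit g)
    (hle : ∀ x ∈ Ioc (0 : ℝ) 1, g x ≤ 4 * x ^ (-γ)) {e : ℝ} (he : e ∈ Icc (0 : ℝ) 1) :
    ∫ x in Icc 0 e, g x ≤ 4 / (1 - γ) * e ^ (1 - γ) := by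
  have hsub : Ioc 0 e ⊆ Icc 0 1 := fun x hx => ⟨hx.1.le, hx.2.trans he.2⟩
  have h := setIntegral_mono_on (f := g) (g := fun x => 4 * x ^ (-γ)) (μ := volume)
    (hg.integrableOn.mono_set hsub) (((integrableOn_rpow_neg hγ1).mono_set hsub).const_mul 4)
    measurableSet_Ioc (fun x hx => hle x ⟨hx.1, hx.2.trans he.2⟩)
  rw [← integral_Icc_eq_integral_Ioc, ← integral_Icc_eq_integral_Ioc, integral_const_mul,
    setIntegral_rpow_neg hγ1 he.1] at h
  calc _ ≤ _ := h
    _ = _ := by ring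

/-- The backward orbit of `1` along the left branch. -/
def leftOrbit (γ : ℝ) (k : ℕ) : ℝ := (leftInv γ)^[k] 1

theorem leftOrbit_succ (k : ℕ) : leftOrbit γ (k + 1) = leftInv γ (leftOrbit γ k) :=
  Function.iterate_succ_apply' _ _ _

theorem leftOrbit_mem (hγ : 0 < γ) (k : ℕ) : leftOrbit γ k ∈ Ioc (0 : ℝ) 1 := by
  induction k with
  | zero => simp [leftOrbit]
  | succ k ih =>
    rw [leftOrbit_succ]
    exact ⟨leftInv_pos hγ ih, (leftInv_mem_unit hγ ⟨ih.1.le, ih.2⟩).2⟩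

theorem leftOrbit_mem_Icc (hγ : 0 < γ) (k : ℕ) : leftOrbit γ k ∈ Icc (0 : ℝ) 1 :=
  ⟨(leftOrbit_mem hγ k).1.le, (leftOrbit_mem hγ k).2⟩

theorem leftOrbit_rpow_ge (hγ : 0 < γ) (hγ1 : γ ≤ 1) (k : ℕ) :
    1 + γ / 2 * k ≤ leftOrbit γ k ^ (-γ) := by
  induction k with
  | zero => simp [leftOrbit]
  | succ k ih =>
    obtain ⟨y, ξ, hy, hy0, hξ0, hξ1, -, hyp, hxp⟩ := rpow_neg_leftInv hγ (leftOrbit_mem hγ k)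
    rw [leftOrbit_succ, ← hy, hyp]
    rw [hxp] at ih
    have h1 := one_add_rpow_neg_le hγ hγ1 hξ0.le
    have h2 := one_le_two_rpow hγ
    have h3 : 2 ^ γ / ξ * (1 + ξ) ^ (-γ) ≤ 2 ^ γ / ξ * (1 - γ * (ξ / (1 + ξ))) := by gcongr
    have h4 : 2 ^ γ / ξ * (1 - γ * (ξ / (1 + ξ))) = 2 ^ γ / ξ - γ * (2 ^ γ / (1 + ξ)) := by
      field_simp
    have h5 : 1 / 2 ≤ 2 ^ γ / (1 + ξ) := by
      rw [div_le_div_iff₀ (by norm_num) (by linarith)]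
      linarith
    push_cast
    nlinarith

theorem leftOrbit_rpow_le (hγ : 0 < γ) (hγ1 : γ < 1) (k : ℕ) :
    leftOrbit γ k ^ (1 - γ) ≤ (1 + γ / 2 * k) ^ (-((1 - γ) / γ)) := by
  have h := leftOrbit_rpow_ge hγ hγ1.le k
  have hz := leftOrbit_mem hγ k
  have h2 := Real.rpow_le_rpow_of_nonpos (by positivity : (0 : ℝ) < 1 + γ / 2 * k) h
    (neg_nonpos.2 (div_nonneg (by linarith) hγ.le) : -((1 - γ) / γ) ≤ 0)
  rw [← Real.rpow_mul hz.1.le] at h2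
  convert h2 using 2
  field_simp

theorem tendsto_leftOrbit (hγ : 0 < γ) (hγ1 : γ < 1) :
    Tendsto (fun k => leftOrbit γ k ^ (1 - γ)) atTop (𝓝 0) := by
  refine squeeze_zero (fun k => Real.rpow_nonneg (leftOrbit_mem hγ k).1.le _)
    (leftOrbit_rpow_le hγ hγ1) ?_
  refine (tendsto_rpow_neg_atTop (div_pos (by linarith) hγ)).comp ?_
  exact tendsto_atTop_add_const_left _ _
    (tendsto_natCast_atTop_atTop.const_mul_atTop (by positivity))

theorem DecUnit.pf_iterate_ge (hγ : 0 < γ) (hγ1 : γ < 1 / 2) {g : ℝ → ℝ} (hg : DecUnit g)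
    (j : ℕ) : (1 / 3) ^ j * g (leftOrbit γ j) ≤ (_root_.pf γ)^[j] g 1 := by
  induction j generalizing g with
  | zero => simp [leftOrbit]
  | succ j ih =>
    rw [Function.iterate_succ_apply, pow_succ, mul_assoc]
    refine le_trans ?_ (ih (hg.pf hγ))
    gcongr
    have hz := leftOrbit_mem_Icc hγ j
    have hr := hg.pfRight.2 _ hz
    have h0 := hg.2 _ (leftInv_mem_unit hγ hz)
    have hJ := leftJac_le_three hγ hγ1 (leftInv_mem hγ hz)
    have hJ1 := one_le_leftJac hγ (leftInv_mem hγ hz).1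
    have : 1 / 3 * g (leftInv γ (leftOrbit γ j)) ≤ _root_.pfLeft γ g (leftOrbit γ j) := by
      unfold _root_.pfLeft
      rw [le_div_iff₀ (by linarith)]
      nlinarith
    rw [leftOrbit_succ]
    unfold _root_.pf
    linarith

theorem exists_pos_le_pf_iterate_one (hγ : 0 < γ) (hγ1 : γ < 1 / 2) :
    ∃ c : ℝ, 0 < c ∧ c ≤ 1 ∧ ∀ i, ∀ x ∈ Icc (0 : ℝ) 1, c ≤ (pf γ)^[i] (fun _ => 1) x := by
  have h1 : Tendsto (fun k => 4 / (1 - γ) * leftOrbit γ k ^ (1 - γ)) atTop (𝓝 0) := by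
    simpa using (tendsto_leftOrbit hγ (by linarith)).const_mul (4 / (1 - γ))
  obtain ⟨K, hK⟩ := (h1.eventually (ge_mem_nhds (by norm_num : (0 : ℝ) < 1 / 2))).exists
  have hz := leftOrbit_mem_Icc hγ K
  have hpow : ((1 : ℝ) / 3) ^ K ≤ 1 := pow_le_one₀ (by norm_num) (by norm_num)
  have hpow0 : 0 < ((1 : ℝ) / 3) ^ K := by positivity
  refine ⟨(1 / 3) ^ K * (1 / 2), by positivity, by linarith, fun i x hx => ?_⟩
  refine le_trans ?_ ((decUnit_one.pf_iterate hγ i).1 hx ⟨zero_le_one, le_rfl⟩ hx.2)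
  rcases le_total K i with hi | hi
  · obtain ⟨j, rfl⟩ := Nat.exists_eq_add_of_le hi
    rw [Function.iterate_add_apply]
    have hd := decUnit_one.pf_iterate hγ j
    refine le_trans ?_ (hd.pf_iterate_ge hγ hγ1 K)
    gcongr
    have e1 := hd.setIntegral_le_rpow (by linarith) (pf_iterate_one_le hγ hγ1 j) hz
    have e2 := hd.setIntegral_le_mul hz.1 hz.2 le_rfl
    have e3 := hd.setIntegral_split le_rfl hz.1 hz.2 le_rfl
    rw [setIntegral_pf_iterate_one hγ] at e3
    have e4 := hd.2 _ hz
    nlinarith [hz.1]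
  · refine le_trans ?_ (decUnit_one.pf_iterate_ge hγ hγ1 i)
    have : ((1 : ℝ) / 3) ^ K ≤ (1 / 3) ^ i :=
      pow_le_pow_of_le_one (by norm_num) (by norm_num) hi
    linarith

end Bounds

section Coupling

variable {γ : ℝ}

theorem pf_iterate_const (c : ℝ) (n : ℕ) :
    (pf γ)^[n] (fun _ => c) = fun x => c * (pf γ)^[n] (fun _ => 1) x := by
  have h := pf_iterate_add_const_mul (γ := γ) (c - 1) (fun _ => 1) (fun _ => 1) n
  have e : (fun _ : ℝ => (1 : ℝ) + (c - 1) * 1) = fun _ => c := by funext; ring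
  rw [e] at h
  rw [h]
  funext x
  ring

theorem DecUnit.mass_le_pf_iterate (hγ : 0 < γ) (hγ1 : γ < 1 / 2) {c : ℝ} (hc0 : 0 < c)
    (hc1 : c ≤ 1) (hc : ∀ i, ∀ x ∈ Icc (0 : ℝ) 1, c ≤ (_root_.pf γ)^[i] (fun _ => 1) x)
    {r : ℝ → ℝ} (hr : DecUnit r) (k : ℕ) :
    c / 3 * ((2 + γ) / 2 * r 1 + ∫ x in Icc (leftOrbit γ k) 1, r x)
      ≤ (_root_.pf γ)^[k] r 1 := by
  have h1mem : (1 : ℝ) ∈ Icc (0 : ℝ) 1 := ⟨zero_le_one, le_rfl⟩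
  induction k generalizing r with
  | zero =>
    have h0 := hr.2 1 h1mem
    have : c / 3 * ((2 + γ) / 2) ≤ 1 := by nlinarith
    simp only [leftOrbit, Function.iterate_zero, id, Icc_self, Measure.restrict_singleton,
      Real.volume_singleton, zero_smul, integral_zero_measure, add_zero]
    nlinarith
  | succ k ih =>
    have hz := leftOrbit_mem_Icc hγ k
    have hz' := leftInv_mem hγ hz
    have hsum : _root_.pf γ r = fun x => _root_.pfLeft γ r x + 1 * _root_.pfRight r x := by
      funext x
      simp [_root_.pf]
    have hleft := ih (hr.pfLeft hγ)
    have hint : ∫ x in Icc (leftOrbit γ k) 1, _root_.pfLeft γ r x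
        = ∫ x in Icc (leftOrbit γ (k + 1)) (1 / 2), r x := by
      have := setIntegral_pfLeft hγ hz' r (fun _ => 1)
      rw [leftBranch_leftInv hγ hz] at this
      simpa [leftOrbit_succ] using this
    have hl1 : _root_.pfLeft γ r 1 = r (1 / 2) / (2 + γ) := by
      rw [_root_.pfLeft, leftInv_one hγ, leftJac_half]
    have hright : r 1 / 2 * c ≤ (_root_.pf γ)^[k] (_root_.pfRight r) 1 := by
      have h := pf_iterate_mono hγ (g := fun _ => r 1 / 2) (h := _root_.pfRight r)
        (fun x hx => div_le_div_of_nonneg_right (hr.1 (right_mem hx) h1mem (right_mem hx).2)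
          two_pos.le) k 1 h1mem
      rw [pf_iterate_const] at h
      have := hr.2 1 h1mem
      exact le_trans (mul_le_mul_of_nonneg_left (hc k 1 h1mem) (by linarith)) h
    have hsplit := hr.setIntegral_split hz'.1 hz'.2 (by norm_num : (1 / 2 : ℝ) ≤ 1) le_rfl
    rw [← leftOrbit_succ] at hsplit
    have hhalf := hr.setIntegral_le_mul (by norm_num) (by norm_num : (1 / 2 : ℝ) ≤ 1) le_rfl
    have e : (2 + γ) / 2 * (r (1 / 2) / (2 + γ)) = r (1 / 2) / 2 := by
      field_simp
    rw [hint, hl1, e] at hleft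
    rw [Function.iterate_succ_apply, hsum, pf_iterate_add_const_mul, hsplit]
    simp only [one_mul]
    have h0 := hr.2 1 h1mem
    have h2 : c / 3 * ((2 + γ) / 2 * r 1) ≤ r 1 / 2 * c := by
      have : 0 ≤ c * r 1 := by positivity
      nlinarith
    have h3 : c / 3 * ∫ x in Icc (1 / 2) 1, r x ≤ c / 3 * (r (1 / 2) / 2) := by
      gcongr
      linarith
    linarith

/-- Nonincreasing functions dominated by an iterate of the constant function `1` under the
transfer operator. -/
def AdmUnit (γ : ℝ) (g : ℝ → ℝ) : Prop :=
  DecUnit g ∧ ∃ N, ∀ x ∈ Icc (0 : ℝ) 1, g x ≤ (pf γ)^[N] (fun _ => 1) x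

theorem AdmUnit.le_rpow (hγ : 0 < γ) (hγ1 : γ < 1 / 2) {g : ℝ → ℝ} (hg : AdmUnit γ g) :
    ∀ x ∈ Ioc (0 : ℝ) 1, g x ≤ 4 * x ^ (-γ) := by
  obtain ⟨-, N, hN⟩ := hg
  exact fun x hx => (hN x ⟨hx.1.le, hx.2⟩).trans (pf_iterate_one_le hγ hγ1 N x hx)

theorem AdmUnit.mass_le_one (hγ : 0 < γ) {g : ℝ → ℝ} (hg : AdmUnit γ g) :
    ∫ x in Icc 0 1, g x ≤ 1 := by
  obtain ⟨hd, N, hN⟩ := hg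
  refine le_trans ?_ (setIntegral_pf_iterate_one hγ N).le
  exact setIntegral_mono_on hd.integrableOn (decUnit_one.pf_iterate hγ N).integrableOn
    measurableSet_Icc hN

theorem AdmUnit.mass_nonneg {g : ℝ → ℝ} (hg : AdmUnit γ g) : 0 ≤ ∫ x in Icc 0 1, g x :=
  setIntegral_nonneg measurableSet_Icc hg.1.2

theorem AdmUnit.pf_iterate_sub (hγ : 0 < γ) {g : ℝ → ℝ} (hg : AdmUnit γ g) {k : ℕ} {s : ℝ}
    (hs : 0 ≤ s) (hle : s ≤ (pf γ)^[k] g 1) : AdmUnit γ (fun x => (pf γ)^[k] g x - s) := by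
  obtain ⟨hd, N, hN⟩ := hg
  have hd' := hd.pf_iterate hγ k
  refine ⟨⟨fun x hx y hy hxy => sub_le_sub_right (hd'.1 hx hy hxy) s, fun x hx => ?_⟩,
    k + N, fun x hx => ?_⟩
  · have := hd'.1 hx ⟨zero_le_one, le_rfl⟩ hx.2
    linarith
  · rw [Function.iterate_add_apply]
    have := pf_iterate_mono hγ hN k x hx
    linarith

theorem AdmUnit.exists_le_pf_iterate (hγ : 0 < γ) (hγ1 : γ < 1 / 2) :
    ∃ η C : ℝ, 0 < η ∧ η < 1 ∧ 0 < C ∧ ∀ m : ℝ, 0 < m → m ≤ 1 → ∃ k : ℕ, 0 < k ∧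
      (k : ℝ) ≤ C * m ^ (-(γ / (1 - γ))) ∧ ∀ g, AdmUnit γ g → ∫ x in Icc 0 1, g x = m →
        η * m ≤ (_root_.pf γ)^[k] g 1 := by
  obtain ⟨c, hc0, hc1, hc⟩ := exists_pos_le_pf_iterate_one hγ hγ1
  set p := γ / (1 - γ) with hp
  have h1γ : 0 < 1 - γ := by linarith
  have hp0 : 0 < p := div_pos hγ h1γ
  refine ⟨c / 6, 2 / γ * ((1 - γ) / 8) ^ (-p) + 1, by positivity, by linarith, by positivity, ?_⟩
  intro m hm0 hm1
  have hB : 0 < 2 / γ * (((1 - γ) / 8) ^ (-p) * m ^ (-p)) := by positivity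
  refine ⟨⌈2 / γ * (((1 - γ) / 8) ^ (-p) * m ^ (-p))⌉₊, Nat.ceil_pos.2 hB, ?_, ?_⟩
  · have h1 := (Nat.ceil_lt_add_one hB.le).le
    have h2 : 1 ≤ m ^ (-p) := Real.one_le_rpow_of_pos_of_le_one_of_nonpos hm0 hm1 (by linarith)
    nlinarith
  · set k := ⌈2 / γ * (((1 - γ) / 8) ^ (-p) * m ^ (-p))⌉₊ with hk
    intro g hg hmass
    have hz := leftOrbit_mem_Icc hγ k
    have h1 : ((1 - γ) / 8 * m) ^ (-p) ≤ 1 + γ / 2 * k := by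
      rw [Real.mul_rpow (by positivity) hm0.le]
      have := Nat.le_ceil (2 / γ * (((1 - γ) / 8) ^ (-p) * m ^ (-p)))
      rw [← hk] at this
      have h3 : γ / 2 * (2 / γ * (((1 - γ) / 8) ^ (-p) * m ^ (-p))) ≤ γ / 2 * k := by gcongr
      have h4 : γ / 2 * (2 / γ * (((1 - γ) / 8) ^ (-p) * m ^ (-p)))
          = ((1 - γ) / 8) ^ (-p) * m ^ (-p) := by
        field_simp
      linarith
    have h2 : leftOrbit γ k ^ (1 - γ) ≤ (1 - γ) / 8 * m := by
      refine (leftOrbit_rpow_le hγ (by linarith) k).trans ?_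
      have hb : 0 < (1 - γ) / 8 * m := by positivity
      have := Real.rpow_le_rpow_of_nonpos (by positivity) h1
        (neg_nonpos.2 (div_nonneg h1γ.le hγ.le) : -((1 - γ) / γ) ≤ 0)
      rw [← Real.rpow_mul hb.le] at this
      have e : -p * -((1 - γ) / γ) = 1 := by rw [hp]; field_simp
      rwa [e, Real.rpow_one] at this
    have h3 := hg.1.setIntegral_le_rpow (by linarith) (hg.le_rpow hγ hγ1) hz
    have h4 := hg.1.setIntegral_split le_rfl hz.1 hz.2 le_rfl
    have h5 := hg.1.mass_le_pf_iterate hγ hγ1 hc0 hc1 hc k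
    have h6 : 4 / (1 - γ) * leftOrbit γ k ^ (1 - γ) ≤ m / 2 := by
      calc _ ≤ 4 / (1 - γ) * ((1 - γ) / 8 * m) := by gcongr
        _ = m / 2 := by field_simp; ring
    have h7 := hg.1.2 1 ⟨zero_le_one, le_rfl⟩
    refine le_trans ?_ h5
    rw [hmass] at h4
    have h8 : m / 2 ≤ ∫ x in Icc (leftOrbit γ k) 1, g x := by linarith
    have h9 : 0 ≤ (2 + γ) / 2 * g 1 := by positivity
    calc c / 6 * m = c / 3 * (m / 2) := by ring
      _ ≤ _ := by gcongr; linarith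

theorem setIntegral_abs_pf_iterate_sub_le (hγ : 0 < γ) {g h : ℝ → ℝ} (hg : AdmUnit γ g)
    (hh : AdmUnit γ h) (n : ℕ) :
    ∫ x in Icc 0 1, |(pf γ)^[n] g x - (pf γ)^[n] h x|
      ≤ (∫ x in Icc 0 1, g x) + ∫ x in Icc 0 1, h x := by
  have dg := hg.1.pf_iterate hγ n
  have dh := hh.1.pf_iterate hγ n
  rw [← setIntegral_pf_iterate hγ hg.1.integrableOn n,
    ← setIntegral_pf_iterate hγ hh.1.integrableOn n,
    ← integral_add dg.integrableOn dh.integrableOn]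
  refine setIntegral_mono_on (dg.integrableOn.sub dh.integrableOn).abs
    (dg.integrableOn.add dh.integrableOn) measurableSet_Icc fun x hx => ?_
  have h1 := dg.2 x hx
  have h2 := dh.2 x hx
  exact abs_le.2 ⟨by linarith, by linarith⟩

theorem exists_setIntegral_abs_pf_iterate_sub_le (hγ : 0 < γ) (hγ1 : γ < 1 / 2) :
    ∃ Q : ℝ, 0 < Q ∧ ∀ g h, AdmUnit γ g → AdmUnit γ h →
      ∫ x in Icc 0 1, g x = ∫ x in Icc 0 1, h x → ∀ n : ℕ, 0 < n →
        ∫ x in Icc 0 1, |(pf γ)^[n] g x - (pf γ)^[n] h x| ≤ Q * (n : ℝ) ^ (-((1 - γ) / γ)) := by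
  obtain ⟨η, C, hη0, hη1, hC, hmain⟩ := AdmUnit.exists_le_pf_iterate hγ hγ1
  set p := γ / (1 - γ) with hp
  set δ := (1 - γ) / γ with hδ
  have h1γ : 0 < 1 - γ := by linarith
  have hp0 : 0 < p := div_pos hγ h1γ
  have hδ0 : 0 < δ := div_pos h1γ hγ
  have hpδ : -p * -δ = 1 := by rw [hp, hδ]; field_simp
  have hη' : 1 < (1 - η) ^ (-p) :=
    Real.one_lt_rpow_of_pos_of_lt_one_of_neg (by linarith) (by linarith) (by linarith)
  set S := C / ((1 - η) ^ (-p) - 1) with hS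
  have hS0 : 0 < S := div_pos hC (by linarith)
  have hSC : S * ((1 - η) ^ (-p) - 1) = C := div_mul_cancel₀ _ (by linarith)
  set Q := 2 * (C + S) ^ δ with hQ
  have hQ0 : 0 < Q := by positivity
  have key : ∀ n : ℕ, ∀ m : ℝ, 0 < m → m ≤ 1 → ∀ g h, AdmUnit γ g → AdmUnit γ h →
      ∫ x in Icc 0 1, g x = m → ∫ x in Icc 0 1, h x = m →
      ∫ x in Icc 0 1, |(pf γ)^[n] g x - (pf γ)^[n] h x| ≤ Q * (n + S * m ^ (-p)) ^ (-δ) := by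
    intro n
    induction n using Nat.strong_induction_on with
    | _ n ih =>
    intro m hm0 hm1 g h hg hh hgm hhm
    obtain ⟨k, hk0, hkC, hk⟩ := hmain m hm0 hm1
    have hmp : 0 < m ^ (-p) := by positivity
    rcases lt_or_ge n k with hnk | hnk
    · refine (setIntegral_abs_pf_iterate_sub_le hγ hg hh n).trans ?_
      have hn : (n : ℝ) ≤ C * m ^ (-p) := le_trans (by exact_mod_cast hnk.le) hkC
      have h1 : ((C + S) * m ^ (-p)) ^ (-δ) ≤ (n + S * m ^ (-p)) ^ (-δ) :=
        Real.rpow_le_rpow_of_nonpos (by positivity) (by linarith) (by linarith)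
      rw [Real.mul_rpow (by positivity) hmp.le, ← Real.rpow_mul hm0.le, hpδ, Real.rpow_one,
        Real.rpow_neg (by positivity)] at h1
      rw [hgm, hhm]
      calc m + m = Q * (((C + S) ^ δ)⁻¹ * m) := by rw [hQ]; field_simp; ring
        _ ≤ _ := by gcongr
    · obtain ⟨j, rfl⟩ := Nat.exists_eq_add_of_le' hnk
      have hg' := hg.pf_iterate_sub hγ (by positivity) (hk g hg hgm)
      have hh' := hh.pf_iterate_sub hγ (by positivity) (hk h hh hhm)
      have hmass : ∀ q, AdmUnit γ q → ∫ x in Icc 0 1, q x = m →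
          ∫ x in Icc 0 1, ((pf γ)^[k] q x - η * m) = (1 - η) * m := by
        intro q hq hqm
        rw [integral_sub (hq.1.pf_iterate hγ k).integrableOn (integrable_const _),
          setIntegral_pf_iterate hγ hq.1.integrableOn, hqm]
        simp
        ring
      have hstep := ih j (by omega) ((1 - η) * m) (mul_pos (by linarith) hm0) (by nlinarith)
        _ _ hg' hh' (hmass g hg hgm) (hmass h hh hhm)
      have hcancel : ∀ q : ℝ → ℝ, (pf γ)^[j] (fun x => (pf γ)^[k] q x - η * m)
          = fun x => (pf γ)^[j + k] q x - η * m * (pf γ)^[j] (fun _ => 1) x := by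
        intro q
        have e : (fun x => (pf γ)^[k] q x - η * m)
            = fun x => (pf γ)^[k] q x + -(η * m) * (fun _ => 1) x := by
          funext x
          ring
        rw [e, pf_iterate_add_const_mul, Function.iterate_add_apply]
        funext x
        ring
      rw [hcancel g, hcancel h] at hstep
      simp only [sub_sub_sub_cancel_right] at hstep
      refine hstep.trans ?_
      rw [Real.mul_rpow (by linarith) hm0.le]
      refine mul_le_mul_of_nonneg_left (Real.rpow_le_rpow_of_nonpos (by positivity) ?_
        (by linarith)) hQ0.le
      have e : S * ((1 - η) ^ (-p) * m ^ (-p))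
          = S * ((1 - η) ^ (-p) - 1) * m ^ (-p) + S * m ^ (-p) := by ring
      rw [e, hSC]
      push_cast
      linarith
  refine ⟨Q, hQ0, fun g h hg hh hgh n hn => ?_⟩
  have hnn : (0 : ℝ) < n := by exact_mod_cast hn
  rcases hg.mass_nonneg.eq_or_lt with h0 | h0
  · refine (setIntegral_abs_pf_iterate_sub_le hγ hg hh n).trans ?_
    rw [← hgh, ← h0, add_zero]
    positivity
  · refine (key n _ h0 (hg.mass_le_one hγ) g h hg hh rfl hgh.symm).trans ?_
    refine mul_le_mul_of_nonneg_left (Real.rpow_le_rpow_of_nonpos hnn ?_ (by linarith)) hQ0.le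
    have : 0 ≤ S * (∫ x in Icc 0 1, g x) ^ (-p) := by positivity
    linarith

end Coupling

section Decay

variable {γ : ℝ}

theorem admUnit_of_le_one {g : ℝ → ℝ} (hg : DecUnit g) (h1 : ∀ x ∈ Icc (0 : ℝ) 1, g x ≤ 1) :
    AdmUnit γ g := ⟨hg, 0, h1⟩

theorem abs_setIntegral_mul_le {g b : ℝ → ℝ} (hg : IntegrableOn g (Icc 0 1)) {M : ℝ}
    (hb : ∀ x, |b x| ≤ M) :
    |∫ x in Icc 0 1, g x * b x| ≤ M * ∫ x in Icc 0 1, |g x| := by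
  rw [← integral_const_mul, ← Real.norm_eq_abs]
  refine norm_integral_le_of_norm_le (hg.abs.const_mul M) (ae_of_all _ fun x => ?_)
  rw [Real.norm_eq_abs, abs_mul, mul_comm]
  exact mul_le_mul_of_nonneg_right (hb x) (abs_nonneg _)

/-- Two admissible densities with the same mass yield integrals of `b ∘ T^n` that differ by
`O(n^{-(1-γ)/γ})`. -/
theorem exists_abs_sub_setIntegral_iterate_le (hγ : 0 < γ) (hγ1 : γ < 1 / 2) :
    ∃ Q : ℝ, 0 < Q ∧ ∀ g h, AdmUnit γ g → AdmUnit γ h →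
      ∫ x in Icc 0 1, g x = ∫ x in Icc 0 1, h x → ∀ n : ℕ, 0 < n → ∀ (b : ℝ → ℝ) (M : ℝ),
        Measurable b → (∀ x, |b x| ≤ M) →
        |(∫ x in Icc 0 1, g x * b ((Tmap γ)^[n] x)) - ∫ x in Icc 0 1, h x * b ((Tmap γ)^[n] x)|
          ≤ M * (Q * (n : ℝ) ^ (-((1 - γ) / γ))) := by
  obtain ⟨Q, hQ0, hQ⟩ := exists_setIntegral_abs_pf_iterate_sub_le hγ hγ1
  refine ⟨Q, hQ0, fun g h hg hh hgh n hn b M hb hM => ?_⟩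
  have hM0 : 0 ≤ M := (abs_nonneg _).trans (hM 0)
  have ig := integrableOn_pf_iterate hγ hg.1.integrableOn n
  have ih := integrableOn_pf_iterate hγ hh.1.integrableOn n
  rw [← setIntegral_pf_iterate_mul hγ hg.1.integrableOn hb hM,
    ← setIntegral_pf_iterate_mul hγ hh.1.integrableOn hb hM,
    ← integral_sub (IntegrableOn.mul_bounded ig hb hM) (IntegrableOn.mul_bounded ih hb hM)]
  simp only [← sub_mul]
  exact (abs_setIntegral_mul_le (ig.sub ih) hM).trans
    (mul_le_mul_of_nonneg_left (hQ g h hg hh hgh n hn) hM0)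

/-- The functional measuring the lack of decorrelation between `φ` and `ψ ∘ T^n` with respect to
Lebesgue measure on the unit interval. -/
def lebCov (γ : ℝ) (ψ φ : ℝ → ℝ) (n : ℕ) : ℝ :=
  (∫ x in Icc 0 1, φ x * ψ ((Tmap γ)^[n] x))
    - (∫ x in Icc 0 1, φ x) * ∫ x in Icc 0 1, ψ ((Tmap γ)^[n] x)

variable {ψ : ℝ → ℝ} {M : ℝ}

theorem integrableOn_mul_iterate (hψ : Measurable ψ) (hM : ∀ x, |ψ x| ≤ M) {φ : ℝ → ℝ}
    (hφ : IntegrableOn φ (Icc 0 1)) (n : ℕ) :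
    IntegrableOn (fun x => φ x * ψ ((Tmap γ)^[n] x)) (Icc 0 1) :=
  IntegrableOn.mul_bounded hφ (hψ.comp ((measurable_Tmap γ).iterate n)) fun _ => hM _

theorem lebCov_add (hψ : Measurable ψ) (hM : ∀ x, |ψ x| ≤ M) {φ₁ φ₂ : ℝ → ℝ}
    (h₁ : IntegrableOn φ₁ (Icc 0 1)) (h₂ : IntegrableOn φ₂ (Icc 0 1)) (n : ℕ) :
    lebCov γ ψ (fun x => φ₁ x + φ₂ x) n = lebCov γ ψ φ₁ n + lebCov γ ψ φ₂ n := by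
  simp only [lebCov, add_mul]
  rw [integral_add h₁ h₂, integral_add (integrableOn_mul_iterate hψ hM h₁ n)
    (integrableOn_mul_iterate hψ hM h₂ n)]
  ring

theorem lebCov_const_mul (c : ℝ) (φ : ℝ → ℝ) (n : ℕ) :
    lebCov γ ψ (fun x => c * φ x) n = c * lebCov γ ψ φ n := by
  simp only [lebCov, mul_assoc, integral_const_mul]
  ring

theorem lebCov_one (n : ℕ) : lebCov γ ψ (fun _ => 1) n = 0 := by
  simp [lebCov]

theorem abs_lebCov_le (hM : ∀ x, |ψ x| ≤ M) {φ : ℝ → ℝ}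
    (hφ : IntegrableOn φ (Icc 0 1)) (n : ℕ) :
    |lebCov γ ψ φ n| ≤ 2 * M * ∫ x in Icc 0 1, |φ x| := by
  have h1 := abs_setIntegral_mul_le (b := fun x => ψ ((Tmap γ)^[n] x)) hφ fun x => hM _
  have h2 : |∫ x in Icc 0 1, φ x| ≤ ∫ x in Icc 0 1, |φ x| := abs_integral_le_integral_abs
  have h3 : |∫ x in Icc 0 1, ψ ((Tmap γ)^[n] x)| ≤ M := by
    have := abs_setIntegral_mul_le (g := fun _ => 1) (b := fun x => ψ ((Tmap γ)^[n] x))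
      (by simp) fun x => hM _
    simpa using this
  have h4 := mul_le_mul h2 h3 (abs_nonneg _) ((abs_nonneg _).trans h2)
  rw [← abs_mul] at h4
  refine (abs_sub _ _).trans ?_
  linarith

theorem tendsto_lebCov_decUnit (hγ : 0 < γ) (hγ1 : γ < 1 / 2) (hψ : Measurable ψ)
    (hM : ∀ x, |ψ x| ≤ M) {g : ℝ → ℝ} (hg : DecUnit g) (h1 : ∀ x ∈ Icc (0 : ℝ) 1, g x ≤ 1) :
    Tendsto (lebCov γ ψ g) atTop (𝓝 0) := by
  obtain ⟨Q, -, hQ⟩ := exists_abs_sub_setIntegral_iterate_le hγ hγ1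
  have ag : AdmUnit γ g := admUnit_of_le_one hg h1
  have ah : AdmUnit γ (fun _ => ∫ x in Icc 0 1, g x) :=
    admUnit_of_le_one ⟨antitoneOn_const, fun _ _ => ag.mass_nonneg⟩ fun _ _ => ag.mass_le_one hγ
  have hlim : Tendsto (fun n : ℕ => M * (Q * (n : ℝ) ^ (-((1 - γ) / γ)))) atTop (𝓝 0) := by
    have := (tendsto_rpow_neg_atTop (div_pos (by linarith : 0 < 1 - γ) hγ)).comp
      tendsto_natCast_atTop_atTop
    simpa using (this.const_mul Q).const_mul M
  refine squeeze_zero_norm' ?_ hlim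
  filter_upwards [eventually_gt_atTop 0] with n hn
  have := hQ g _ ag ah (by simp) n hn ψ M hψ hM
  rwa [integral_const_mul] at this

theorem tendsto_lebCov_polynomial (hγ : 0 < γ) (hγ1 : γ < 1 / 2) (hψ : Measurable ψ)
    (hM : ∀ x, |ψ x| ≤ M) (p : Polynomial ℝ) :
    Tendsto (lebCov γ ψ fun x => p.eval x) atTop (𝓝 0) := by
  induction p using Polynomial.induction_on' with
  | add p q hp hq =>
    have : (lebCov γ ψ fun x => (p + q).eval x)
        = fun n => lebCov γ ψ (fun x => p.eval x) n + lebCov γ ψ (fun x => q.eval x) n := by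
      funext n
      simp only [Polynomial.eval_add]
      exact lebCov_add hψ hM p.continuous.continuousOn.integrableOn_Icc
        q.continuous.continuousOn.integrableOn_Icc n
    rw [this]
    simpa using hp.add hq
  | monomial k c =>
    have hd : DecUnit fun x : ℝ => 1 - x ^ k :=
      ⟨fun x hx y hy hxy => sub_le_sub_left (pow_le_pow_left₀ hx.1 hxy k) 1,
        fun x hx => sub_nonneg.2 (pow_le_one₀ hx.1 hx.2)⟩
    have h := tendsto_lebCov_decUnit hγ hγ1 hψ hM hd fun x hx => by
      have := pow_nonneg hx.1 k
      linarith
    have : (lebCov γ ψ fun x => (Polynomial.monomial k c).eval x)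
        = fun n => -c * lebCov γ ψ (fun x => 1 - x ^ k) n := by
      funext n
      have e : (fun x : ℝ => (Polynomial.monomial k c).eval x)
          = fun x => c * 1 + -c * (1 - x ^ k) := by
        funext x
        rw [Polynomial.eval_monomial]
        ring
      rw [e, lebCov_add hψ hM (integrable_const _) (hd.integrableOn.const_mul _),
        lebCov_const_mul, lebCov_const_mul, lebCov_one]
      ring
    rw [this]
    simpa using h.const_mul (-c)

theorem exists_polynomial_setIntegral_abs_sub_le {φ : ℝ → ℝ} (hφ : IntegrableOn φ (Icc 0 1))
    {ε : ℝ} (hε : 0 < ε) : ∃ p : Polynomial ℝ, ∫ x in Icc 0 1, |φ x - p.eval x| ≤ ε := by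
  obtain ⟨u, hu, hui⟩ := Integrable.exists_boundedContinuous_integral_sub_le hφ (half_pos hε)
  obtain ⟨p, hp⟩ := exists_polynomial_near_of_continuousOn 0 1 u u.continuous.continuousOn
    (ε / 2) (half_pos hε)
  refine ⟨p, ?_⟩
  have hpi : IntegrableOn (fun x => p.eval x) (Icc 0 1) :=
    p.continuous.continuousOn.integrableOn_Icc
  have h1 : ∫ x in Icc 0 1, |u x - p.eval x| ≤ ε / 2 := by
    have := setIntegral_mono_on (μ := volume) (s := Icc (0 : ℝ) 1)
      (f := fun x => |u x - p.eval x|) (g := fun _ => ε / 2) (Integrable.sub hui hpi).abs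
      (by simp) measurableSet_Icc fun x hx => by
        rw [abs_sub_comm]
        exact (hp x hx).le
    simpa using this
  have h2 : ∫ x in Icc 0 1, |φ x - p.eval x|
      ≤ ∫ x in Icc 0 1, (‖φ x - u x‖ + |u x - p.eval x|) :=
    integral_mono (Integrable.sub hφ hpi).abs
      ((Integrable.sub hφ hui).norm.add (Integrable.sub hui hpi).abs)
      fun x => abs_sub_le _ _ _
  have h3 : ∫ x in Icc 0 1, (‖φ x - u x‖ + |u x - p.eval x|)
      = (∫ x in Icc 0 1, ‖φ x - u x‖) + ∫ x in Icc 0 1, |u x - p.eval x| :=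
    integral_add (Integrable.sub hφ hui).norm (Integrable.sub hui hpi).abs
  linarith

theorem tendsto_lebCov (hγ : 0 < γ) (hγ1 : γ < 1 / 2) (hψ : Measurable ψ)
    (hM : ∀ x, |ψ x| ≤ M) {φ : ℝ → ℝ} (hφ : IntegrableOn φ (Icc 0 1)) :
    Tendsto (lebCov γ ψ φ) atTop (𝓝 0) := by
  have hM0 : 0 ≤ M := (abs_nonneg _).trans (hM 0)
  rw [Metric.tendsto_nhds]
  intro ε hε
  obtain ⟨p, hp⟩ := exists_polynomial_setIntegral_abs_sub_le hφ
    (ε := ε / (4 * (M + 1))) (by positivity)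
  have hpi : IntegrableOn (fun x => p.eval x) (Icc 0 1) :=
    p.continuous.continuousOn.integrableOn_Icc
  have hlim := Metric.tendsto_nhds.1 (tendsto_lebCov_polynomial hγ hγ1 hψ hM p) (ε / 2)
    (half_pos hε)
  filter_upwards [hlim] with n hn
  rw [Real.dist_eq, sub_zero] at hn ⊢
  have e : φ = fun x => p.eval x + (φ x - p.eval x) := by
    funext x
    ring
  have hb := abs_lebCov_le (γ := γ) hM (Integrable.sub hφ hpi) n
  have hb' : 2 * M * ∫ x in Icc 0 1, |φ x - p.eval x| ≤ 2 * M * (ε / (4 * (M + 1))) := by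
    gcongr
  have hb'' : 2 * M * (ε / (4 * (M + 1))) < ε / 2 := by
    rw [← mul_div_assoc, div_lt_div_iff₀ (by positivity) (by norm_num)]
    nlinarith
  rw [e, lebCov_add (φ₂ := fun x => φ x - p.eval x) hψ hM hpi (Integrable.sub hφ hpi)]
  refine (abs_add_le _ _).trans_lt ?_
  have hb3 : |lebCov γ ψ (fun x => φ x - p.eval x) n|
    ≤ 2 * M * ∫ x in Icc 0 1, |φ x - p.eval x| := hb
  linarith

section Invariant

variable {ν : Measure ℝ} [IsProbabilityMeasure ν]

theorem tendsto_integral_mul_sub (hγ : 0 < γ) (hγ1 : γ < 1 / 2)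
    (hac : ν ≪ volume.restrict (Icc 0 1)) (hψ : Measurable ψ) (hM : ∀ x, |ψ x| ≤ M)
    {b : ℝ → ℝ} (hb : Measurable b) {B : ℝ} (hB : ∀ x, |b x| ≤ B) :
    Tendsto (fun n => (∫ x, b x * ψ ((Tmap γ)^[n] x) ∂ν)
      - (∫ x, b x ∂ν) * ∫ x in Icc 0 1, ψ ((Tmap γ)^[n] x)) atTop (𝓝 0) := by
  have hD : IntegrableOn (fun x => (ν.rnDeriv (volume.restrict (Icc 0 1)) x).toReal) (Icc 0 1) :=
    Measure.integrable_toReal_rnDeriv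
  refine (tendsto_lebCov hγ hγ1 hψ hM (IntegrableOn.mul_bounded hD hb hB)).congr fun n => ?_
  have h := fun q : ℝ → ℝ => integral_rnDeriv_smul hac (f := q)
  simp only [smul_eq_mul] at h
  simp only [lebCov, mul_assoc]
  rw [← h, ← h]

theorem tendsto_setIntegral_iterate (hγ : 0 < γ) (hγ1 : γ < 1 / 2)
    (hac : ν ≪ volume.restrict (Icc 0 1)) (hT : MeasurePreserving (Tmap γ) ν ν)
    (hψ : Measurable ψ) (hM : ∀ x, |ψ x| ≤ M) :
    Tendsto (fun n => ∫ x in Icc 0 1, ψ ((Tmap γ)^[n] x)) atTop (𝓝 (∫ x, ψ x ∂ν)) := by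
  have h := tendsto_integral_mul_sub hγ hγ1 hac hψ hM (b := fun _ => 1) measurable_const
    (B := 1) (by simp)
  have e : ∀ n : ℕ, ∫ x, ψ ((Tmap γ)^[n] x) ∂ν = ∫ x, ψ x ∂ν := fun n =>
    (hT.iterate n).integral_comp_of_aestronglyMeasurable hψ.aestronglyMeasurable
  simp only [one_mul, e, integral_const, probReal_univ, smul_eq_mul] at h
  simpa using (tendsto_const_nhds (x := ∫ x, ψ x ∂ν)).sub h

theorem tendsto_integral_mul_iterate (hγ : 0 < γ) (hγ1 : γ < 1 / 2)
    (hac : ν ≪ volume.restrict (Icc 0 1)) (hT : MeasurePreserving (Tmap γ) ν ν)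
    (hψ : Measurable ψ) (hM : ∀ x, |ψ x| ≤ M) :
    Tendsto (fun n => ∫ x, ψ x * ψ ((Tmap γ)^[n] x) ∂ν) atTop (𝓝 ((∫ x, ψ x ∂ν) ^ 2)) := by
  have h1 := tendsto_integral_mul_sub hγ hγ1 hac hψ hM hψ hM
  have h2 := (tendsto_setIntegral_iterate hγ hγ1 hac hT hψ hM).const_mul (∫ x, ψ x ∂ν)
  have h := h1.add h2
  simpa [sq] using h

/-- Polynomial decay of correlations of nonincreasing observables against bounded ones. -/
theorem exists_abs_integral_mul_iterate_sub_le (hγ : 0 < γ) (hγ1 : γ < 1 / 2)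
    (hac : ν ≪ volume.restrict (Icc 0 1)) (hT : MeasurePreserving (Tmap γ) ν ν) :
    ∃ Q : ℝ, 0 < Q ∧ ∀ g : ℝ → ℝ, Measurable g → AntitoneOn g (Icc 0 1) →
      (∀ x, g x ∈ Icc (0 : ℝ) 1) → ∀ n : ℕ, 0 < n → ∀ (b : ℝ → ℝ) (M : ℝ), Measurable b →
      (∀ x, |b x| ≤ M) →
      |(∫ x, g x * b ((Tmap γ)^[n] x) ∂ν) - (∫ x, g x ∂ν) * ∫ x, b x ∂ν|
        ≤ M * (Q * (n : ℝ) ^ (-((1 - γ) / γ))) := by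
  obtain ⟨Q, hQ0, hQ⟩ := exists_abs_sub_setIntegral_iterate_le hγ hγ1
  refine ⟨Q, hQ0, fun g hg hanti hg01 n hn b M hb hM => ?_⟩
  have hdec : DecUnit g := ⟨hanti, fun x _ => (hg01 x).1⟩
  have hg1 : ∀ x, |g x| ≤ 1 := fun x => by rw [abs_of_nonneg (hg01 x).1]; exact (hg01 x).2
  have hbn : Measurable fun x => b ((Tmap γ)^[n] x) := hb.comp ((measurable_Tmap γ).iterate n)
  set u : ℕ → ℝ → ℝ := fun N => (pf γ)^[N] (fun _ => 1) with hu
  have du : ∀ N, DecUnit (u N) := fun N => decUnit_one.pf_iterate hγ N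
  have hone : IntegrableOn (fun _ : ℝ => (1 : ℝ)) (Icc 0 1) := decUnit_one.integrableOn
  have key : ∀ (q : ℝ → ℝ) (B : ℝ), Measurable q → (∀ x, |q x| ≤ B) →
      Tendsto (fun N => ∫ x in Icc 0 1, u N x * q x) atTop (𝓝 (∫ x, q x ∂ν)) := by
    intro q B hq hB
    refine (tendsto_setIntegral_iterate hγ hγ1 hac hT hq hB).congr fun N => ?_
    rw [hu, setIntegral_pf_iterate_mul hγ hone hq hB]
    simp only [one_mul]
  have k1 := key g 1 hg hg1
  have k2 := key (fun x => g x * b ((Tmap γ)^[n] x)) M (hg.mul hbn) fun x => by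
    rw [abs_mul]
    calc |g x| * |b ((Tmap γ)^[n] x)| ≤ 1 * M :=
          mul_le_mul (hg1 x) (hM _) (abs_nonneg _) zero_le_one
      _ = M := one_mul M
  have k3 := key (fun x => b ((Tmap γ)^[n] x)) M hbn fun x => hM _
  have e : ∫ x, b ((Tmap γ)^[n] x) ∂ν = ∫ x, b x ∂ν :=
    (hT.iterate n).integral_comp_of_aestronglyMeasurable hb.aestronglyMeasurable
  rw [e] at k3
  refine le_of_tendsto (k2.sub (k1.mul k3)).abs (Eventually.of_forall fun N => ?_)
  have aG : AdmUnit γ fun x => u N x * g x := by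
    refine ⟨(du N).mul hdec, N, fun x hx => ?_⟩
    have := mul_le_mul_of_nonneg_left (hg01 x).2 ((du N).2 x hx)
    rwa [mul_one] at this
  have aH : AdmUnit γ fun x => (∫ y in Icc 0 1, u N y * g y) * u N x := by
    refine ⟨(du N).const_mul aG.mass_nonneg, N, fun x hx => ?_⟩
    have := mul_le_mul_of_nonneg_right (aG.mass_le_one hγ) ((du N).2 x hx)
    rwa [one_mul] at this
  have hmass : ∫ x in Icc 0 1, u N x * g x
      = ∫ x in Icc 0 1, (∫ y in Icc 0 1, u N y * g y) * u N x := by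
    rw [integral_const_mul, setIntegral_pf_iterate_one hγ, mul_one]
  have := hQ _ _ aG aH hmass n hn b M hb hM
  simp only [mul_assoc, integral_const_mul] at this ⊢
  exact this

end Invariant

end Decay

section Domination

variable {γ V : ℝ} {ν : Measure ℝ}

/-- The measure with density `V x^{-γ}` on the unit interval. -/
def powerMeasure (γ V : ℝ) : Measure ℝ :=
  (volume.restrict (Ioo 0 1)).withDensity fun x => ENNReal.ofReal (V * x ^ (-γ))

theorem measurable_power_density (γ V : ℝ) :
    Measurable fun x : ℝ => ENNReal.ofReal (V * x ^ (-γ)) := by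
  fun_prop

theorem withDensity_le_powerMeasure {ρ : ℝ → ℝ} (hρ : ∀ x ∈ Ioo (0 : ℝ) 1, ρ x ≤ V * x ^ (-γ)) :
    (volume.restrict (Icc (0 : ℝ) 1)).withDensity (fun x => ENNReal.ofReal (ρ x))
      ≤ powerMeasure γ V := by
  rw [← Measure.restrict_congr_set (Ioo_ae_eq_Icc (μ := volume) (a := (0 : ℝ)) (b := 1))]
  refine withDensity_mono ?_
  filter_upwards [ae_restrict_mem measurableSet_Ioo] with x hx
  exact ENNReal.ofReal_le_ofReal (hρ x hx)

theorem absolutelyContinuous_of_le_powerMeasure (hdom : ν ≤ powerMeasure γ V) :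
    ν ≪ volume.restrict (Icc 0 1) :=
  (Measure.absolutelyContinuous_of_le hdom).trans ((withDensity_absolutelyContinuous _ _).trans
    (Measure.absolutelyContinuous_of_le (Measure.restrict_mono Ioo_subset_Icc_self le_rfl)))

theorem ae_mem_Ioo_of_le_powerMeasure (hdom : ν ≤ powerMeasure γ V) :
    ∀ᵐ x ∂ν, x ∈ Ioo (0 : ℝ) 1 :=
  ((Measure.absolutelyContinuous_of_le hdom).trans
    (withDensity_absolutelyContinuous _ _)).ae_le (ae_restrict_mem measurableSet_Ioo)

theorem measure_le_of_subset_Ioi (hγ1 : γ < 1) (hV : 0 < V) (hdom : ν ≤ powerMeasure γ V)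
    {A : Set ℝ} (hA : MeasurableSet A) {s : ℝ} (hs : s ∈ Icc (0 : ℝ) 1)
    (hAs : ∀ x ∈ Ioo (0 : ℝ) 1, x ∈ A → s ≤ x) :
    ν A ≤ ENNReal.ofReal (V / (1 - γ) * (1 - s ^ (1 - γ))) := by
  refine (hdom A).trans ?_
  have hsub : A ∩ Ioo 0 1 ⊆ Icc s 1 := fun x hx => ⟨hAs x hx.2 hx.1, hx.2.2.le⟩
  have hI : IntegrableOn (fun x : ℝ => x ^ (-γ)) (Icc 0 1) := integrableOn_rpow_neg hγ1
  have hint : ∫ x in Icc s 1, x ^ (-γ) = (1 - s ^ (1 - γ)) / (1 - γ) := by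
    rw [integral_Icc_eq_integral_Ioc, ← intervalIntegral.integral_of_le hs.2,
      integral_rpow (Or.inl (by linarith)), Real.one_rpow, neg_add_eq_sub]
  rw [powerMeasure, withDensity_apply _ hA, Measure.restrict_restrict hA]
  refine (lintegral_mono_set hsub).trans ?_
  rw [← ofReal_integral_eq_lintegral_ofReal, integral_const_mul, hint]
  · exact ENNReal.ofReal_le_ofReal (by rw [mul_div_assoc', div_mul_eq_mul_div])
  · exact (hI.mono_set (Icc_subset_Icc_left hs.1)).const_mul V
  · filter_upwards [ae_restrict_mem measurableSet_Icc] with x hx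
    have := hs.1.trans hx.1
    positivity

theorem setIntegral_one_sub_rpow_neg {q τ : ℝ} (hq : q < 1) (hτ : 0 ≤ τ) :
    ∫ x in Ioo (1 - τ) 1, (1 - x) ^ (-q) = τ ^ (1 - q) / (1 - q) := by
  rw [← integral_Ioc_eq_integral_Ioo, ← intervalIntegral.integral_of_le (by linarith),
    intervalIntegral.integral_comp_sub_left (fun x => x ^ (-q)) 1, sub_self, sub_sub_cancel,
    integral_rpow (Or.inl (by linarith)), neg_add_eq_sub, Real.zero_rpow (by linarith), sub_zero]

theorem integrableOn_one_sub_rpow_neg {q τ : ℝ} (hq : q < 1) (hτ : 0 ≤ τ) :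
    IntegrableOn (fun x : ℝ => (1 - x) ^ (-q)) (Ioo (1 - τ) 1) := by
  have h : IntervalIntegrable (fun x : ℝ => x ^ (-q)) volume τ 0 :=
    intervalIntegral.intervalIntegrable_rpow' (by linarith)
  have h' := h.comp_sub_left 1
  rw [sub_zero] at h'
  exact ((intervalIntegrable_iff_integrableOn_Ioc_of_le (by linarith)).1 h').mono_set
    Ioo_subset_Ioc_self

/-- Integrals with respect to `ν` of functions supported in a neighbourhood of `1`. -/
theorem integral_le_of_support_near_one (hγ : 0 < γ) (hV : 0 < V) (hdom : ν ≤ powerMeasure γ V)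
    {h : ℝ → ℝ} (hm : Measurable h) (h0 : ∀ x, 0 ≤ h x) {D q τ : ℝ} (hD : 0 ≤ D) (hq : q < 1)
    (hτ : 0 ≤ τ) (hτ1 : τ ≤ 1 / 2) (hsupp : ∀ x ∈ Ioo (0 : ℝ) 1, τ ≤ 1 - x → h x = 0)
    (hle : ∀ x ∈ Ioo (0 : ℝ) 1, h x ≤ D * (1 - x) ^ (-q)) :
    Integrable h ν ∧ ∫ x, h x ∂ν ≤ V * 2 ^ γ * D / (1 - q) * τ ^ (1 - q) := by
  have hb : ∫⁻ x, ENNReal.ofReal (h x) ∂ν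
      ≤ ENNReal.ofReal (V * 2 ^ γ * D / (1 - q) * τ ^ (1 - q)) := by
    calc ∫⁻ x, ENNReal.ofReal (h x) ∂ν ≤ ∫⁻ x, ENNReal.ofReal (h x) ∂(powerMeasure γ V) :=
          lintegral_mono' hdom le_rfl
      _ = ∫⁻ x in Ioo 0 1, ENNReal.ofReal (V * x ^ (-γ)) * ENNReal.ofReal (h x) :=
          lintegral_withDensity_eq_lintegral_mul _ (measurable_power_density γ V) hm.ennreal_ofReal
      _ ≤ ∫⁻ x in Ioo 0 1, (Ioo (1 - τ) 1).indicator
            (fun x => ENNReal.ofReal (V * 2 ^ γ * D * (1 - x) ^ (-q))) x := by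
          refine setLIntegral_mono' measurableSet_Ioo fun x hx => ?_
          by_cases hx' : x ∈ Ioo (1 - τ) 1
          · rw [indicator_of_mem hx', ← ENNReal.ofReal_mul (mul_nonneg hV.le
              (Real.rpow_nonneg hx.1.le _))]
            have h2 : x ^ (-γ) ≤ 2 ^ γ := by
              have := Real.rpow_le_rpow_of_nonpos (by norm_num : (0 : ℝ) < 1 / 2)
                (by linarith [hx'.1] : 1 / 2 ≤ x) (neg_nonpos.2 hγ.le)
              rwa [one_div, Real.inv_rpow two_pos.le, Real.rpow_neg two_pos.le, inv_inv] at this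
            refine ENNReal.ofReal_le_ofReal ?_
            rw [mul_assoc (V * 2 ^ γ)]
            exact mul_le_mul (mul_le_mul_of_nonneg_left h2 hV.le) (hle x hx) (h0 x)
              (by positivity)
          · have : τ ≤ 1 - x := by
              by_contra hcon
              exact hx' ⟨by linarith, hx.2⟩
            simp [hsupp x hx this]
      _ = ∫⁻ x in Ioo (1 - τ) 1, ENNReal.ofReal (V * 2 ^ γ * D * (1 - x) ^ (-q)) := by
          rw [lintegral_indicator measurableSet_Ioo, Measure.restrict_restrict measurableSet_Ioo,
            inter_eq_left.2 (Ioo_subset_Ioo_left (by linarith))]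
      _ = ENNReal.ofReal (V * 2 ^ γ * D / (1 - q) * τ ^ (1 - q)) := by
          rw [← ofReal_integral_eq_lintegral_ofReal, integral_const_mul,
            setIntegral_one_sub_rpow_neg hq hτ]
          · congr 1
            ring
          · exact (integrableOn_one_sub_rpow_neg hq hτ).const_mul _
          · filter_upwards [ae_restrict_mem measurableSet_Ioo] with x hx
            have : 0 ≤ 1 - x := by linarith [hx.2]
            positivity
  have hnn : 0 ≤ V * 2 ^ γ * D / (1 - q) * τ ^ (1 - q) := by
    have : 0 < 1 - q := by linarith
    positivity
  refine ⟨(lintegral_ofReal_ne_top_iff_integrable hm.aestronglyMeasurable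
    (ae_of_all _ h0)).1 (hb.trans_lt ENNReal.ofReal_lt_top).ne, ?_⟩
  rw [integral_eq_lintegral_of_nonneg_ae (ae_of_all _ h0) hm.aestronglyMeasurable]
  exact ENNReal.toReal_le_of_le_ofReal hnn hb

end Domination

section Covariance

variable {Ω : Type*} [MeasurableSpace Ω] {ν : Measure Ω} [IsProbabilityMeasure ν] {S : Ω → Ω}

theorem abs_integral_mul_comp_sub_le (hS : MeasurePreserving S ν ν) {p e b : Ω → ℝ}
    (hp : Integrable p ν) (he : Integrable e ν) (he0 : ∀ x, 0 ≤ e x) (hb : Measurable b)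
    {B : ℝ} (hB : ∀ x, |b x| ≤ B) {K : ℝ}
    (hK : |(∫ x, p x * b (S x) ∂ν) - (∫ x, p x ∂ν) * ∫ x, b x ∂ν| ≤ K) :
    |(∫ x, (p x + e x) * b (S x) ∂ν) - (∫ x, (p x + e x) ∂ν) * ∫ x, b x ∂ν|
      ≤ K + 2 * B * ∫ x, e x ∂ν := by
  have hbS : AEStronglyMeasurable (fun x => b (S x)) ν :=
    (hb.comp hS.measurable).aestronglyMeasurable
  have i1 : Integrable (fun x => p x * b (S x)) ν :=
    hp.mul_bdd (c := B) hbS (ae_of_all _ fun _ => hB _)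
  have i2 : Integrable (fun x => e x * b (S x)) ν :=
    he.mul_bdd (c := B) hbS (ae_of_all _ fun _ => hB _)
  have h1 : |∫ x, e x * b (S x) ∂ν| ≤ B * ∫ x, e x ∂ν := by
    rw [← integral_const_mul, ← Real.norm_eq_abs]
    refine norm_integral_le_of_norm_le (he.const_mul B) (ae_of_all _ fun x => ?_)
    rw [Real.norm_eq_abs, abs_mul, abs_of_nonneg (he0 x), mul_comm]
    exact mul_le_mul_of_nonneg_right (hB _) (he0 x)
  have h2 : |∫ x, b x ∂ν| ≤ B := by
    have := norm_integral_le_of_norm_le_const (μ := ν) (f := b) (C := B) (ae_of_all _ hB)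
    simpa using this
  have h3 : 0 ≤ ∫ x, e x ∂ν := integral_nonneg he0
  simp only [add_mul]
  rw [integral_add i1 i2, integral_add hp he]
  have h4 : |(∫ x, e x ∂ν) * ∫ x, b x ∂ν| ≤ B * ∫ x, e x ∂ν := by
    rw [abs_mul, abs_of_nonneg h3, mul_comm]
    exact mul_le_mul_of_nonneg_right h2 h3
  rw [abs_le] at *
  constructor <;> linarith [hK.1, hK.2, h1.1, h1.2, h4.1, h4.2]

theorem abs_integral_mul_self_comp_sub_le (hS : MeasurePreserving S ν ν) {p e : Ω → ℝ} {M : ℝ}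
    (hp : Measurable p) (hpM : ∀ x, |p x| ≤ M) (hem : Measurable e) (he0 : ∀ x, 0 ≤ e x)
    (he2 : MemLp e 2 ν) {K : ℝ}
    (hK : |(∫ x, p x * p (S x) ∂ν) - (∫ x, p x ∂ν) * ∫ x, p x ∂ν| ≤ K) :
    |(∫ x, (p x + e x) * (p (S x) + e (S x)) ∂ν)
        - (∫ x, (p x + e x) ∂ν) * ∫ x, (p x + e x) ∂ν|
      ≤ K + 4 * M * (∫ x, e x ∂ν) + 2 * ∫ x, e x ^ 2 ∂ν := by
  have hM0 : 0 ≤ M := by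
    obtain ⟨x⟩ : Nonempty Ω := ν.nonempty_of_neZero
    exact (abs_nonneg _).trans (hpM x)
  have hpi : Integrable p ν := integrable_of_abs_le hp hpM
  have he : Integrable e ν := he2.integrable one_le_two
  have he2i : Integrable (fun x => e x ^ 2) ν := he2.integrable_sq
  have heS2 : MemLp (fun x => e (S x)) 2 ν := he2.comp_measurePreserving hS
  have heS : Integrable (fun x => e (S x)) ν := heS2.integrable one_le_two
  have heS2i : Integrable (fun x => e (S x) ^ 2) ν := heS2.integrable_sq
  have eS : ∫ x, e (S x) ∂ν = ∫ x, e x ∂ν :=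
    hS.integral_comp_of_aestronglyMeasurable hem.aestronglyMeasurable
  have eS2 : ∫ x, e (S x) ^ 2 ∂ν = ∫ x, e x ^ 2 ∂ν :=
    hS.integral_comp_of_aestronglyMeasurable (g := fun x => e x ^ 2)
      (hem.pow_const 2).aestronglyMeasurable
  have hpe : ∀ u : Ω → ℝ, Integrable u ν → (∀ x, 0 ≤ u x) → ∀ v : Ω → ℝ, (∀ x, |v x| ≤ M) →
      |∫ x, v x * u x ∂ν| ≤ M * ∫ x, u x ∂ν := by
    intro u hu hu0 v hv
    rw [← integral_const_mul, ← Real.norm_eq_abs]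
    refine norm_integral_le_of_norm_le (hu.const_mul M) (ae_of_all _ fun x => ?_)
    rw [Real.norm_eq_abs, abs_mul, abs_of_nonneg (hu0 x)]
    exact mul_le_mul_of_nonneg_right (hv _) (hu0 x)
  have b1 := hpe e he he0 (fun x => p (S x)) fun _ => hpM _
  have b2 := hpe (fun x => e (S x)) heS (fun _ => he0 _) p hpM
  rw [eS] at b2
  have b3 : 0 ≤ ∫ x, e x * e (S x) ∂ν := integral_nonneg fun x => mul_nonneg (he0 _) (he0 _)
  have i4 : Integrable (fun x => e x * e (S x)) ν := he2.integrable_mul heS2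
  have b4 : ∫ x, e x * e (S x) ∂ν ≤ ∫ x, e x ^ 2 ∂ν := by
    have : ∫ x, e x * e (S x) ∂ν ≤ ∫ x, (1 / 2 * e x ^ 2 + 1 / 2 * e (S x) ^ 2) ∂ν :=
      integral_mono i4 ((he2i.const_mul _).add (heS2i.const_mul _)) fun x => by
        simp only
        nlinarith [sq_nonneg (e x - e (S x))]
    rw [integral_add (he2i.const_mul _) (heS2i.const_mul _), integral_const_mul,
      integral_const_mul, eS2] at this
    linarith
  have b5 : (∫ x, e x ∂ν) ^ 2 ≤ ∫ x, e x ^ 2 ∂ν := by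
    have := ProbabilityTheory.variance_nonneg e ν
    rw [ProbabilityTheory.variance_eq_sub he2] at this
    simpa using this
  have b6 : |∫ x, p x ∂ν| ≤ M := by
    have := norm_integral_le_of_norm_le_const (μ := ν) (f := p) (C := M) (ae_of_all _ hpM)
    simpa using this
  have b7 : 0 ≤ ∫ x, e x ∂ν := integral_nonneg he0
  have b8 : |(∫ x, p x ∂ν) * ∫ x, e x ∂ν| ≤ M * ∫ x, e x ∂ν := by
    rw [abs_mul, abs_of_nonneg b7]
    exact mul_le_mul_of_nonneg_right b6 b7
  have hpS : Measurable fun x => p (S x) := hp.comp hS.measurable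
  have i1 : Integrable (fun x => p x * p (S x)) ν :=
    hpi.mul_bdd (c := M) hpS.aestronglyMeasurable (ae_of_all _ fun _ => hpM _)
  have i2 : Integrable (fun x => p (S x) * e x) ν :=
    he.bdd_mul (c := M) hpS.aestronglyMeasurable (ae_of_all _ fun _ => hpM _)
  have i3 : Integrable (fun x => p x * e (S x)) ν :=
    heS.bdd_mul (c := M) hp.aestronglyMeasurable (ae_of_all _ hpM)
  have expand : ∫ x, (p x + e x) * (p (S x) + e (S x)) ∂ν
      = (∫ x, p x * p (S x) ∂ν) + (∫ x, p (S x) * e x ∂ν)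
        + ((∫ x, p x * e (S x) ∂ν) + ∫ x, e x * e (S x) ∂ν) := by
    rw [← integral_add i1 i2, ← integral_add i3 i4]
    refine Eq.trans (integral_congr_ae (ae_of_all _ fun x => ?_))
      (integral_add (i1.add i2) (i3.add i4))
    simp only
    ring
  rw [expand, integral_add hpi he]
  have e3 : ((∫ x, p x ∂ν) + ∫ x, e x ∂ν) * ((∫ x, p x ∂ν) + ∫ x, e x ∂ν)
      = (∫ x, p x ∂ν) * (∫ x, p x ∂ν) + 2 * ((∫ x, p x ∂ν) * ∫ x, e x ∂ν)
        + (∫ x, e x ∂ν) ^ 2 := by ring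
  have b9 := sq_nonneg (∫ x, e x ∂ν)
  rw [e3]
  rw [abs_le] at *
  constructor <;> linarith [hK.1, hK.2, b1.1, b1.2, b2.1, b2.2, b8.1, b8.2]

end Covariance

section UnboundedObservable

variable {γ V : ℝ} {ν : Measure ℝ} {F : ℝ → ℝ} {C a : ℝ}

/-- The excess of `F` over a level is controlled near the singularity at `1`. -/
theorem excess_bounds (hγ : 0 < γ) (hV : 0 < V) (hdom : ν ≤ powerMeasure γ V)
    (hF : Measurable F) (hFb : ∀ x ∈ Ioo (0 : ℝ) 1, F x ≤ C * (1 - x) ^ (-a))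
    (hC : 0 < C) (ha : 0 ≤ a) (ha2 : a < 1 / 2) {τ : ℝ} (hτ : 0 < τ) (hτ1 : τ ≤ 1 / 2) :
    MemLp (fun x => F x - min (F x) (C * τ ^ (-a))) 2 ν ∧
      ∫ x, (F x - min (F x) (C * τ ^ (-a))) ∂ν ≤ V * 2 ^ γ * C / (1 - a) * τ ^ (1 - a) ∧
      ∫ x, (F x - min (F x) (C * τ ^ (-a))) ^ 2 ∂ν
        ≤ V * 2 ^ γ * C ^ 2 / (1 - 2 * a) * τ ^ (1 - 2 * a) := by
  set M := C * τ ^ (-a) with hM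
  have hM0 : 0 < M := by positivity
  have hm : Measurable fun x => F x - min (F x) M := hF.sub (hF.min measurable_const)
  have h0 : ∀ x, 0 ≤ F x - min (F x) M := fun x => sub_nonneg.2 (min_le_left _ _)
  have hsupp : ∀ x ∈ Ioo (0 : ℝ) 1, τ ≤ 1 - x → F x - min (F x) M = 0 := by
    intro x hx hxτ
    have h := Real.rpow_le_rpow_of_nonpos hτ hxτ (neg_nonpos.2 ha)
    have : F x ≤ M := (hFb x hx).trans (mul_le_mul_of_nonneg_left h hC.le)
    rw [min_eq_left this, sub_self]
  have hle : ∀ x ∈ Ioo (0 : ℝ) 1, F x - min (F x) M ≤ C * (1 - x) ^ (-a) := by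
    intro x hx
    have h1x : 0 ≤ 1 - x := by linarith [hx.2]
    have hnn : 0 ≤ C * (1 - x) ^ (-a) := by positivity
    rcases le_total (F x) M with h | h
    · rw [min_eq_left h, sub_self]
      exact hnn
    · rw [min_eq_right h]
      linarith [hFb x hx]
  have hle2 : ∀ x ∈ Ioo (0 : ℝ) 1,
      (F x - min (F x) M) ^ 2 ≤ C ^ 2 * (1 - x) ^ (-(2 * a)) := by
    intro x hx
    have h1x : 0 ≤ 1 - x := by linarith [hx.2]
    have := pow_le_pow_left₀ (h0 x) (hle x hx) 2
    have e : ((1 - x) ^ (-a)) ^ 2 = (1 - x) ^ (-(2 * a)) := by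
      rw [← Real.rpow_natCast, ← Real.rpow_mul h1x]
      congr 1
      push_cast
      ring
    rwa [mul_pow, e] at this
  obtain ⟨-, i1⟩ := integral_le_of_support_near_one hγ hV hdom hm h0 hC.le (by linarith) hτ.le
    hτ1 hsupp hle
  obtain ⟨i2, i3⟩ := integral_le_of_support_near_one hγ hV hdom (hm.pow_const 2)
    (fun x => sq_nonneg _) (sq_nonneg C) (by linarith : 2 * a < 1) hτ.le hτ1
    (fun x hx hxτ => by rw [hsupp x hx hxτ, zero_pow two_ne_zero]) hle2
  exact ⟨(memLp_two_iff_integrable_sq hm.aestronglyMeasurable).2 i2, i1, i3⟩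

variable [IsProbabilityMeasure ν]

theorem exists_abs_cov_antitone_le (hγ : 0 < γ) (hγ1 : γ < 1 / 2)
    (hac : ν ≪ volume.restrict (Icc 0 1)) (hT : MeasurePreserving (Tmap γ) ν ν) :
    ∃ Q : ℝ, 0 < Q ∧ ∀ g : ℝ → ℝ, Measurable g → AntitoneOn g (Icc 0 1) →
      (∀ x, g x ∈ Icc (0 : ℝ) 1) → ∀ (n : ℕ) (b : ℝ → ℝ) (M : ℝ), Measurable b →
      (∀ x, |b x| ≤ M) →
      |(∫ x, g x * b ((Tmap γ)^[n] x) ∂ν) - (∫ x, g x ∂ν) * ∫ x, b x ∂ν|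
        ≤ M * (Q * ((n : ℝ) + 1) ^ (-((1 - γ) / γ))) := by
  obtain ⟨Q, hQ0, hQ⟩ := exists_abs_integral_mul_iterate_sub_le hγ hγ1 hac hT
  set δ := (1 - γ) / γ with hδ
  have hδ0 : 0 < δ := div_pos (by linarith) hγ
  refine ⟨Q * 2 ^ δ + 2, by positivity, fun g hg hanti hg01 n b M hb hM => ?_⟩
  have hM0 : 0 ≤ M := (abs_nonneg _).trans (hM 0)
  rcases Nat.eq_zero_or_pos n with rfl | hn
  · have h1 : |∫ x, g x * b x ∂ν| ≤ M := by
      have := norm_integral_le_of_norm_le_const (μ := ν) (f := fun x => g x * b x) (C := M)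
        (ae_of_all _ fun x => by
          rw [Real.norm_eq_abs, abs_mul, abs_of_nonneg (hg01 x).1]
          exact (mul_le_of_le_one_left (abs_nonneg _) (hg01 x).2).trans (hM x))
      simpa using this
    have h2 : |∫ x, g x ∂ν| ≤ 1 := by
      have := norm_integral_le_of_norm_le_const (μ := ν) (f := g) (C := 1)
        (ae_of_all _ fun x => by
          rw [Real.norm_eq_abs, abs_of_nonneg (hg01 x).1]
          exact (hg01 x).2)
      simpa using this
    have h3 : |∫ x, b x ∂ν| ≤ M := by
      have := norm_integral_le_of_norm_le_const (μ := ν) (f := b) (C := M) (ae_of_all _ hM)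
      simpa using this
    have h4 : |(∫ x, g x ∂ν) * ∫ x, b x ∂ν| ≤ M := by
      rw [abs_mul]
      exact (mul_le_of_le_one_left (abs_nonneg _) h2).trans h3
    have h5 : 0 ≤ Q * 2 ^ δ := by positivity
    simp only [Function.iterate_zero, id, Nat.cast_zero, zero_add, Real.one_rpow, mul_one]
    refine (abs_sub _ _).trans ?_
    nlinarith
  · refine (hQ g hg hanti hg01 n hn b M hb hM).trans (mul_le_mul_of_nonneg_left ?_ hM0)
    have hn' : (1 : ℝ) ≤ n := by exact_mod_cast hn
    have h1 : (2 * (n : ℝ)) ^ (-δ) ≤ ((n : ℝ) + 1) ^ (-δ) :=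
      Real.rpow_le_rpow_of_nonpos (by positivity) (by linarith) (by linarith)
    rw [Real.mul_rpow two_pos.le (by positivity), Real.rpow_neg two_pos.le] at h1
    have h2 : (0 : ℝ) ≤ ((n : ℝ) + 1) ^ (-δ) := by positivity
    have h3 : (0 : ℝ) < 2 ^ δ := by positivity
    calc Q * (n : ℝ) ^ (-δ) = Q * 2 ^ δ * (((2 : ℝ) ^ δ)⁻¹ * (n : ℝ) ^ (-δ)) := by
          field_simp
      _ ≤ Q * 2 ^ δ * ((n : ℝ) + 1) ^ (-δ) := by gcongr
      _ ≤ _ := by nlinarith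

theorem exists_abs_cov_monotone_le (hγ : 0 < γ) (hγ1 : γ < 1 / 2) (hdom : ν ≤ powerMeasure γ V)
    (hT : MeasurePreserving (Tmap γ) ν ν) :
    ∃ Q : ℝ, 0 < Q ∧ ∀ (p : ℝ → ℝ) (M : ℝ), 0 < M → Measurable p → (∀ x, p x ∈ Icc (0 : ℝ) M) →
      p 0 = 0 → MonotoneOn p (Ioo 0 1) → ∀ (n : ℕ) (b : ℝ → ℝ) (B : ℝ), Measurable b →
      (∀ x, |b x| ≤ B) →
      |(∫ x, p x * b ((Tmap γ)^[n] x) ∂ν) - (∫ x, p x ∂ν) * ∫ x, b x ∂ν|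
        ≤ M * B * (Q * ((n : ℝ) + 1) ^ (-((1 - γ) / γ))) := by
  obtain ⟨Q, hQ0, hQ⟩ := exists_abs_cov_antitone_le hγ hγ1
    (absolutelyContinuous_of_le_powerMeasure hdom) hT
  refine ⟨Q, hQ0, fun p M hM hp hpM hp0 hmono n b B hb hB => ?_⟩
  set g : ℝ → ℝ := (Iio 1).indicator fun x => 1 - p x / M with hg
  have hval : ∀ x, 1 - p x / M ∈ Icc (0 : ℝ) 1 := fun x =>
    ⟨sub_nonneg.2 ((div_le_one hM).2 (hpM x).2), sub_le_self _ (div_nonneg (hpM x).1 hM.le)⟩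
  have hg01 : ∀ x, g x ∈ Icc (0 : ℝ) 1 := fun x => by
    by_cases h : x ∈ Iio (1 : ℝ)
    · rw [hg, indicator_of_mem h]
      exact hval x
    · rw [hg, indicator_of_notMem h]
      exact ⟨le_rfl, zero_le_one⟩
  have hgm : Measurable g := (measurable_const.sub (hp.div_const M)).indicator measurableSet_Iio
  have hanti : AntitoneOn g (Icc 0 1) := by
    intro x hx y hy hxy
    rcases hy.2.lt_or_eq with hy1 | rfl
    · have hx1 : x < 1 := hxy.trans_lt hy1
      rw [hg, indicator_of_mem (mem_Iio.2 hy1), indicator_of_mem (mem_Iio.2 hx1)]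
      refine sub_le_sub_left (div_le_div_of_nonneg_right ?_ hM.le) 1
      rcases hx.1.eq_or_lt with h0 | h0
      · rw [← h0, hp0]
        exact (hpM y).1
      · exact hmono ⟨h0, hx1⟩ ⟨h0.trans_le hxy, hy1⟩ hxy
    · rw [hg, indicator_of_notMem (by simp)]
      exact (hg01 x).1
  have hpg : p =ᵐ[ν] fun x => M * (1 - g x) := by
    filter_upwards [ae_mem_Ioo_of_le_powerMeasure hdom] with x hx
    rw [hg, indicator_of_mem (mem_Iio.2 hx.2)]
    field_simp
    ring
  have hgi : Integrable g ν :=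
    integrable_of_abs_le (M := 1) hgm fun x => by
      rw [abs_of_nonneg (hg01 x).1]
      exact (hg01 x).2
  have hbn : Measurable fun x => b ((Tmap γ)^[n] x) := hb.comp ((measurable_Tmap γ).iterate n)
  have hbi : Integrable (fun x => b ((Tmap γ)^[n] x)) ν := integrable_of_abs_le hbn fun _ => hB _
  have hgb : Integrable (fun x => g x * b ((Tmap γ)^[n] x)) ν :=
    hgi.mul_bdd (c := B) hbn.aestronglyMeasurable (ae_of_all _ fun _ => hB _)
  have eb : ∫ x, b ((Tmap γ)^[n] x) ∂ν = ∫ x, b x ∂ν :=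
    (hT.iterate n).integral_comp_of_aestronglyMeasurable hb.aestronglyMeasurable
  have e1 : ∫ x, p x ∂ν = M * (1 - ∫ x, g x ∂ν) := by
    rw [integral_congr_ae hpg, integral_const_mul, integral_sub (integrable_const _) hgi]
    simp
  have e2 : ∫ x, p x * b ((Tmap γ)^[n] x) ∂ν
      = M * ((∫ x, b x ∂ν) - ∫ x, g x * b ((Tmap γ)^[n] x) ∂ν) := by
    rw [← eb, ← integral_sub hbi hgb, ← integral_const_mul]
    refine integral_congr_ae ?_
    filter_upwards [hpg] with x hx
    rw [hx]
    ring
  have key := hQ g hgm hanti hg01 n b B hb hB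
  have e3 : M * ((∫ x, b x ∂ν) - ∫ x, g x * b ((Tmap γ)^[n] x) ∂ν)
        - M * (1 - ∫ x, g x ∂ν) * ∫ x, b x ∂ν
      = -(M * ((∫ x, g x * b ((Tmap γ)^[n] x) ∂ν) - (∫ x, g x ∂ν) * ∫ x, b x ∂ν)) := by ring
  rw [e1, e2, e3, abs_neg, abs_mul, abs_of_pos hM, mul_assoc]
  exact mul_le_mul_of_nonneg_left key hM.le

theorem integral_centered_mul_comp {S : ℝ → ℝ} (hS : MeasurePreserving S ν ν)
    (hF2 : MemLp F 2 ν) {b : ℝ → ℝ} (hb : MemLp b 2 ν) :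
    ∫ x, (F x - ∫ y, F y ∂ν) * b (S x) ∂ν
      = (∫ x, F x * b (S x) ∂ν) - (∫ x, F x ∂ν) * ∫ x, b x ∂ν := by
  have hbS : MemLp (fun x => b (S x)) 2 ν := hb.comp_measurePreserving hS
  have hi : Integrable (fun x => F x * b (S x)) ν := hF2.integrable_mul hbS
  simp only [sub_mul]
  rw [integral_sub hi ((hbS.integrable one_le_two).const_mul _),
    integral_const_mul, hS.integral_comp_of_aestronglyMeasurable hb.1]

theorem exists_summable_cov_bound (hγ : 0 < γ) (hγ1 : γ < 1 / 2) (hV : 0 < V)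
    (hdom : ν ≤ powerMeasure γ V) (hT : MeasurePreserving (Tmap γ) ν ν)
    (hF : Measurable F) (hF0 : ∀ x, 0 ≤ F x) (hFz : F 0 = 0) (hmono : MonotoneOn F (Ioo 0 1))
    (hFb : ∀ x ∈ Ioo (0 : ℝ) 1, F x ≤ C * (1 - x) ^ (-a)) (hC : 0 < C) (ha : 0 ≤ a)
    (ha' : a < 1 / 2 - γ / (2 * (1 - γ))) :
    MemLp F 2 ν ∧ ∃ c : ℕ → ℝ, Summable c ∧
      (∀ k, ∀ b : ℝ → ℝ, Measurable b → (∀ x, |b x| ≤ 1) →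
        |∫ x, (F x - ∫ y, F y ∂ν) * b ((Tmap γ)^[k] x) ∂ν| ≤ c k) ∧
      ∀ k, |∫ x, (F x - ∫ y, F y ∂ν) * (F ((Tmap γ)^[k] x) - ∫ y, F y ∂ν) ∂ν| ≤ c k := by
  have h1γ : 0 < 1 - γ := by linarith
  set δ := (1 - γ) / γ with hδ
  have hδ0 : 0 < δ := div_pos h1γ hγ
  have hquot : 0 < γ / (2 * (1 - γ)) := by positivity
  have ha2 : a < 1 / 2 := by linarith
  have hσ : 1 < δ * (1 - 2 * a) := by
    have e : δ * (2 * (γ / (2 * (1 - γ)))) = 1 := by rw [hδ]; field_simp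
    have : 2 * (γ / (2 * (1 - γ))) < 1 - 2 * a := by linarith
    exact e.symm.trans_lt (mul_lt_mul_of_pos_left this hδ0)
  obtain ⟨Q, hQ0, hQ⟩ := exists_abs_cov_monotone_le hγ hγ1 hdom hT
  set D1 := V * 2 ^ γ * C / (1 - a) with hD1
  set D2 := V * 2 ^ γ * C ^ 2 / (1 - 2 * a) with hD2
  have hD1p : 0 < D1 := div_pos (by positivity) (by linarith)
  have hD2p : 0 < D2 := div_pos (by positivity) (by linarith)
  have htrunc : ∀ M : ℝ, 0 < M → (∀ x, min (F x) M ∈ Icc (0 : ℝ) M) ∧ min (F 0) M = 0 ∧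
      MonotoneOn (fun x => min (F x) M) (Ioo 0 1) ∧ Measurable fun x => min (F x) M := by
    intro M hM
    refine ⟨fun x => ⟨le_min (hF0 x) hM.le, min_le_right _ _⟩, ?_, fun x hx y hy hxy =>
      min_le_min_right _ (hmono hx hy hxy), hF.min measurable_const⟩
    rw [hFz, min_eq_left hM.le]
  have habs : ∀ M : ℝ, 0 < M → ∀ x, |min (F x) M| ≤ M := fun M hM x => by
    rw [abs_of_nonneg ((htrunc M hM).1 x).1]
    exact min_le_right _ _
  have hsplit : ∀ M x, F x = min (F x) M + (F x - min (F x) M) := fun M x => by ring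
  have hF2 : MemLp F 2 ν := by
    obtain ⟨he, -, -⟩ := excess_bounds hγ hV hdom hF hFb hC ha ha2 (τ := 1 / 2) (by norm_num)
      le_rfl
    have hM : 0 < C * (1 / 2 : ℝ) ^ (-a) := by positivity
    have hp : MemLp (fun x => min (F x) (C * (1 / 2 : ℝ) ^ (-a))) 2 ν :=
      memLp_two_of_abs_le (htrunc _ hM).2.2.2 (habs _ hM)
    have := hp.add he
    convert this using 1
    funext x
    exact hsplit _ x
  refine ⟨hF2, ?_⟩
  set A := 2 * C * Q + 2 * D1 + (2 * C ^ 2 * Q + 4 * C * D1 + 2 * D2) with hA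
  have hA0 : 0 < A := by positivity
  refine ⟨fun k => A * (1 / ((k : ℝ) + 1) ^ (δ * (1 - 2 * a))), ?_, ?_⟩
  · have h := (summable_nat_add_iff (f := fun k : ℕ => 1 / (k : ℝ) ^ (δ * (1 - 2 * a))) 1).2
      (Real.summable_one_div_nat_rpow.2 hσ)
    refine Summable.mul_left A ?_
    simpa using h
  have main : ∀ k : ℕ, ∃ τ : ℝ, 0 < τ ∧ τ ≤ 1 / 2 ∧ ((k : ℝ) + 1) ^ (-δ) = 2 * τ ∧
      τ ^ (1 - 2 * a) ≤ 1 / ((k : ℝ) + 1) ^ (δ * (1 - 2 * a)) := by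
    intro k
    have hN0 : (0 : ℝ) < (k : ℝ) + 1 := by positivity
    have hN : (1 : ℝ) ≤ (k : ℝ) + 1 := by linarith [k.cast_nonneg (α := ℝ)]
    have h1 : ((k : ℝ) + 1) ^ (-δ) ≤ 1 := Real.rpow_le_one_of_one_le_of_nonpos hN (by linarith)
    have h0 : 0 < ((k : ℝ) + 1) ^ (-δ) := by positivity
    refine ⟨((k : ℝ) + 1) ^ (-δ) / 2, by positivity, by linarith, by ring, ?_⟩
    have h2 : (((k : ℝ) + 1) ^ (-δ) / 2) ^ (1 - 2 * a) ≤ (((k : ℝ) + 1) ^ (-δ)) ^ (1 - 2 * a) :=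
      Real.rpow_le_rpow (by positivity) (by linarith) (by linarith)
    refine h2.trans_eq ?_
    rw [← Real.rpow_mul hN0.le, neg_mul, Real.rpow_neg hN0.le, one_div]
  have hpow : ∀ τ : ℝ, 0 < τ → τ ^ (-a) * τ = τ ^ (1 - a) ∧ τ ^ (-a) * τ ^ (1 - a) = τ ^ (1 - 2 * a)
      ∧ (τ ^ (-a)) ^ 2 * τ = τ ^ (1 - 2 * a) := by
    intro τ hτ
    have e1 : τ ^ (-a) * τ = τ ^ (1 - a) := by
      rw [sub_eq_neg_add, Real.rpow_add hτ, Real.rpow_one]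
    have e2 : τ ^ (-a) * τ ^ (1 - a) = τ ^ (1 - 2 * a) := by
      rw [← Real.rpow_add hτ]
      congr 1
      ring
    exact ⟨e1, e2, by rw [sq, mul_assoc, e1, e2]⟩
  refine ⟨fun k b hb hb1 => ?_, fun k => ?_⟩
  · obtain ⟨τ, hτ0, hτ1, hN, hτ2⟩ := main k
    obtain ⟨he, he1, -⟩ := excess_bounds hγ hV hdom hF hFb hC ha ha2 hτ0 hτ1
    have hM : 0 < C * τ ^ (-a) := by positivity
    obtain ⟨t1, t2, t3, t4⟩ := htrunc _ hM
    have hK := hQ _ _ hM t4 t1 t2 t3 k b 1 hb hb1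
    rw [hN] at hK
    have h := abs_integral_mul_comp_sub_le (hT.iterate k)
      (integrable_of_abs_le t4 (habs _ hM)) (he.integrable one_le_two)
      (fun x => sub_nonneg.2 (min_le_left _ _)) hb hb1 hK
    simp only [add_sub_cancel] at h
    rw [integral_centered_mul_comp (hT.iterate k) hF2 (memLp_two_of_abs_le hb hb1)]
    refine h.trans ?_
    obtain ⟨p1, -, -⟩ := hpow τ hτ0
    have h3 : τ ^ (1 - a) ≤ τ ^ (1 - 2 * a) :=
      Real.rpow_le_rpow_of_exponent_ge hτ0 (by linarith) (by linarith)
    have h4 : C * τ ^ (-a) * 1 * (Q * (2 * τ)) = 2 * C * Q * τ ^ (1 - a) := by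
      rw [← p1]
      ring
    have h5 : 2 * C * Q * τ ^ (1 - a) + 2 * 1 * (D1 * τ ^ (1 - a)) ≤ A * τ ^ (1 - 2 * a) := by
      have h6 : (2 * C * Q + 2 * D1) * τ ^ (1 - a) ≤ (2 * C * Q + 2 * D1) * τ ^ (1 - 2 * a) := by
        gcongr
      have h7 : 0 ≤ (2 * C ^ 2 * Q + 4 * C * D1 + 2 * D2) * τ ^ (1 - 2 * a) := by positivity
      rw [hA, add_mul _ _ (τ ^ (1 - 2 * a))]
      linarith
    rw [h4]
    refine le_trans ?_ (h5.trans (mul_le_mul_of_nonneg_left hτ2 hA0.le))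
    linarith
  · obtain ⟨τ, hτ0, hτ1, hN, hτ2⟩ := main k
    obtain ⟨he, he1, he2⟩ := excess_bounds hγ hV hdom hF hFb hC ha ha2 hτ0 hτ1
    have hM : 0 < C * τ ^ (-a) := by positivity
    obtain ⟨t1, t2, t3, t4⟩ := htrunc _ hM
    have hK := hQ _ _ hM t4 t1 t2 t3 k _ _ t4 (habs _ hM)
    rw [hN] at hK
    have h := abs_integral_mul_self_comp_sub_le
      (e := fun x => F x - min (F x) (C * τ ^ (-a))) (hT.iterate k) t4 (habs _ hM)
      (hF.sub t4) (fun x => sub_nonneg.2 (min_le_left _ _)) he hK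
    simp only [add_sub_cancel] at h
    have hcen : MemLp (fun x => F x - ∫ y, F y ∂ν) 2 ν := hF2.sub (memLp_const _)
    have hz : ∫ x, (F x - ∫ y, F y ∂ν) ∂ν = 0 := by
      rw [integral_sub (hF2.integrable one_le_two) (integrable_const _)]
      simp
    have e0 := integral_centered_mul_comp (hT.iterate k) hF2 hcen
    have hFS : MemLp (fun x => F ((Tmap γ)^[k] x)) 2 ν :=
      hF2.comp_measurePreserving (hT.iterate k)
    have e1 : ∫ x, F x * (F ((Tmap γ)^[k] x) - ∫ y, F y ∂ν) ∂ν
        = (∫ x, F x * F ((Tmap γ)^[k] x) ∂ν) - (∫ x, F x ∂ν) * ∫ x, F x ∂ν := by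
      have hi : Integrable (fun x => F x * F ((Tmap γ)^[k] x)) ν := hF2.integrable_mul hFS
      simp only [mul_sub]
      rw [integral_sub hi ((hF2.integrable one_le_two).mul_const _),
        integral_mul_const]
    rw [e0, hz, mul_zero, sub_zero, e1]
    refine h.trans ?_
    obtain ⟨-, p2, p3⟩ := hpow τ hτ0
    have h4 : C * τ ^ (-a) * (C * τ ^ (-a)) * (Q * (2 * τ)) = 2 * C ^ 2 * Q * τ ^ (1 - 2 * a) := by
      rw [← p3]
      ring
    have h5 : 4 * (C * τ ^ (-a)) * ∫ x, (F x - min (F x) (C * τ ^ (-a))) ∂ν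
        ≤ 4 * C * D1 * τ ^ (1 - 2 * a) := by
      calc _ ≤ 4 * (C * τ ^ (-a)) * (D1 * τ ^ (1 - a)) := by gcongr
        _ = 4 * C * D1 * (τ ^ (-a) * τ ^ (1 - a)) := by ring
        _ = _ := by rw [p2]
    have h6 : 0 ≤ (2 * C * Q + 2 * D1) * τ ^ (1 - 2 * a) := by positivity
    rw [h4]
    refine le_trans ?_ (mul_le_mul_of_nonneg_left hτ2 hA0.le)
    rw [hA, add_mul _ _ (τ ^ (1 - 2 * a))]
    linarith

/-- The central limit theorem for nonnegative monotone observables with a mild singularity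
at `1`. -/
theorem exists_gaussian_limit_of_monotoneOn (hγ : 0 < γ) (hγ1 : γ < 1 / 2) (hV : 0 < V)
    (hdom : ν ≤ powerMeasure γ V) (hT : MeasurePreserving (Tmap γ) ν ν)
    (hF : Measurable F) (hF0 : ∀ x, 0 ≤ F x) (hFz : F 0 = 0) (hmono : MonotoneOn F (Ioo 0 1))
    (hFb : ∀ x ∈ Ioo (0 : ℝ) 1, F x ≤ C * (1 - x) ^ (-a)) (hC : 0 < C) (ha : 0 ≤ a)
    (ha' : a < 1 / 2 - γ / (2 * (1 - γ))) :
    ∃ v : ℝ≥0, ∀ g : BoundedContinuousFunction ℝ ℝ,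
      Tendsto (fun n : ℕ => ∫ x, g ((n : ℝ) ^ (-(1:ℝ)/2) *
          Sn γ (fun z => F z - ∫ y, F y ∂ν) n x) ∂ν)
        atTop (𝓝 (∫ y, g y ∂(gaussianReal 0 v))) := by
  obtain ⟨hF2, c, hc, hb, hcov⟩ :=
    exists_summable_cov_bound hγ hγ1 hV hdom hT hF hF0 hFz hmono hFb hC ha ha'
  have hmix : ∀ b : ℝ → ℝ, Measurable b → (∃ B, ∀ x, |b x| ≤ B) →
      Tendsto (fun n => ∫ x, b x * b ((Tmap γ)^[n] x) ∂ν) atTop (𝓝 ((∫ x, b x ∂ν) ^ 2)) :=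
    fun b hbm ⟨B, hB⟩ => tendsto_integral_mul_iterate hγ hγ1
      (absolutelyContinuous_of_le_powerMeasure hdom) hT hbm hB
  have hcm : Measurable fun z => F z - ∫ y, F y ∂ν := hF.sub_const _
  have hc2 : MemLp (fun z => F z - ∫ y, F y ∂ν) 2 ν := hF2.sub (memLp_const _)
  obtain ⟨v, hv⟩ := tendsto_integral_gaussian_of_summable hT hmix hcm hc2 hc hb hcov
  exact ⟨v, hv⟩

end UnboundedObservable

/-- second simple example: `γ ∈ (0,1/2)`, the density of
`ν_γ` is bounded by `V(γ) x^{−γ}`, and `f` is positive nondecreasing on `(0,1)`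
with `f(x) ≤ C (1−x)^{−a}`, `0 ≤ a < 1/2 − γ/(2(1−γ))`.  Then (for `a > 0`)
`ν_γ(f > t) ≤ (V(γ)/(1−γ)) (1 − (1 − (C/t)^{1/a})^{1−γ})` for all `t > C`, and
`n^{-1/2} S_n(f − ν_γ(f))` converges in distribution to a centered Gaussian law. -/
theorem statement10 (γ : ℝ) (hγ : γ ∈ Set.Ioo (0:ℝ) (1/2))
    (ν : Measure ℝ) [IsProbabilityMeasure ν] (hsupp : ν (Set.Icc 0 1) = 1)
    (hinv : Measure.map (Tmap γ) ν = ν)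
    (V : ℝ) (hV : 0 < V) (ρ : ℝ → ℝ)
    (hν : ν = (MeasureTheory.volume.restrict (Set.Icc (0:ℝ) 1)).withDensity
        (fun x => ENNReal.ofReal (ρ x)))
    (hρ : ∀ x ∈ Set.Ioo (0:ℝ) 1, ρ x ≤ V * x ^ (-γ))
    (f : ℝ → ℝ) (hfm : Measurable f)
    (hfpos : ∀ x ∈ Set.Ioo (0:ℝ) 1, 0 < f x)
    (hfmono : MonotoneOn f (Set.Ioo (0:ℝ) 1))
    (C a : ℝ) (hC : 0 < C) (ha : 0 ≤ a) (ha' : a < 1/2 - γ / (2 * (1 - γ)))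
    (hfb : ∀ x ∈ Set.Ioo (0:ℝ) 1, f x ≤ C * (1 - x) ^ (-a)) :
    (0 < a → ∀ t : ℝ, C < t →
      ν {x | t < f x} ≤ ENNReal.ofReal
        (V / (1 - γ) * (1 - (1 - (C / t) ^ (1/a)) ^ (1 - γ)))) ∧
    ∃ v : ℝ≥0, ∀ g : BoundedContinuousFunction ℝ ℝ,
      Tendsto (fun n : ℕ => ∫ x, g ((n : ℝ) ^ (-(1:ℝ)/2) *
          Sn γ (fun z => f z - ∫ y, f y ∂ν) n x) ∂ν)
        atTop (𝓝 (∫ y, g y ∂(gaussianReal 0 v))) := by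
  obtain ⟨hγ0, hγ1⟩ := hγ
  have hdom : ν ≤ powerMeasure γ V := by
    rw [hν]
    exact withDensity_le_powerMeasure hρ
  have hT : MeasurePreserving (Tmap γ) ν ν := ⟨measurable_Tmap γ, hinv⟩
  refine ⟨fun ha0 t ht => ?_, ?_⟩
  · have ht0 : 0 < t := hC.trans ht
    have hq0 : 0 < C / t := by positivity
    have hs1 : (C / t) ^ (1 / a) ≤ 1 :=
      Real.rpow_le_one hq0.le ((div_le_one ht0).2 ht.le) (by positivity)
    have hs0 : 0 < (C / t) ^ (1 / a) := by positivity
    refine measure_le_of_subset_Ioi (by linarith) hV hdom (measurableSet_lt measurable_const hfm)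
      ⟨by linarith, by linarith⟩ fun x hx (hxt : t < f x) => ?_
    have h1x : 0 < 1 - x := by linarith [hx.2]
    have h1 : t < C * ((1 - x) ^ a)⁻¹ := by
      rw [← Real.rpow_neg h1x.le]
      exact hxt.trans_le (hfb x hx)
    have h2 : (1 - x) ^ a ≤ C / t := by
      rw [← div_eq_mul_inv, lt_div_iff₀ (by positivity)] at h1
      rw [le_div_iff₀ ht0]
      linarith
    have h3 := Real.rpow_le_rpow (by positivity) h2 (by positivity : 0 ≤ 1 / a)
    rw [← Real.rpow_mul h1x.le, mul_one_div_cancel ha0.ne', Real.rpow_one] at h3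
    linarith
  · set F := (Ioo (0 : ℝ) 1).indicator f with hFdef
    have hFin : ∀ x ∈ Ioo (0 : ℝ) 1, F x = f x := fun x hx => indicator_of_mem hx f
    have hFf : F =ᵐ[ν] f := by
      filter_upwards [ae_mem_Ioo_of_le_powerMeasure hdom] with x hx using hFin x hx
    obtain ⟨v, hv⟩ := exists_gaussian_limit_of_monotoneOn (F := F) hγ0 hγ1 hV hdom hT
      (hfm.indicator measurableSet_Ioo) (indicator_nonneg fun x hx => (hfpos x hx).le)
      (indicator_of_notMem (by simp) f)
      (fun x hx y hy hxy => by rw [hFin x hx, hFin y hy]; exact hfmono hx hy hxy)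
      (fun x hx => by rw [hFin x hx]; exact hfb x hx) hC ha ha'
    refine ⟨v, fun g => (hv g).congr fun n => integral_congr_ae ?_⟩
    have hall : ∀ᵐ x ∂ν, ∀ i : ℕ, F ((Tmap γ)^[i + 1] x) = f ((Tmap γ)^[i + 1] x) :=
      ae_all_iff.2 fun i => (hT.iterate (i + 1)).quasiMeasurePreserving.ae hFf
    filter_upwards [hall] with x hx
    simp only [Sn, hx, integral_congr_ae hFf]

end
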